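/- There exists a universal constant C_A > 0 such that the following holds. Fix z̄ = (x̄,t̄) ∈ ℝ³×ℝ and suppose u,d:Q₁(z̄)→ℝ³, p:Q₁(z̄)→ℝ have the Q₁(z̄)-regularity and satisfy the weak pressure equation −∫_{Q₁(z̄)} pΔψ dz = ∫_{Q₁(z̄)}(u⊗u+∇d⊙∇d):∇²ψ dz for all ψ∈C_c^∞(Q₁(z̄)). Then for every z₀ ∈ Q_{1/2}(z̄) and every integer n ≥ 2: R_{n+1}(z₀) ≤ C_A ( max_{1≤k≤n} L_k(z₀)^{3/2} + ‖p‖_{L^{3/2}(Q_{1/2}(z₀))}^{3/2} ). -/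

import Mathlib

open MeasureTheory Set Filter
open scoped ENNReal NNReal

noncomputable section

abbrev E3 : Type := EuclideanSpace ℝ (Fin 3)

/-- Space-time `ℝ³ × ℝ`. -/
abbrev SpT : Type := E3 × ℝ

/-- Spatial partial derivative `∂_j` of a function on space-time. -/
def sderiv (j : Fin 3) (ψ : SpT → ℝ) (z : SpT) : ℝ :=
  fderiv ℝ ψ z ((EuclideanSpace.single j 1 : E3), (0 : ℝ))

/-- Time derivative `∂_t` of a function on space-time. -/
def tderiv (ψ : SpT → ℝ) (z : SpT) : ℝ :=
  fderiv ℝ ψ z ((0 : E3), (1 : ℝ))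

/-- Spatial Laplacian of a function on space-time. -/
def sLap (ψ : SpT → ℝ) (z : SpT) : ℝ := ∑ j, sderiv j (sderiv j ψ) z

/-- `ψ ∈ C_c^∞(U)`. -/
def IsTestOn (U : Set SpT) (ψ : SpT → ℝ) : Prop :=
  ContDiff ℝ (⊤ : ℕ∞) ψ ∧ HasCompactSupport ψ ∧ tsupport ψ ⊆ U

/-- `g` is the weak spatial gradient of `f` on `U`. -/
def WeakSGrad (U : Set SpT) (f : SpT → ℝ) (g : Fin 3 → SpT → ℝ) : Prop :=
  ∀ (j : Fin 3) (ψ : SpT → ℝ), IsTestOn U ψ →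
    ∫ z in U, f z * sderiv j ψ z = - ∫ z in U, g j z * ψ z

/-- Squared Frobenius norm of a `3×3` array, e.g. `|∇v|² = Σ_{i,j} (∂_j v_i)²`. -/
def nsq2 (M : Fin 3 → Fin 3 → ℝ) : ℝ := ∑ i, ∑ j, (M i j) ^ 2

/-- Squared norm of a `3×3×3` array, e.g. `|∇²d|² = Σ_{i,j,k} (∂_j ∂_k d_i)²`. -/
def nsq3 (A : Fin 3 → Fin 3 → Fin 3 → ℝ) : ℝ := ∑ i, ∑ j, ∑ k, (A i j k) ^ 2

/-- Open Euclidean ball in `ℝ³`. -/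
def ball3 (x : E3) (r : ℝ) : Set E3 := Metric.ball x r

/-- Parabolic cylinder `Q_r(z₀) = B_r(x₀) × (t₀ - r², t₀)`. -/
def Qcyl (z : SpT) (r : ℝ) : Set SpT := ball3 z.1 r ×ˢ Ioo (z.2 - r ^ 2) z.2

/-- Centered parabolic cylinder `Q*_r(z₀) = B_r(x₀) × (t₀ - (7/8)r², t₀ + (1/8)r²)`. -/
def Qstar (z : SpT) (r : ℝ) : Set SpT :=
  ball3 z.1 r ×ˢ Ioo (z.2 - 7 / 8 * r ^ 2) (z.2 + 1 / 8 * r ^ 2)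

/-- The time interval `I*_r(t₀) = (t₀ - (7/8)r², t₀ + (1/8)r²)`. -/
def Istar (t₀ r : ℝ) : Set ℝ := Ioo (t₀ - 7 / 8 * r ^ 2) (t₀ + 1 / 8 * r ^ 2)

/-- `u` is weakly divergence free on `U`. -/
def DivFreeOn (U : Set SpT) (u : SpT → E3) : Prop :=
  ∀ ψ : SpT → ℝ, IsTestOn U ψ → ∫ z in U, ∑ j, u z j * sderiv j ψ z = 0

/-- The weak pressure equation `-Δp = ∇·(∇ᵀ·(u⊗u + ∇d⊙∇d))` on `U`. -/
def PressureEqOn (U : Set SpT) (u : SpT → E3) (p : SpT → ℝ)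
    (Dd : SpT → Fin 3 → Fin 3 → ℝ) : Prop :=
  ∀ ψ : SpT → ℝ, IsTestOn U ψ →
    -∫ z in U, p z * sLap ψ z =
      ∫ z in U, ∑ i, ∑ j, (u z i * u z j + ∑ k, Dd z k i * Dd z k j) *
        sderiv i (sderiv j ψ) z

/-- The `Q₁(z̄)`-regularity of `(u,d,p)`, with weak spatial gradients `Du`, `Dd`, `D2d`
(`Du z i j = ∂_j u_i`, `Dd z i j = ∂_j d_i`, `D2d z i j k = ∂_j ∂_k d_i`). -/
structure QReg (xb : E3) (tb : ℝ) (u d : SpT → E3) (p : SpT → ℝ)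
    (Du Dd : SpT → Fin 3 → Fin 3 → ℝ) (D2d : SpT → Fin 3 → Fin 3 → Fin 3 → ℝ) : Prop where
  meas_u : Measurable u
  meas_d : Measurable d
  meas_p : Measurable p
  meas_Du : Measurable Du
  meas_Dd : Measurable Dd
  meas_D2d : Measurable D2d
  grad_u : ∀ i : Fin 3, WeakSGrad (Qcyl (xb, tb) 1) (fun z => u z i) (fun j z => Du z i j)
  grad_d : ∀ i : Fin 3, WeakSGrad (Qcyl (xb, tb) 1) (fun z => d z i) (fun j z => Dd z i j)
  grad_Dd : ∀ i k : Fin 3,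
    WeakSGrad (Qcyl (xb, tb) 1) (fun z => Dd z i k) (fun j z => D2d z i j k)
  linf_u : ∃ M : ℝ, ∀ᵐ t ∂(volume.restrict (Ioo (tb - 1) tb)),
    ∫ x in ball3 xb 1, ‖u (x, t)‖ ^ 2 ≤ M
  linf_d : ∃ M : ℝ, ∀ᵐ t ∂(volume.restrict (Ioo (tb - 1) tb)),
    ∫ x in ball3 xb 1, ‖d (x, t)‖ ^ 2 ≤ M
  linf_Dd : ∃ M : ℝ, ∀ᵐ t ∂(volume.restrict (Ioo (tb - 1) tb)),
    ∫ x in ball3 xb 1, nsq2 (Dd (x, t)) ≤ M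
  l2_Du : IntegrableOn (fun z => nsq2 (Du z)) (Qcyl (xb, tb) 1)
  l2_Dd : IntegrableOn (fun z => nsq2 (Dd z)) (Qcyl (xb, tb) 1)
  l2_D2d : IntegrableOn (fun z => nsq3 (D2d z)) (Qcyl (xb, tb) 1)
  l32_p : IntegrableOn (fun z => |p z| ^ ((3 : ℝ) / 2)) (Qcyl (xb, tb) 1)

/-- The dyadic radius `r_k = 2^{-k}`. -/
def rdy (k : ℕ) : ℝ := (1 / 2 : ℝ) ^ k

/-- The quantity `L_k(z₀)`. -/
def Ldy (u : SpT → E3) (Du Dd : SpT → Fin 3 → Fin 3 → ℝ)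
    (D2d : SpT → Fin 3 → Fin 3 → Fin 3 → ℝ) (z₀ : SpT) (k : ℕ) : ℝ≥0∞ :=
  essSup (fun t => (volume (ball3 z₀.1 (rdy k)))⁻¹ *
      ∫⁻ x in ball3 z₀.1 (rdy k), ENNReal.ofReal (‖u (x, t)‖ ^ 2 + nsq2 (Dd (x, t))))
    (volume.restrict (Ioo (z₀.2 - rdy k ^ 2) z₀.2)) +
  (volume (ball3 z₀.1 (rdy k)))⁻¹ *
    ∫⁻ z in Qcyl z₀ (rdy k), ENNReal.ofReal (nsq2 (Du z) + nsq3 (D2d z))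

/-- The quantity `R_k(z₀)`. -/
def Rdy (u : SpT → E3) (p : SpT → ℝ) (Dd : SpT → Fin 3 → Fin 3 → ℝ)
    (z₀ : SpT) (k : ℕ) : ℝ≥0∞ :=
  (volume (Qcyl z₀ (rdy k)))⁻¹ *
    ∫⁻ z in Qcyl z₀ (rdy k), ENNReal.ofReal (‖u z‖ ^ 3 + Real.sqrt (nsq2 (Dd z)) ^ 3) +
  ENNReal.ofReal (rdy k ^ ((1 : ℝ) / 3)) * ((volume (Qcyl z₀ (rdy k)))⁻¹ *
    ∫⁻ z in Qcyl z₀ (rdy k),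
      ENNReal.ofReal (‖u z‖ * abs (p z - ⨍ x in ball3 z₀.1 (rdy k), p (x, z.2))))

open scoped Topology Convolution

/-- Partial derivative of a function on `ℝ³`. -/
def pd (j : Fin 3) (φ : E3 → ℝ) (x : E3) : ℝ := fderiv ℝ φ x (EuclideanSpace.single j 1)

/-- `φ ∈ C_c^∞(B)` for `B ⊆ ℝ³`. -/
def IsSpaceTest (B : Set E3) (φ : E3 → ℝ) : Prop :=
  ContDiff ℝ (⊤ : ℕ∞) φ ∧ HasCompactSupport φ ∧ tsupport φ ⊆ B

/-- Convolution of real-valued functions on `ℝ³`. -/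
def cv (K g : E3 → ℝ) : E3 → ℝ := K ⋆[ContinuousLinearMap.lsmul ℝ ℝ, volume] g

lemma cv_apply (K g : E3 → ℝ) (x : E3) : cv K g x = ∫ y, K (x - y) * g y := by
  simp only [cv, convolution_lsmul_swap, smul_eq_mul]

lemma contDiff_pd {φ : E3 → ℝ} (hφ : ContDiff ℝ (⊤ : ℕ∞) φ) (j : Fin 3) :
    ContDiff ℝ (⊤ : ℕ∞) (pd j φ) := by
  have : ContDiff ℝ (⊤ : ℕ∞) (fderiv ℝ φ) := hφ.fderiv_right (by simp)
  exact this.clm_apply contDiff_const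

lemma tsupport_pd_subset (φ : E3 → ℝ) (j : Fin 3) : tsupport (pd j φ) ⊆ tsupport φ :=
  tsupport_fderiv_apply_subset ℝ _

lemma IsSpaceTest.pd {B : Set E3} {φ : E3 → ℝ} (h : IsSpaceTest B φ) (j : Fin 3) :
    IsSpaceTest B (pd j φ) :=
  ⟨contDiff_pd h.1 j, h.2.1.fderiv_apply ℝ _, (tsupport_pd_subset φ j).trans h.2.2⟩

lemma cv_comm (K g : E3 → ℝ) : cv K g = cv g K := by
  ext x
  rw [cv_apply]
  simp only [cv, convolution_def, ContinuousLinearMap.lsmul_apply, smul_eq_mul]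
  exact integral_congr_ae (ae_of_all _ fun y => mul_comm _ _)

lemma hasFDerivAt_cv {K g : E3 → ℝ} (hK : ContDiff ℝ 1 K) (hKc : HasCompactSupport K)
    (hg : LocallyIntegrable g) (x : E3) :
    HasFDerivAt (cv K g)
      ((g ⋆[(ContinuousLinearMap.lsmul ℝ ℝ).precompR E3, volume] fderiv ℝ K) x) x := by
  rw [cv_comm]
  exact hKc.hasFDerivAt_convolution_right _ hg hK x

lemma pd_cv {K g : E3 → ℝ} (hK : ContDiff ℝ 1 K) (hKc : HasCompactSupport K)
    (hg : LocallyIntegrable g) (j : Fin 3) : pd j (cv K g) = cv (pd j K) g := by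
  ext x
  rw [pd, (hasFDerivAt_cv hK hKc hg x).fderiv,
    convolution_precompR_apply _ hg (hKc.fderiv ℝ) (hK.continuous_fderiv one_ne_zero), cv_comm]
  rfl

lemma contDiff_cv {K g : E3 → ℝ} {n : ℕ∞} (hK : ContDiff ℝ n K) (hKc : HasCompactSupport K)
    (hg : LocallyIntegrable g) : ContDiff ℝ n (cv K g) := by
  rw [cv_comm]
  exact hKc.contDiff_convolution_right _ hg hK

lemma cv_eq_zero {K g : E3 → ℝ} {x₀ : E3} {a b : ℝ} (hK : ∀ x, a ≤ ‖x‖ → K x = 0)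
    (hg : ∀ x, b ≤ dist x x₀ → g x = 0) {x : E3} (hx : a + b ≤ dist x x₀) : cv K g x = 0 := by
  rw [cv_apply]
  refine integral_eq_zero_of_ae (ae_of_all _ fun y => ?_)
  by_cases h : b ≤ dist y x₀
  · simp [hg y h]
  · have : dist x x₀ ≤ dist x y + dist y x₀ := dist_triangle _ _ _
    rw [dist_eq_norm x y] at this
    simp [hK (x - y) (by linarith)]

lemma tsupport_subset_closedBall {f : E3 → ℝ} {x₀ : E3} {a : ℝ}
    (hf : ∀ x, a ≤ dist x x₀ → f x = 0) : tsupport f ⊆ Metric.closedBall x₀ a := by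
  refine closure_minimal (fun x hx => ?_) Metric.isClosed_closedBall
  by_contra h
  exact hx (hf x (by simp only [Metric.mem_closedBall, not_le] at h; exact h.le))

lemma lintegral_mul_sq_le {α : Type*} [MeasurableSpace α] {μ : Measure α} {k f : α → ℝ≥0∞}
    (hk : AEMeasurable k μ) (hf : AEMeasurable f μ) :
    (∫⁻ y, k y * f y ∂μ) ^ 2 ≤ (∫⁻ y, k y ∂μ) * ∫⁻ y, k y * f y ^ 2 ∂μ := by
  have hh := ENNReal.lintegral_mul_le_Lp_mul_Lq μ Real.HolderConjugate.two_two
    (f := fun y => k y ^ (1 / 2 : ℝ)) (g := fun y => k y ^ (1 / 2 : ℝ) * f y)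
    (hk.pow_const _) ((hk.pow_const _).mul hf)
  have e1 : ∀ y, k y ^ (1 / 2 : ℝ) * k y ^ (1 / 2 : ℝ) = k y := fun y => by
    rw [← ENNReal.rpow_add_of_nonneg _ _ (by norm_num) (by norm_num)]; norm_num
  have e2 : ∀ a : ℝ≥0∞, (a ^ (1 / 2 : ℝ)) ^ (2 : ℝ) = a := fun a => by
    rw [← ENNReal.rpow_mul]; norm_num
  have e3 : ∀ a : ℝ≥0∞, (a ^ (1 / 2 : ℝ)) ^ 2 = a := fun a => by
    rw [← ENNReal.rpow_two, e2]
  simp only [Pi.mul_apply, ← mul_assoc, e1, ENNReal.mul_rpow_of_nonneg _ _ zero_le_two, e2,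
    ENNReal.rpow_two] at hh
  calc _ ≤ _ := pow_le_pow_left' hh 2
    _ = _ := by rw [mul_pow, e3, e3]

/-- Young's convolution inequality `L¹ * L² → L²`. -/
lemma lintegral_cv_sq_le {K g : E3 → ℝ} (hK : Measurable K) (hg : Measurable g) :
    ∫⁻ x, ‖cv K g x‖ₑ ^ 2 ≤ (∫⁻ x, ‖K x‖ₑ) ^ 2 * ∫⁻ x, ‖g x‖ₑ ^ 2 := by
  have hm : Measurable fun z : E3 × E3 => ‖K (z.1 - z.2)‖ₑ * ‖g z.2‖ₑ ^ 2 := by fun_prop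
  calc ∫⁻ x, ‖cv K g x‖ₑ ^ 2
      ≤ ∫⁻ x, (∫⁻ y, ‖K y‖ₑ) * ∫⁻ y, ‖K (x - y)‖ₑ * ‖g y‖ₑ ^ 2 := by
        refine lintegral_mono fun x => ?_
        have h1 : ‖cv K g x‖ₑ ≤ ∫⁻ y, ‖K (x - y)‖ₑ * ‖g y‖ₑ := by
          rw [cv_apply]
          refine (enorm_integral_le_lintegral_enorm _).trans (le_of_eq ?_)
          simp only [enorm_mul]
        refine (pow_le_pow_left' h1 2).trans ?_
        refine (lintegral_mul_sq_le (by fun_prop) (by fun_prop)).trans (le_of_eq ?_)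
        rw [lintegral_sub_left_eq_self (fun y => ‖K y‖ₑ) x]
    _ = (∫⁻ y, ‖K y‖ₑ) * ∫⁻ y, ∫⁻ x, ‖K (x - y)‖ₑ * ‖g y‖ₑ ^ 2 := by
        rw [lintegral_const_mul _ hm.lintegral_prod_right', lintegral_lintegral_swap hm.aemeasurable]
    _ = _ := by
        have : ∀ y, ∫⁻ x, ‖K (x - y)‖ₑ * ‖g y‖ₑ ^ 2 = (∫⁻ x, ‖K x‖ₑ) * ‖g y‖ₑ ^ 2 := fun y => by
          rw [lintegral_mul_const _ (by fun_prop),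
            lintegral_sub_right_eq_self (fun y => ‖K y‖ₑ) y]
        simp only [this]
        rw [lintegral_const_mul _ (by fun_prop), sq, mul_assoc]

lemma pd_comm {φ : E3 → ℝ} (hφ : ContDiff ℝ (⊤ : ℕ∞) φ) (i j : Fin 3) :
    pd i (pd j φ) = pd j (pd i φ) := by
  ext x
  have hd : DifferentiableAt ℝ (fderiv ℝ φ) x :=
    ((hφ.fderiv_right (m := 1) (by norm_cast)).differentiable one_ne_zero) x
  have h : ∀ v w : E3, fderiv ℝ (fun y => fderiv ℝ φ y v) x w = fderiv ℝ (fderiv ℝ φ) x w v := by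
    intro v w
    rw [fderiv_clm_apply hd (differentiableAt_const v)]
    simp
  have hs : IsSymmSndFDerivAt ℝ φ x := by
    refine hφ.contDiffAt.isSymmSndFDerivAt ?_
    simp only [minSmoothness_of_isRCLikeNormedField]
    norm_cast
  unfold pd
  rw [h, h, hs.eq]

lemma integral_mul_pd {f g : E3 → ℝ} (hf : ContDiff ℝ (⊤ : ℕ∞) f) (hg : ContDiff ℝ (⊤ : ℕ∞) g)
    (hfc : HasCompactSupport f) (j : Fin 3) :
    ∫ x, f x * pd j g x = - ∫ x, pd j f x * g x := by
  have h1 := (contDiff_pd hf j).continuous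
  have h2 := (contDiff_pd hg j).continuous
  refine integral_mul_fderiv_eq_neg_fderiv_mul_of_integrable ?_ ?_ ?_
    (fun x _ => hf.differentiable (by simp) x) (fun x _ => hg.differentiable (by simp) x)
  · exact (h1.mul hg.continuous).integrable_of_hasCompactSupport
      ((hfc.fderiv_apply ℝ _).mul_right)
  · exact (hf.continuous.mul h2).integrable_of_hasCompactSupport hfc.mul_right
  · exact (hf.continuous.mul hg.continuous).integrable_of_hasCompactSupport hfc.mul_right

/-- `‖∇²ψ‖₂ = ‖Δψ‖₂` for `ψ ∈ C_c^∞(ℝ³)`. -/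
lemma integral_hessian_sq {ψ : E3 → ℝ} (hψ : ContDiff ℝ (⊤ : ℕ∞) ψ) (hc : HasCompactSupport ψ) :
    ∑ i, ∑ j, ∫ x, (pd i (pd j ψ) x) ^ 2 = ∫ x, (∑ i, pd i (pd i ψ) x) ^ 2 := by
  have hcp : ∀ {φ : E3 → ℝ}, HasCompactSupport φ → ∀ j, HasCompactSupport (pd j φ) :=
    fun h j => h.fderiv_apply ℝ _
  have key : ∀ i j, ∫ x, (pd i (pd j ψ) x) ^ 2 = ∫ x, pd i (pd i ψ) x * pd j (pd j ψ) x := by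
    intro i j
    have e1 := integral_mul_pd (contDiff_pd (contDiff_pd hψ j) i) (contDiff_pd hψ j)
      (hcp (hcp hc j) i) i
    have e2 := integral_mul_pd (contDiff_pd (contDiff_pd hψ i) i) (contDiff_pd hψ j)
      (hcp (hcp hc i) i) j
    have e3 : pd i (pd i (pd j ψ)) = pd j (pd i (pd i ψ)) := by
      rw [pd_comm hψ i j, pd_comm (contDiff_pd hψ i) i j]
    simp only [sq]
    rw [e1, e3, e2]
  simp only [key]
  have hint : ∀ i j, Integrable fun x => pd i (pd i ψ) x * pd j (pd j ψ) x := fun i j =>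
    ((contDiff_pd (contDiff_pd hψ i) i).continuous.mul
      (contDiff_pd (contDiff_pd hψ j) j).continuous).integrable_of_hasCompactSupport
      (hcp (hcp hc i) i).mul_right
  simp only [sq, Finset.sum_mul_sum]
  rw [integral_finsetSum _ fun i _ => integrable_finsetSum _ fun j _ => hint i j]
  refine Finset.sum_congr rfl fun i _ => ?_
  rw [integral_finsetSum _ fun j _ => hint i j]

lemma pd_comp_smul {φ : E3 → ℝ} (hφ : Differentiable ℝ φ) (a c : ℝ) (j : Fin 3) :
    pd j (fun x => c * φ (a • x)) = fun x => (c * a) * pd j φ (a • x) := by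
  ext x
  have h1 : HasFDerivAt (fun x : E3 => a • x) (a • ContinuousLinearMap.id ℝ E3) x :=
    (hasFDerivAt_id x).const_smul a
  have h2 := (((hφ (a • x)).hasFDerivAt).comp x h1).const_mul c
  have h3 : fderiv ℝ (fun x => c * φ (a • x)) x
    = c • ((fderiv ℝ φ (a • x)).comp (a • ContinuousLinearMap.id ℝ E3)) := h2.fderiv
  rw [pd, h3]
  simp [pd, mul_assoc]

/-- Radial profile of the gradient of a regularised Newtonian kernel. -/
def kerGrad (s : ℝ) : ℝ := s ^ (-(3 / 2) : ℝ) * Real.smoothTransition (8 * s - 1)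

/-- Radial profile of a regularised Newtonian kernel. -/
def kerProfile (s : ℝ) : ℝ := 2 - ∫ σ in (1 / 4 : ℝ)..s, kerGrad σ / 2

/-- A smooth function equal to `1 / ‖x‖` for `‖x‖ ≥ 1 / 2`. -/
def newt (x : E3) : ℝ := kerProfile (‖x‖ ^ 2)

/-- The bump `-Δ newt`. -/
def kerBump (x : E3) : ℝ := 3 * kerGrad (‖x‖ ^ 2) + 2 * ‖x‖ ^ 2 * deriv kerGrad (‖x‖ ^ 2)

lemma contDiff_transition : ContDiff ℝ (⊤ : ℕ∞) fun s : ℝ => Real.smoothTransition (8 * s - 1) :=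
  Real.smoothTransition.contDiff.comp (by fun_prop)

lemma kerGrad_eventually_zero {s : ℝ} (hs : s < 1 / 8) : kerGrad =ᶠ[𝓝 s] 0 := by
  filter_upwards [Iio_mem_nhds hs] with t ht
  simp only [mem_Iio] at ht
  simp [kerGrad, Real.smoothTransition.zero_of_nonpos (show 8 * t - 1 ≤ 0 by linarith)]

lemma contDiff_kerGrad : ContDiff ℝ (⊤ : ℕ∞) kerGrad := by
  rw [contDiff_iff_contDiffAt]
  intro s
  by_cases hs : s < 1 / 8
  · exact (contDiffAt_const (c := (0 : ℝ))).congr_of_eventuallyEq (kerGrad_eventually_zero hs)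
  · have : s ≠ 0 := by intro h; rw [h] at hs; norm_num at hs
    exact (Real.contDiffAt_rpow_const_of_ne this).mul contDiff_transition.contDiffAt

lemma hasDerivAt_kerProfile (s : ℝ) : HasDerivAt kerProfile (-(kerGrad s / 2)) s := by
  have hc : Continuous fun σ => kerGrad σ / 2 := contDiff_kerGrad.continuous.div_const _
  exact (intervalIntegral.integral_hasDerivAt_right (hc.intervalIntegrable _ _)
    (hc.stronglyMeasurableAtFilter _ _) hc.continuousAt).const_sub 2

lemma contDiff_kerProfile : ContDiff ℝ (⊤ : ℕ∞) kerProfile := by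
  rw [contDiff_infty_iff_deriv]
  refine ⟨fun s => (hasDerivAt_kerProfile s).differentiableAt, ?_⟩
  rw [show deriv kerProfile = fun s => -(kerGrad s / 2) from
    funext fun s => (hasDerivAt_kerProfile s).deriv]
  exact (contDiff_kerGrad.div_const 2).neg

lemma contDiff_newt : ContDiff ℝ (⊤ : ℕ∞) newt := contDiff_kerProfile.comp (contDiff_norm_sq ℝ)

lemma kerProfile_eq {s : ℝ} (hs : 1 / 4 ≤ s) : kerProfile s = s ^ (-(1 / 2) : ℝ) := by
  have h : ∫ σ in (1 / 4 : ℝ)..s, kerGrad σ / 2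
      = -(s ^ (-(1 / 2) : ℝ)) - -((1 / 4 : ℝ) ^ (-(1 / 2) : ℝ)) := by
    refine intervalIntegral.integral_eq_sub_of_hasDerivAt (f := fun s : ℝ => -(s ^ (-(1 / 2) : ℝ)))
      (fun σ hσ => ?_)
      ((contDiff_kerGrad.continuous.div_const _).intervalIntegrable _ _)
    rw [uIcc_of_le hs] at hσ
    have h0 : 0 < σ := by linarith [hσ.1]
    have h1 := (Real.hasDerivAt_rpow_const (x := σ) (p := (-(1 / 2) : ℝ)) (Or.inl h0.ne')).neg
    refine h1.congr_deriv ?_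
    rw [kerGrad, Real.smoothTransition.one_of_one_le (by linarith [hσ.1])]
    norm_num
    ring
  have h2 : ((1 / 4 : ℝ) ^ (-(1 / 2) : ℝ)) = 2 := by
    rw [show (1 / 4 : ℝ) = 2 ^ (-2 : ℝ) by norm_num [Real.rpow_neg], ← Real.rpow_mul (by norm_num)]
    norm_num
  rw [kerProfile, h, h2]
  ring

lemma newt_eq {x : E3} (hx : 1 / 2 ≤ ‖x‖) : newt x = ‖x‖⁻¹ := by
  rw [newt, kerProfile_eq (by nlinarith), ← Real.rpow_natCast, ← Real.rpow_mul (norm_nonneg _),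
    ← Real.rpow_neg_one]
  norm_num

lemma pd_radial {f : ℝ → ℝ} (hf : Differentiable ℝ f) (j : Fin 3) (x : E3) :
    pd j (fun y => f (‖y‖ ^ 2)) x = 2 * x j * deriv f (‖x‖ ^ 2) := by
  have h := ((hf (‖x‖ ^ 2)).hasDerivAt).comp_hasFDerivAt x (hasStrictFDerivAt_norm_sq x).hasFDerivAt
  rw [pd, show fderiv ℝ (fun y : E3 => f (‖y‖ ^ 2)) x = _ from h.fderiv]
  simp [EuclideanSpace.inner_single_right]
  ring

lemma pd_newt (j : Fin 3) : pd j newt = fun x => - (x j * kerGrad (‖x‖ ^ 2)) := by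
  ext x
  rw [show newt = fun y => kerProfile (‖y‖ ^ 2) from rfl,
    pd_radial (contDiff_kerProfile.differentiable (by simp)), (hasDerivAt_kerProfile _).deriv]
  ring

lemma laplacian_newt (x : E3) : ∑ j, pd j (pd j newt) x = - kerBump x := by
  have hd : Differentiable ℝ kerGrad := contDiff_kerGrad.differentiable (by simp)
  have h : ∀ j, pd j (pd j newt) x
      = - kerGrad (‖x‖ ^ 2) - 2 * x j ^ 2 * deriv kerGrad (‖x‖ ^ 2) := by
    intro j
    rw [pd_newt, pd]
    have h1 : HasFDerivAt (fun y : E3 => y j) (EuclideanSpace.proj j : E3 →L[ℝ] ℝ) x :=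
      (EuclideanSpace.proj j : E3 →L[ℝ] ℝ).hasFDerivAt
    have hdr : Differentiable ℝ fun y : E3 => kerGrad (‖y‖ ^ 2) :=
      hd.comp ((contDiff_norm_sq ℝ (n := 1)).differentiable one_ne_zero)
    have h3 := (h1.mul (hdr x).hasFDerivAt).neg
    have h4 := pd_radial hd j x
    rw [pd] at h4
    rw [show fderiv ℝ (fun x : E3 => -(x j * kerGrad (‖x‖ ^ 2))) x = _ from h3.fderiv]
    simp [h4]
    ring
  simp only [h, kerBump, Fin.sum_univ_three]
  have : ‖x‖ ^ 2 = x 0 ^ 2 + x 1 ^ 2 + x 2 ^ 2 := by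
    rw [EuclideanSpace.norm_sq_eq]; simp [Fin.sum_univ_three]
  rw [this]; ring

lemma contDiff_kerBump : ContDiff ℝ (⊤ : ℕ∞) kerBump := by
  have h1 : ContDiff ℝ (⊤ : ℕ∞) (deriv kerGrad) := contDiff_kerGrad.deriv' 
  have h2 : ContDiff ℝ (⊤ : ℕ∞) fun x : E3 => ‖x‖ ^ 2 := contDiff_norm_sq ℝ
  exact (contDiff_const.mul (contDiff_kerGrad.comp h2)).add
    ((contDiff_const.mul h2).mul (h1.comp h2))

lemma kerBump_eq {x : E3} (hx : 0 < ‖x‖) :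
    kerBump x = 2 * (‖x‖ ^ 2) ^ (-(1 / 2) : ℝ)
      * deriv (fun s : ℝ => Real.smoothTransition (8 * s - 1)) (‖x‖ ^ 2) := by
  rw [kerBump]
  set s := ‖x‖ ^ 2 with hs
  have h0 : 0 < s := by positivity
  have hT := (contDiff_transition.differentiable (by simp) s).hasDerivAt
  have h1 := (Real.hasDerivAt_rpow_const (x := s) (p := (-(3 / 2) : ℝ)) (Or.inl h0.ne')).mul hT
  rw [show deriv kerGrad s = _ from h1.deriv, kerGrad]
  have e1 : s ^ (-(3 / 2) - 1 : ℝ) = s ^ (-(3 / 2) : ℝ) / s := by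
    rw [Real.rpow_sub h0, Real.rpow_one]
  have e2 : s ^ (-(3 / 2) : ℝ) = s ^ (-(1 / 2) : ℝ) / s := by
    rw [show (-(3 / 2) : ℝ) = -(1 / 2) - 1 by norm_num, Real.rpow_sub h0, Real.rpow_one]
  rw [e1, e2]
  field_simp
  ring

lemma kerBump_zero {x : E3} (hx : 1 / 2 ≤ ‖x‖) : kerBump x = 0 := by
  have hm : IsLocalMax (fun s : ℝ => Real.smoothTransition (8 * s - 1)) (‖x‖ ^ 2) := by
    refine Eventually.of_forall fun t => ?_
    simp only
    rw [Real.smoothTransition.one_of_one_le (x := 8 * ‖x‖ ^ 2 - 1) (by nlinarith)]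
    exact Real.smoothTransition.le_one _
  rw [kerBump_eq (by linarith), hm.deriv_eq_zero, mul_zero]

lemma kerBump_nonneg (x : E3) : 0 ≤ kerBump x := by
  rcases (norm_nonneg x).eq_or_lt with h | h
  · have : kerGrad (‖x‖ ^ 2) = 0 :=
      (kerGrad_eventually_zero (s := ‖x‖ ^ 2) (by rw [← h]; norm_num)).eq_of_nhds
    simp [kerBump, ← h]
    rw [← h] at this
    norm_num at this
    simp [this]
  · rw [kerBump_eq h]
    have : 0 ≤ deriv (fun s : ℝ => Real.smoothTransition (8 * s - 1)) (‖x‖ ^ 2) := by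
      apply Monotone.deriv_nonneg
      exact Real.smoothTransition.monotone.comp fun a b hab => by linarith
    positivity

lemma hasCompactSupport_of_zero {f : E3 → ℝ} {a : ℝ} (hf : ∀ x, a ≤ ‖x‖ → f x = 0) :
    HasCompactSupport f :=
  HasCompactSupport.of_support_subset_isCompact (isCompact_closedBall (0 : E3) a)
    (subset_closure.trans (tsupport_subset_closedBall (x₀ := 0) (by simpa using hf)))

lemma hasCompactSupport_kerBump : HasCompactSupport kerBump :=
  hasCompactSupport_of_zero fun _ h => kerBump_zero h

lemma integral_kerBump_pos : 0 < ∫ x, kerBump x := by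
  obtain ⟨c, hc, hd⟩ := exists_deriv_eq_slope (fun s : ℝ => Real.smoothTransition (8 * s - 1))
    (show (1 / 8 : ℝ) < 1 / 4 by norm_num) contDiff_transition.continuous.continuousOn
    (contDiff_transition.differentiable (by simp)).differentiableOn
  have hc0 : 0 < c := by linarith [hc.1]
  norm_num [Real.smoothTransition.zero, Real.smoothTransition.one] at hd
  have hn : ‖(EuclideanSpace.single 0 (√c) : E3)‖ = √c := by
    simp [abs_of_nonneg (Real.sqrt_nonneg c)]
  refine contDiff_kerBump.continuous.integral_pos_of_hasCompactSupport_nonneg_nonzero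
    hasCompactSupport_kerBump kerBump_nonneg (x := EuclideanSpace.single 0 (√c)) ?_
  rw [kerBump_eq (by rw [hn]; positivity), hn, Real.sq_sqrt hc0.le, hd]
  positivity

/-- The kernel `newt` rescaled to length `a`. -/
def newtScaled (a : ℝ) (x : E3) : ℝ := a⁻¹ * newt (a⁻¹ • x)

/-- The bump `kerBump` rescaled to length `a`. -/
def bumpScaled (a : ℝ) (x : E3) : ℝ := a⁻¹ ^ 3 * kerBump (a⁻¹ • x)

/-- The compactly supported difference of two rescaled kernels. -/
def newtDiff (a b : ℝ) (x : E3) : ℝ := newtScaled a x - newtScaled b x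

lemma norm_inv_smul_ge {a : ℝ} (ha : 0 < a) {x : E3} (hx : a / 2 ≤ ‖x‖) : 1 / 2 ≤ ‖a⁻¹ • x‖ := by
  rw [norm_smul, norm_inv, Real.norm_of_nonneg ha.le, inv_mul_eq_div, le_div_iff₀ ha]
  linarith

lemma newtScaled_eq {a : ℝ} (ha : 0 < a) {x : E3} (hx : a / 2 ≤ ‖x‖) :
    newtScaled a x = ‖x‖⁻¹ := by
  rw [newtScaled, newt_eq (norm_inv_smul_ge ha hx), norm_smul, norm_inv, Real.norm_of_nonneg ha.le,
    mul_inv, inv_inv, inv_mul_cancel_left₀ ha.ne']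

lemma newtDiff_zero {a b : ℝ} (ha : 0 < a) (hab : a ≤ b) (x : E3) (hx : b / 2 ≤ ‖x‖) :
    newtDiff a b x = 0 := by
  rw [newtDiff, newtScaled_eq ha (by linarith), newtScaled_eq (ha.trans_le hab) hx, sub_self]

lemma contDiff_newtScaled (a : ℝ) : ContDiff ℝ (⊤ : ℕ∞) (newtScaled a) :=
  contDiff_const.mul (contDiff_newt.comp (contDiff_const_smul _))

lemma contDiff_newtDiff (a b : ℝ) : ContDiff ℝ (⊤ : ℕ∞) (newtDiff a b) :=
  (contDiff_newtScaled a).sub (contDiff_newtScaled b)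

lemma contDiff_bumpScaled (a : ℝ) : ContDiff ℝ (⊤ : ℕ∞) (bumpScaled a) :=
  contDiff_const.mul (contDiff_kerBump.comp (contDiff_const_smul _))

lemma bumpScaled_zero {a : ℝ} (ha : 0 < a) (x : E3) (hx : a / 2 ≤ ‖x‖) : bumpScaled a x = 0 := by
  rw [bumpScaled, kerBump_zero (norm_inv_smul_ge ha hx), mul_zero]

lemma bumpScaled_nonneg {a : ℝ} (ha : 0 < a) (x : E3) : 0 ≤ bumpScaled a x :=
  mul_nonneg (by positivity) (kerBump_nonneg _)

lemma hasCompactSupport_newtDiff {a b : ℝ} (ha : 0 < a) (hab : a ≤ b) :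
    HasCompactSupport (newtDiff a b) :=
  hasCompactSupport_of_zero (newtDiff_zero ha hab)

lemma hasCompactSupport_bumpScaled {a : ℝ} (ha : 0 < a) : HasCompactSupport (bumpScaled a) :=
  hasCompactSupport_of_zero (bumpScaled_zero ha)

lemma integral_bumpScaled {a : ℝ} (ha : 0 < a) : ∫ x, bumpScaled a x = ∫ x, kerBump x := by
  simp only [bumpScaled]
  rw [integral_const_mul, Measure.integral_comp_inv_smul_of_nonneg _ _ ha.le]
  simp only [finrank_euclideanSpace, Fintype.card_fin, smul_eq_mul, ← mul_assoc]
  rw [← mul_pow, inv_mul_cancel₀ ha.ne', one_pow, one_mul]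

lemma lintegral_bumpScaled {a : ℝ} (ha : 0 < a) :
    ∫⁻ x, ‖bumpScaled a x‖ₑ = ENNReal.ofReal (∫ x, kerBump x) := by
  have hi : Integrable (bumpScaled a) :=
    (contDiff_bumpScaled a).continuous.integrable_of_hasCompactSupport
      (hasCompactSupport_bumpScaled ha)
  rw [← integral_bumpScaled ha, ofReal_integral_eq_lintegral_ofReal hi
    (ae_of_all _ (bumpScaled_nonneg ha))]
  exact lintegral_congr fun x => Real.enorm_of_nonneg (bumpScaled_nonneg ha x)

lemma pd_sub {f g : E3 → ℝ} (hf : ContDiff ℝ (⊤ : ℕ∞) f) (hg : ContDiff ℝ (⊤ : ℕ∞) g) (j : Fin 3) :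
    pd j (fun x => f x - g x) = fun x => pd j f x - pd j g x := by
  ext x
  have := ((hf.differentiable (by simp) x).hasFDerivAt.sub
    (hg.differentiable (by simp) x).hasFDerivAt).fderiv
  rw [pd, show fderiv ℝ (fun x => f x - g x) x = _ from this]
  rfl

lemma pd_pd_scaled {f : E3 → ℝ} (hf : ContDiff ℝ (⊤ : ℕ∞) f) (a : ℝ) (i j : Fin 3) :
    pd i (pd j fun x => a⁻¹ * f (a⁻¹ • x)) = fun x => a⁻¹ ^ 3 * pd i (pd j f) (a⁻¹ • x) := by
  rw [pd_comp_smul (hf.differentiable (by simp)),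
    pd_comp_smul ((contDiff_pd hf j).differentiable (by simp))]
  ext x
  ring

lemma laplacian_newtScaled (a : ℝ) (x : E3) :
    ∑ j, pd j (pd j (newtScaled a)) x = - bumpScaled a x := by
  have : ∀ j, pd j (pd j (newtScaled a)) x = a⁻¹ ^ 3 * pd j (pd j newt) (a⁻¹ • x) := fun j =>
    congrFun (pd_pd_scaled contDiff_newt a j j) x
  simp only [this, ← Finset.mul_sum, laplacian_newt, bumpScaled]
  ring

lemma laplacian_newtDiff (a b : ℝ) (x : E3) :
    ∑ j, pd j (pd j (newtDiff a b)) x = bumpScaled b x - bumpScaled a x := by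
  have : ∀ j, pd j (pd j (newtDiff a b)) x
      = pd j (pd j (newtScaled a)) x - pd j (pd j (newtScaled b)) x := fun j => by
    rw [show newtDiff a b = fun x => newtScaled a x - newtScaled b x from rfl,
      pd_sub (contDiff_newtScaled a) (contDiff_newtScaled b),
      pd_sub (contDiff_pd (contDiff_newtScaled a) j) (contDiff_pd (contDiff_newtScaled b) j)]
  simp only [this, Finset.sum_sub_distrib, laplacian_newtScaled]
  ring

lemma newtDiff_half (b : ℝ) :
    newtDiff (b / 2) b = fun x => b⁻¹ * newtDiff (1 / 2) 1 (b⁻¹ • x) := by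
  ext x
  simp only [newtDiff, newtScaled, smul_smul]
  rw [show (1 / 2 : ℝ)⁻¹ * b⁻¹ = (b / 2)⁻¹ by rw [← mul_inv]; congr 1; ring,
    show (b / 2)⁻¹ = b⁻¹ * (1 / 2 : ℝ)⁻¹ by rw [← mul_inv]; congr 1; ring]
  simp only [inv_one, one_mul]
  ring

lemma hasCompactSupport_pd {φ : E3 → ℝ} (h : HasCompactSupport φ) (j : Fin 3) :
    HasCompactSupport (pd j φ) := h.fderiv_apply ℝ _

lemma exists_lipschitz_hessian_newtDiff : ∃ C : ℝ, 0 ≤ C ∧ ∀ b : ℝ, 0 < b → ∀ i j x y,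
    |pd i (pd j (newtDiff (b / 2) b)) x - pd i (pd j (newtDiff (b / 2) b)) y|
      ≤ C * b⁻¹ ^ 4 * dist x y := by
  have hs := contDiff_newtDiff (1 / 2) 1
  have hc : HasCompactSupport (newtDiff (1 / 2) 1) :=
    hasCompactSupport_newtDiff (by norm_num) (by norm_num)
  choose L hL using fun i j : Fin 3 => (contDiff_pd (contDiff_pd hs j) i).lipschitzWith_of_hasCompactSupport
    (hasCompactSupport_pd (hasCompactSupport_pd hc j) i) (by simp)
  refine ⟨∑ i, ∑ j, (L i j : ℝ), by positivity, fun b hb i j x y => ?_⟩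
  have hle : (L i j : ℝ) ≤ ∑ i, ∑ j, (L i j : ℝ) :=
    (Finset.single_le_sum (f := fun j => (L i j : ℝ)) (fun _ _ => by positivity)
      (Finset.mem_univ j)).trans
    (Finset.single_le_sum (f := fun i => ∑ j, (L i j : ℝ)) (fun _ _ => by positivity)
      (Finset.mem_univ i))
  rw [newtDiff_half, pd_pd_scaled hs]
  have h := (hL i j).dist_le_mul (b⁻¹ • x) (b⁻¹ • y)
  rw [dist_smul₀, Real.dist_eq, Real.norm_of_nonneg (by positivity)] at h
  rw [← mul_sub, abs_mul, abs_of_nonneg (by positivity : (0 : ℝ) ≤ b⁻¹ ^ 3)]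
  calc _ ≤ b⁻¹ ^ 3 * ((L i j : ℝ) * (b⁻¹ * dist x y)) := by gcongr
    _ ≤ b⁻¹ ^ 3 * ((∑ i, ∑ j, (L i j : ℝ)) * (b⁻¹ * dist x y)) := by gcongr
    _ = _ := by ring

/-- Convolution of a Lipschitz kernel with a function of mean zero. -/
lemma abs_cv_le_of_lipschitz {H g : E3 → ℝ} {x₀ : E3} {b c : ℝ} (hH : Continuous H)
    (hHc : HasCompactSupport H)
    (hL : ∀ x y, |H x - H y| ≤ c * dist x y) (hc : 0 ≤ c) (hg : Integrable g)
    (hgb : ∀ x, b ≤ dist x x₀ → g x = 0) (hg0 : ∫ x, g x = 0) (x : E3) :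
    |cv H g x| ≤ c * b * ∫ y, |g y| := by
  obtain ⟨M, hM⟩ := hHc.exists_bound_of_continuous hH
  have h1 : Integrable fun y => H (x - y) * g y :=
    hg.bdd_mul (c := M) (by fun_prop) (ae_of_all _ fun y => hM _)
  have h2 : cv H g x = ∫ y, (H (x - y) - H (x - x₀)) * g y := by
    simp only [sub_mul]
    rw [integral_sub h1 (hg.const_mul _), integral_const_mul, hg0, cv_apply]
    ring
  rw [h2, ← integral_const_mul]
  refine abs_integral_le_integral_abs.trans (integral_mono_of_nonneg
    (ae_of_all _ fun y => abs_nonneg _) (hg.abs.const_mul _) (ae_of_all _ fun y => ?_))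
  simp only [abs_mul]
  by_cases hy : b ≤ dist y x₀
  · simp [hgb y hy]
  · refine mul_le_mul_of_nonneg_right ((hL _ _).trans ?_) (abs_nonneg _)
    rw [dist_sub_left]
    exact mul_le_mul_of_nonneg_left (not_le.1 hy).le hc

lemma integral_abs_mul_le_sqrt {α : Type*} [MeasurableSpace α] {μ : Measure α} {f h : α → ℝ}
    (hf : AEStronglyMeasurable f μ) (hh : AEStronglyMeasurable h μ)
    (hf2 : Integrable (fun x => f x ^ 2) μ) (hh2 : Integrable (fun x => h x ^ 2) μ) :
    ∫ x, |f x| * |h x| ∂μ ≤ √(∫ x, f x ^ 2 ∂μ) * √(∫ x, h x ^ 2 ∂μ) := by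
  have := integral_mul_norm_le_Lp_mul_Lq (μ := μ) (f := f) (g := h) Real.HolderConjugate.two_two
    (by simpa using (memLp_two_iff_integrable_sq hf).2 hf2)
    (by simpa using (memLp_two_iff_integrable_sq hh).2 hh2)
  simpa [Real.sqrt_eq_rpow] using this

lemma integrable_mul_abs_of_sq {α : Type*} [MeasurableSpace α] {μ : Measure α} {f h : α → ℝ}
    (hf : AEStronglyMeasurable f μ) (hh : AEStronglyMeasurable h μ)
    (hf2 : Integrable (fun x => f x ^ 2) μ) (hh2 : Integrable (fun x => h x ^ 2) μ) :
    Integrable (fun x => |f x| * |h x|) μ :=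
  ((memLp_two_iff_integrable_sq hf).2 hf2).abs.integrable_mul
    ((memLp_two_iff_integrable_sq hh).2 hh2).abs

/-- The pressure equation `-Δp = ∂ᵢ∂ⱼFᵢⱼ` at a fixed time on the ball `B_{1/2}(x₀)`, with
`|Fᵢⱼ| ≤ Φ`. -/
structure StaticPressure (x₀ : E3) (p : E3 → ℝ) (F : Fin 3 → Fin 3 → E3 → ℝ) (Φ : E3 → ℝ) :
    Prop where
  int_p : IntegrableOn p (Metric.ball x₀ (1 / 2))
  meas_F : ∀ i j, Measurable (F i j)
  bound : ∀ i j x, |F i j x| ≤ Φ x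
  int_Φ : IntegrableOn Φ (Metric.ball x₀ (1 / 2))
  eq : ∀ φ, IsSpaceTest (Metric.ball x₀ (1 / 2)) φ →
    -∫ x in Metric.ball x₀ (1 / 2), p x * ∑ j, pd j (pd j φ) x =
      ∫ x in Metric.ball x₀ (1 / 2), ∑ i, ∑ j, F i j x * pd i (pd j φ) x

lemma StaticPressure.nonneg {x₀ : E3} {p Φ : E3 → ℝ} {F : Fin 3 → Fin 3 → E3 → ℝ}
    (h : StaticPressure x₀ p F Φ) (x : E3) : 0 ≤ Φ x :=
  (abs_nonneg _).trans (h.bound 0 0 x)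

/-- Bounded measurable functions vanishing off `B_b(x₀)`. -/
structure BddSupp (x₀ : E3) (b : ℝ) (g : E3 → ℝ) : Prop where
  meas : Measurable g
  bdd : ∃ M, ∀ x, |g x| ≤ M
  zero : ∀ x, b ≤ dist x x₀ → g x = 0

lemma BddSupp.memLp {x₀ : E3} {b : ℝ} {g : E3 → ℝ} (h : BddSupp x₀ b g) (q : ℝ≥0∞) :
    MemLp g q volume := by
  obtain ⟨M, hM⟩ := h.bdd
  have : IsFiniteMeasure (volume.restrict (Metric.ball x₀ b)) :=
    isFiniteMeasure_restrict.2 measure_ball_lt_top.ne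
  have h1 : MemLp g q (volume.restrict (Metric.ball x₀ b)) :=
    MemLp.of_bound h.meas.aestronglyMeasurable M (ae_of_all _ hM)
  rw [← memLp_indicator_iff_restrict measurableSet_ball] at h1
  convert h1 using 1
  ext x
  by_cases hx : x ∈ Metric.ball x₀ b
  · simp [hx]
  · rw [indicator_of_notMem hx, h.zero x (by simpa using hx)]

lemma BddSupp.integrable {x₀ : E3} {b : ℝ} {g : E3 → ℝ} (h : BddSupp x₀ b g) :
    Integrable g := memLp_one_iff_integrable.1 (h.memLp 1)

lemma BddSupp.integrable_sq {x₀ : E3} {b : ℝ} {g : E3 → ℝ} (h : BddSupp x₀ b g) :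
    Integrable (fun x => g x ^ 2) := (h.memLp 2).integrable_sq

lemma cv_sub {K H g : E3 → ℝ} (hK : Continuous K) (hKc : HasCompactSupport K)
    (hH : Continuous H) (hHc : HasCompactSupport H) (hg : Integrable g) (x : E3) :
    cv (fun y => K y - H y) g x = cv K g x - cv H g x := by
  obtain ⟨M, hM⟩ := hKc.exists_bound_of_continuous hK
  obtain ⟨N, hN⟩ := hHc.exists_bound_of_continuous hH
  simp only [cv_apply, sub_mul]
  exact integral_sub (hg.bdd_mul (c := M) (by fun_prop) (ae_of_all _ fun y => hM _))
    (hg.bdd_mul (c := N) (by fun_prop) (ae_of_all _ fun y => hN _))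

lemma cv_sum {K : Fin 3 → E3 → ℝ} {g : E3 → ℝ} (hK : ∀ j, Continuous (K j))
    (hKc : ∀ j, HasCompactSupport (K j)) (hg : Integrable g) (x : E3) :
    ∑ j, cv (K j) g x = cv (fun y => ∑ j, K j y) g x := by
  simp only [cv_apply, Finset.sum_mul]
  refine (integral_finsetSum _ fun j _ => ?_).symm
  obtain ⟨M, hM⟩ := (hKc j).exists_bound_of_continuous (hK j)
  have := hK j
  exact hg.bdd_mul (c := M) (by fun_prop) (ae_of_all _ fun y => hM _)

/-- The second derivatives of the potential `newtDiff a b ∗ g`. -/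
lemma pd_pd_cv_newtDiff {a b : ℝ} (ha : 0 < a) (hab : a ≤ b) {g : E3 → ℝ} (hg : Integrable g)
    (i j : Fin 3) : pd i (pd j (cv (newtDiff a b) g)) = cv (pd i (pd j (newtDiff a b))) g := by
  have hK := contDiff_newtDiff a b
  have hKc := hasCompactSupport_newtDiff ha hab
  rw [pd_cv (hK.of_le (by exact_mod_cast le_top)) hKc hg.locallyIntegrable,
    pd_cv ((contDiff_pd hK j).of_le (by exact_mod_cast le_top)) (hasCompactSupport_pd hKc j)
      hg.locallyIntegrable]

lemma laplacian_cv_newtDiff {a b : ℝ} (ha : 0 < a) (hab : a ≤ b) {g : E3 → ℝ} (hg : Integrable g)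
    (x : E3) : ∑ j, pd j (pd j (cv (newtDiff a b) g)) x
      = cv (fun y => bumpScaled b y - bumpScaled a y) g x := by
  have hK := contDiff_newtDiff a b
  have hKc := hasCompactSupport_newtDiff ha hab
  simp only [pd_pd_cv_newtDiff ha hab hg]
  rw [cv_sum (fun j => (contDiff_pd (contDiff_pd hK j) j).continuous)
    (fun j => hasCompactSupport_pd (hasCompactSupport_pd hKc j) j) hg]
  simp only [laplacian_newtDiff]

lemma isSpaceTest_cv_newtDiff {a b c : ℝ} (ha : 0 < a) (hab : a ≤ b) {x₀ : E3} {g : E3 → ℝ}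
    (hg : BddSupp x₀ c g) (hbc : b / 2 + c < 1 / 2) :
    IsSpaceTest (Metric.ball x₀ (1 / 2)) (cv (newtDiff a b) g) := by
  have h0 : tsupport (cv (newtDiff a b) g) ⊆ Metric.closedBall x₀ (b / 2 + c) :=
    tsupport_subset_closedBall fun x hx => cv_eq_zero (newtDiff_zero ha hab) hg.zero hx
  exact ⟨contDiff_cv (contDiff_newtDiff a b) (hasCompactSupport_newtDiff ha hab)
    hg.integrable.locallyIntegrable,
    (isCompact_closedBall _ _).of_isClosed_subset (isClosed_tsupport _) h0,
    h0.trans (Metric.closedBall_subset_ball hbc)⟩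

lemma continuous_cv_bump {a : ℝ} (ha : 0 < a) {g : E3 → ℝ} (hg : Integrable g) :
    Continuous (cv (bumpScaled a) g) :=
  (contDiff_cv (n := ⊤) (contDiff_bumpScaled a) (hasCompactSupport_bumpScaled ha)
    hg.locallyIntegrable).continuous

lemma abs_cv_bump_le {a : ℝ} (ha : 0 < a) {g : E3 → ℝ} {M : ℝ} (hM : ∀ x, |g x| ≤ M) (x : E3) :
    |cv (bumpScaled a) g x| ≤ (∫ y, kerBump y) * M := by
  have hi : Integrable (bumpScaled a) :=
    (contDiff_bumpScaled a).continuous.integrable_of_hasCompactSupport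
      (hasCompactSupport_bumpScaled ha)
  have h1 : (∫ y, kerBump y) * M = ∫ y, bumpScaled a (x - y) * M := by
    rw [integral_mul_const, integral_sub_left_eq_self (bumpScaled a) volume x,
      integral_bumpScaled ha]
  rw [h1, cv_apply]
  refine abs_integral_le_integral_abs.trans (integral_mono_of_nonneg
    (ae_of_all _ fun y => abs_nonneg _) ((hi.comp_sub_left x).mul_const _)
    (ae_of_all _ fun y => ?_))
  simp only [abs_mul, abs_of_nonneg (bumpScaled_nonneg ha _)]
  exact mul_le_mul_of_nonneg_left (hM _) (bumpScaled_nonneg ha _)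

lemma integrableOn_mul_cv_bump {a c : ℝ} (ha : 0 < a) {x₀ : E3} {g p : E3 → ℝ} {B : Set E3}
    (hp : IntegrableOn p B) (hg : BddSupp x₀ c g) :
    IntegrableOn (fun x => p x * cv (bumpScaled a) g x) B := by
  obtain ⟨M, hM⟩ := hg.bdd
  exact hp.mul_bdd (continuous_cv_bump ha hg.integrable).aestronglyMeasurable
    (ae_of_all _ (abs_cv_bump_le ha hM))

namespace StaticPressure

variable {x₀ : E3} {p Φ g : E3 → ℝ} {F : Fin 3 → Fin 3 → E3 → ℝ} {a b c : ℝ}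

/-- Testing the pressure equation with the potential `newtDiff a b ∗ g`. -/
lemma test (h : StaticPressure x₀ p F Φ) (ha : 0 < a) (hab : a ≤ b) (hg : BddSupp x₀ c g)
    (hbc : b / 2 + c < 1 / 2) :
    (∫ x in Metric.ball x₀ (1 / 2), p x * cv (bumpScaled a) g x)
      - ∫ x in Metric.ball x₀ (1 / 2), p x * cv (bumpScaled b) g x
      = ∫ x in Metric.ball x₀ (1 / 2), ∑ i, ∑ j, F i j x * pd i (pd j (cv (newtDiff a b) g)) x := by
  have hb := ha.trans_le hab
  rw [← h.eq _ (isSpaceTest_cv_newtDiff ha hab hg hbc)]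
  simp only [laplacian_cv_newtDiff ha hab hg.integrable,
    cv_sub (contDiff_bumpScaled b).continuous (hasCompactSupport_bumpScaled hb)
      (contDiff_bumpScaled a).continuous (hasCompactSupport_bumpScaled ha) hg.integrable, mul_sub]
  rw [integral_sub (integrableOn_mul_cv_bump hb h.int_p hg)
    (integrableOn_mul_cv_bump ha h.int_p hg)]
  ring

/-- Bound for a sum of products with functions supported in a smaller ball. -/
lemma abs_integral_le (h : StaticPressure x₀ p F Φ) {H : Fin 3 → Fin 3 → E3 → ℝ}
    {s : ℝ} (hs : s ≤ 1 / 2) (h0 : ∀ i j x, s ≤ dist x x₀ → H i j x = 0)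
    (hi : IntegrableOn (fun x => Φ x * ∑ i, ∑ j, |H i j x|) (Metric.ball x₀ s)) :
    |∫ x in Metric.ball x₀ (1 / 2), ∑ i, ∑ j, F i j x * H i j x|
      ≤ ∫ x in Metric.ball x₀ s, Φ x * ∑ i, ∑ j, |H i j x| := by
  rw [setIntegral_eq_of_subset_of_forall_sdiff_eq_zero measurableSet_ball
    (Metric.ball_subset_ball hs)
    (fun x hx => Finset.sum_eq_zero fun i _ => Finset.sum_eq_zero fun j _ => by
      rw [h0 i j x (by simpa using hx.2), mul_zero])]
  refine abs_integral_le_integral_abs.trans (integral_mono_of_nonneg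
    (ae_of_all _ fun y => abs_nonneg _) hi (ae_of_all _ fun x => ?_))
  simp only [Finset.mul_sum]
  refine (Finset.abs_sum_le_sum_abs _ _).trans (Finset.sum_le_sum fun i _ =>
    (Finset.abs_sum_le_sum_abs _ _).trans (Finset.sum_le_sum fun j _ => ?_))
  rw [abs_mul]
  exact mul_le_mul_of_nonneg_right (h.bound i j x) (abs_nonneg _)

end StaticPressure

lemma lintegral_enorm_sq_eq {α : Type*} [MeasurableSpace α] {μ : Measure α} {f : α → ℝ}
    (hf : Integrable (fun x => f x ^ 2) μ) :
    ∫⁻ x, ‖f x‖ₑ ^ 2 ∂μ = ENNReal.ofReal (∫ x, f x ^ 2 ∂μ) := by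
  rw [ofReal_integral_eq_lintegral_ofReal hf (ae_of_all _ fun x => sq_nonneg _)]
  refine lintegral_congr fun x => ?_
  rw [← sq_abs, ENNReal.ofReal_pow (abs_nonneg _), ← Real.enorm_eq_ofReal_abs]

/-- Young's inequality for Bochner integrals. -/
lemma integral_cv_sq_le {K g : E3 → ℝ} {c : ℝ} (hK : Measurable K) (hg : Measurable g)
    (hc : 0 ≤ c) (hKc : ∫⁻ x, ‖K x‖ₑ ≤ ENNReal.ofReal c) (hg2 : Integrable fun x => g x ^ 2) :
    ∫ x, cv K g x ^ 2 ≤ c ^ 2 * ∫ x, g x ^ 2 := by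
  by_cases hi : Integrable fun x => cv K g x ^ 2
  · have h := lintegral_cv_sq_le hK hg
    rw [lintegral_enorm_sq_eq hi, lintegral_enorm_sq_eq hg2] at h
    have h2 : ENNReal.ofReal (∫ x, cv K g x ^ 2) ≤ ENNReal.ofReal (c ^ 2 * ∫ x, g x ^ 2) := by
      rw [ENNReal.ofReal_mul (by positivity), ENNReal.ofReal_pow hc]
      exact h.trans (by gcongr)
    exact (ENNReal.ofReal_le_ofReal_iff (by positivity)).1 h2
  · rw [integral_undef hi]
    positivity

lemma lintegral_bumpScaled_sub_le {a b : ℝ} (ha : 0 < a) (hb : 0 < b) :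
    ∫⁻ x, ‖bumpScaled b x - bumpScaled a x‖ₑ ≤ ENNReal.ofReal (2 * ∫ x, kerBump x) := by
  calc ∫⁻ x, ‖bumpScaled b x - bumpScaled a x‖ₑ
      ≤ ∫⁻ x, (‖bumpScaled b x‖ₑ + ‖bumpScaled a x‖ₑ) := lintegral_mono fun x => enorm_sub_le
    _ = ENNReal.ofReal (∫ x, kerBump x) + ENNReal.ofReal (∫ x, kerBump x) := by
        rw [lintegral_add_left (contDiff_bumpScaled b).continuous.measurable.enorm,
          lintegral_bumpScaled ha, lintegral_bumpScaled hb]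
    _ = _ := by
        rw [two_mul, ENNReal.ofReal_add integral_kerBump_pos.le integral_kerBump_pos.le]

/-- The `L²` Hessian bound for the potential. -/
lemma integral_hessian_cv_newtDiff_le {a b c : ℝ} (ha : 0 < a) (hab : a ≤ b) {x₀ : E3} {g : E3 → ℝ}
    (hg : BddSupp x₀ c g) (hbc : b / 2 + c < 1 / 2) :
    ∑ i, ∑ j, ∫ x, pd i (pd j (cv (newtDiff a b) g)) x ^ 2
      ≤ (2 * ∫ x, kerBump x) ^ 2 * ∫ x, g x ^ 2 := by
  have hψ := isSpaceTest_cv_newtDiff ha hab hg hbc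
  rw [integral_hessian_sq hψ.1 hψ.2.1]
  simp only [laplacian_cv_newtDiff ha hab hg.integrable]
  exact integral_cv_sq_le
    ((contDiff_bumpScaled b).continuous.sub (contDiff_bumpScaled a).continuous).measurable
    hg.meas (by linarith [integral_kerBump_pos])
    (lintegral_bumpScaled_sub_le ha (ha.trans_le hab)) hg.integrable_sq

lemma sq_sum_sum_abs_le (A : Fin 3 → Fin 3 → ℝ) :
    (∑ i, ∑ j, |A i j|) ^ 2 ≤ 9 * ∑ i, ∑ j, A i j ^ 2 := by
  have h1 := sq_sum_le_card_mul_sum_sq (s := Finset.univ) (f := fun i => ∑ j, |A i j|)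
  have h2 : ∀ i, (∑ j, |A i j|) ^ 2 ≤ 3 * ∑ j, A i j ^ 2 := fun i => by
    simpa using sq_sum_le_card_mul_sum_sq (s := Finset.univ) (f := fun j => |A i j|)
  have h3 := Finset.sum_le_sum fun i (_ : i ∈ Finset.univ) => h2 i
  rw [← Finset.mul_sum] at h3
  simp only [Finset.card_univ, Fintype.card_fin, Nat.cast_ofNat] at h1
  linarith

lemma pd_zero {φ : E3 → ℝ} (hφ : ContDiff ℝ (⊤ : ℕ∞) φ) {a : ℝ} (ha : a ≠ 0)
    (h : ∀ x, a ≤ ‖x‖ → φ x = 0) (j : Fin 3) (x : E3) (hx : a ≤ ‖x‖) : pd j φ x = 0 := by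
  have h1 : (Metric.closedBall (0 : E3) a)ᶜ ⊆ {x | pd j φ x = 0} := fun y hy => by
    have : y ∉ tsupport (pd j φ) := fun hm => hy
      (tsupport_subset_closedBall (by simpa using h) (tsupport_pd_subset φ j hm))
    exact image_eq_zero_of_notMem_tsupport this
  have h2 := closure_minimal h1 (isClosed_eq (contDiff_pd hφ j).continuous continuous_const)
  rw [closure_compl, interior_closedBall _ ha] at h2
  exact h2 (by simpa using hx)

lemma pd_pd_newtDiff_zero {a b : ℝ} (ha : 0 < a) (hab : a ≤ b) (i j : Fin 3) (x : E3)
    (hx : b / 2 ≤ ‖x‖) : pd i (pd j (newtDiff a b)) x = 0 := by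
  have hb : b / 2 ≠ 0 := by linarith
  exact pd_zero (contDiff_pd (contDiff_newtDiff a b) j) hb
    (pd_zero (contDiff_newtDiff a b) hb (newtDiff_zero ha hab) j) i x hx

namespace StaticPressure

variable {x₀ : E3} {p Φ g : E3 → ℝ} {F : Fin 3 → Fin 3 → E3 → ℝ} {a b c : ℝ}

lemma near (h : StaticPressure x₀ p F Φ) (ha : 0 < a) (hab : a ≤ b) (hg : BddSupp x₀ b g)
    (hb : 3 / 2 * b < 1 / 2)
    (hΦ : IntegrableOn (fun x => Φ x ^ 2) (Metric.ball x₀ (3 / 2 * b))) :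
    |(∫ x in Metric.ball x₀ (1 / 2), p x * cv (bumpScaled a) g x)
      - ∫ x in Metric.ball x₀ (1 / 2), p x * cv (bumpScaled b) g x|
      ≤ 6 * (∫ x, kerBump x) * √(∫ x in Metric.ball x₀ (3 / 2 * b), Φ x ^ 2)
        * √(∫ x, g x ^ 2) := by
  have hbc : b / 2 + b < 1 / 2 := by linarith
  set ψ := cv (newtDiff a b) g with hψdef
  have hψ : IsSpaceTest (Metric.ball x₀ (1 / 2)) ψ := isSpaceTest_cv_newtDiff ha hab hg hbc
  set S := fun x => ∑ i, ∑ j, |pd i (pd j ψ) x| with hS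
  have hcont : ∀ i j, Continuous (pd i (pd j ψ)) := fun i j => ((hψ.pd j).pd i).1.continuous
  have hSc : Continuous S := by fun_prop
  have hsq : ∀ i j, Integrable fun x => pd i (pd j ψ) x ^ 2 := fun i j =>
    ((hcont i j).memLp_of_hasCompactSupport ((hψ.pd j).pd i).2.1).integrable_sq
  have hsum : Integrable fun x => 9 * ∑ i, ∑ j, pd i (pd j ψ) x ^ 2 :=
    (integrable_finsetSum _ fun i _ => integrable_finsetSum _ fun j _ => hsq i j).const_mul 9
  have hSi : Integrable fun x => S x ^ 2 := by
    refine hsum.mono' (by fun_prop) (ae_of_all _ fun x => ?_)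
    rw [Real.norm_of_nonneg (by positivity)]
    exact sq_sum_sum_abs_le _
  have hΦm : AEStronglyMeasurable Φ (volume.restrict (Metric.ball x₀ (3 / 2 * b))) :=
    h.int_Φ.aestronglyMeasurable.mono_measure
      (Measure.restrict_mono (Metric.ball_subset_ball hb.le) le_rfl)
  have hS0 : ∀ x, 0 ≤ S x := fun x => by positivity
  have e1 : ∀ x, |Φ x| * |S x| = Φ x * S x := fun x => by
    rw [abs_of_nonneg (h.nonneg x), abs_of_nonneg (hS0 x)]
  have h1 := integral_abs_mul_le_sqrt hΦm hSc.aestronglyMeasurable hΦ hSi.integrableOn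
  have h2 := integrable_mul_abs_of_sq hΦm hSc.aestronglyMeasurable hΦ hSi.integrableOn
  simp only [e1] at h1 h2
  have h3 : ∫ x, S x ^ 2 ≤ (6 * ∫ x, kerBump x) ^ 2 * ∫ x, g x ^ 2 := by
    calc ∫ x, S x ^ 2 ≤ ∫ x, 9 * ∑ i, ∑ j, pd i (pd j ψ) x ^ 2 :=
          integral_mono hSi hsum fun x => sq_sum_sum_abs_le _
      _ = 9 * ∑ i, ∑ j, ∫ x, pd i (pd j ψ) x ^ 2 := by
          rw [integral_const_mul, integral_finsetSum _ fun i _ =>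
            integrable_finsetSum _ fun j _ => hsq i j]
          simp only [integral_finsetSum _ fun j _ => hsq _ j]
      _ ≤ _ := by
          have := integral_hessian_cv_newtDiff_le ha hab hg hbc
          linarith
  have h4 : √(∫ x in Metric.ball x₀ (3 / 2 * b), S x ^ 2)
      ≤ 6 * (∫ x, kerBump x) * √(∫ x, g x ^ 2) := by
    rw [← Real.sqrt_sq (by linarith [integral_kerBump_pos] : 0 ≤ 6 * ∫ x, kerBump x),
      ← Real.sqrt_mul (sq_nonneg _)]
    exact Real.sqrt_le_sqrt ((setIntegral_le_integral hSi (ae_of_all _ fun x => sq_nonneg _)).trans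
      h3)
  rw [h.test ha hab hg hbc]
  refine (h.abs_integral_le hb.le (fun i j x hx => ?_) h2).trans (h1.trans ?_)
  · rw [hψdef, pd_pd_cv_newtDiff ha hab hg.integrable]
    exact cv_eq_zero (pd_pd_newtDiff_zero ha hab i j) hg.zero (by linarith)
  · calc _ ≤ √(∫ x in Metric.ball x₀ (3 / 2 * b), Φ x ^ 2)
        * (6 * (∫ x, kerBump x) * √(∫ x, g x ^ 2)) := by gcongr
      _ = _ := by ring

end StaticPressure

lemma exists_abs_cv_bump_quarter_le : ∃ C : ℝ, 0 ≤ C ∧ ∀ (x₀ : E3) (c : ℝ) (g : E3 → ℝ),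
    BddSupp x₀ c g → ∫ x, g x = 0 → ∀ x,
      |cv (bumpScaled (1 / 4)) g x| ≤ C * c * ∫ y, |g y| := by
  obtain ⟨L, hL⟩ := ((contDiff_bumpScaled (1 / 4)).of_le
    (by exact_mod_cast le_top : (1 : WithTop ℕ∞) ≤ _)).lipschitzWith_of_hasCompactSupport
    (hasCompactSupport_bumpScaled (by norm_num)) one_ne_zero
  refine ⟨L, L.2, fun x₀ c g hg hg0 x => ?_⟩
  exact abs_cv_le_of_lipschitz (contDiff_bumpScaled _).continuous
    (hasCompactSupport_bumpScaled (by norm_num))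
    (fun x y => by simpa [Real.dist_eq] using hL.dist_le_mul x y) L.2 hg.integrable hg.zero hg0 x

lemma rdy_pos (k : ℕ) : 0 < rdy k := by unfold rdy; positivity

lemma rdy_succ (k : ℕ) : rdy (k + 1) = rdy k / 2 := by unfold rdy; rw [pow_succ]; ring

lemma rdy_anti : Antitone rdy := antitone_nat_of_succ_le fun k => by
  rw [rdy_succ]; linarith [rdy_pos k]

lemma rdy_two : rdy 2 = 1 / 4 := by norm_num [rdy]

/-- Convolution with the rescaled bumps converges almost everywhere. -/
lemma ae_tendsto_cv_bump {g : E3 → ℝ} (hg : LocallyIntegrable g) :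
    ∀ᵐ x, Tendsto (fun a => cv (bumpScaled a) g x) (𝓝[>] 0) (𝓝 ((∫ y, kerBump y) * g x)) := by
  obtain ⟨M, hM⟩ := hasCompactSupport_kerBump.exists_bound_of_continuous
    contDiff_kerBump.continuous
  filter_upwards [(Besicovitch.vitaliFamily (volume : Measure E3)).ae_tendsto_average_norm_sub hg]
    with x hx
  set κ := ∫ y, kerBump y
  have hκ : 0 < κ := integral_kerBump_pos
  have h0 := hx.comp (Besicovitch.tendsto_filterAt volume x)
  have h1 := tendsto_integral_smul_of_tendsto_average_norm_sub (μ := (volume : Measure E3))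
    (l := 𝓝[>] (0 : ℝ)) (f := g) (c := g x)
    (g := fun a y => κ⁻¹ * bumpScaled a (x - y)) (a := fun a => Metric.closedBall x a)
    (κ⁻¹ * (M * volume.real (Metric.closedBall (0 : E3) 1))) h0
    (Eventually.of_forall fun a => hg.integrableOn_isCompact (isCompact_closedBall _ _))
    ?_ ?_ ?_
  · have h2 := h1.const_mul κ
    refine h2.congr fun a => ?_
    rw [cv_apply]
    simp only [smul_eq_mul, mul_assoc]
    rw [integral_const_mul, mul_inv_cancel_left₀ hκ.ne']
  · refine tendsto_const_nhds.congr' ?_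
    filter_upwards [self_mem_nhdsWithin] with a ha
    rw [integral_const_mul, integral_sub_left_eq_self (bumpScaled a) volume x,
      integral_bumpScaled ha, inv_mul_cancel₀ hκ.ne']
  · filter_upwards [self_mem_nhdsWithin] with a ha y hy
    by_contra hya
    refine hy ?_
    simp only [Metric.mem_closedBall, not_le] at hya
    change κ⁻¹ * bumpScaled a (x - y) = 0
    rw [bumpScaled_zero ha, mul_zero]
    rw [← dist_eq_norm, dist_comm]
    have : (0 : ℝ) < a := ha
    linarith
  · filter_upwards [self_mem_nhdsWithin] with a ha y
    have ha' : (0 : ℝ) < a := ha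
    have hv : volume.real (Metric.closedBall x a)
        = a ^ 3 * volume.real (Metric.closedBall (0 : E3) 1) := by
      rw [Measure.addHaar_real_closedBall' volume x ha'.le]
      simp
    have hpos : 0 < volume.real (Metric.closedBall (0 : E3) 1) :=
      ENNReal.toReal_pos (Metric.measure_closedBall_pos volume _ one_pos).ne'
        measure_closedBall_lt_top.ne
    rw [hv, abs_of_nonneg (mul_nonneg (inv_nonneg.2 hκ.le) (bumpScaled_nonneg ha' _)),
      le_div_iff₀ (by positivity)]
    have h3 : kerBump (a⁻¹ • (x - y)) ≤ M := (le_abs_self _).trans (hM _)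
    have ha3 : a⁻¹ ^ 3 * a ^ 3 = 1 := by rw [← mul_pow, inv_mul_cancel₀ ha'.ne', one_pow]
    calc κ⁻¹ * bumpScaled a (x - y) * (a ^ 3 * volume.real (Metric.closedBall (0 : E3) 1))
        = (a⁻¹ ^ 3 * a ^ 3) * (κ⁻¹ * (kerBump (a⁻¹ • (x - y))
          * volume.real (Metric.closedBall (0 : E3) 1))) := by unfold bumpScaled; ring
      _ ≤ _ := by rw [ha3, one_mul]; gcongr

namespace StaticPressure

variable {x₀ : E3} {p Φ g : E3 → ℝ} {F : Fin 3 → Fin 3 → E3 → ℝ} {a b c C m : ℝ}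

lemma far (h : StaticPressure x₀ p F Φ) (hC0 : 0 ≤ C)
    (hC : ∀ i j x y, |pd i (pd j (newtDiff (b / 2) b)) x - pd i (pd j (newtDiff (b / 2) b)) y|
      ≤ C * b⁻¹ ^ 4 * dist x y) (hb : 0 < b) (hg : BddSupp x₀ c g) (hg0 : ∫ x, g x = 0)
    (hc : 0 ≤ c) (hcb : c ≤ b / 2) (hb2 : b < 1 / 2)
    (hm : ∫ x in Metric.ball x₀ b, Φ x ≤ m * b ^ 3) :
    |(∫ x in Metric.ball x₀ (1 / 2), p x * cv (bumpScaled (b / 2)) g x)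
      - ∫ x in Metric.ball x₀ (1 / 2), p x * cv (bumpScaled b) g x|
      ≤ 9 * C * c * m * b⁻¹ * ∫ x, |g x| := by
  have hab : b / 2 ≤ b := by linarith
  have ha : 0 < b / 2 := by linarith
  rw [h.test ha hab hg (by linarith)]
  simp only [pd_pd_cv_newtDiff ha hab hg.integrable]
  set H := fun i j => cv (pd i (pd j (newtDiff (b / 2) b))) g with hH
  have hKc : ∀ i j, ContDiff ℝ (⊤ : ℕ∞) (pd i (pd j (newtDiff (b / 2) b))) := fun i j =>
    contDiff_pd (contDiff_pd (contDiff_newtDiff _ _) j) i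
  have hKs : ∀ i j, HasCompactSupport (pd i (pd j (newtDiff (b / 2) b))) := fun i j =>
    hasCompactSupport_pd (hasCompactSupport_pd (hasCompactSupport_newtDiff ha hab) j) i
  set A := C * b⁻¹ ^ 4 * c * ∫ x, |g x| with hA
  have hA0 : 0 ≤ A := by positivity
  have hbd : ∀ i j x, |H i j x| ≤ A := fun i j x =>
    abs_cv_le_of_lipschitz (hKc i j).continuous (hKs i j) (hC i j) (by positivity)
      hg.integrable hg.zero hg0 x
  have hHcont : ∀ i j, Continuous (H i j) := fun i j =>
    (contDiff_cv (n := ⊤) (hKc i j) (hKs i j) hg.integrable.locallyIntegrable).continuous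
  have hΦb : IntegrableOn Φ (Metric.ball x₀ b) :=
    h.int_Φ.mono_set (Metric.ball_subset_ball hb2.le)
  have hS : ∀ x, ∑ i, ∑ j, |H i j x| ≤ 9 * A := fun x =>
    calc _ ≤ ∑ _i : Fin 3, ∑ _j : Fin 3, A :=
          Finset.sum_le_sum fun i _ => Finset.sum_le_sum fun j _ => hbd i j x
      _ = _ := by simp; ring
  have hi : IntegrableOn (fun x => Φ x * ∑ i, ∑ j, |H i j x|) (Metric.ball x₀ b) := by
    refine hΦb.mul_bdd (c := 9 * A) (by fun_prop) (ae_of_all _ fun x => ?_)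
    rw [Real.norm_of_nonneg (by positivity)]
    exact hS x
  refine (h.abs_integral_le hb2.le (fun i j x hx => ?_) hi).trans ?_
  · exact cv_eq_zero (pd_pd_newtDiff_zero ha hab i j) hg.zero (by linarith)
  · calc ∫ x in Metric.ball x₀ b, Φ x * ∑ i, ∑ j, |H i j x|
        ≤ ∫ x in Metric.ball x₀ b, Φ x * (9 * A) :=
          integral_mono hi (hΦb.mul_const _) fun x => mul_le_mul_of_nonneg_left (hS x) (h.nonneg x)
      _ = (∫ x in Metric.ball x₀ b, Φ x) * (9 * A) := integral_mul_const _ _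
      _ ≤ (m * b ^ 3) * (9 * A) := by gcongr
      _ = _ := by rw [hA]; field_simp

lemma chain (h : StaticPressure x₀ p F Φ) (hC0 : 0 ≤ C)
    (hC : ∀ b : ℝ, 0 < b → ∀ i j x y,
      |pd i (pd j (newtDiff (b / 2) b)) x - pd i (pd j (newtDiff (b / 2) b)) y|
      ≤ C * b⁻¹ ^ 4 * dist x y) {n : ℕ} (hg : BddSupp x₀ (rdy (n + 1)) g)
    (hg0 : ∫ x, g x = 0)
    (hm : ∀ k, 2 ≤ k → k ≤ n → ∫ x in Metric.ball x₀ (rdy k), Φ x ≤ m * rdy k ^ 3)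
    {j : ℕ} (hj : 1 ≤ j) (hjn : j ≤ n) (hm0 : 0 ≤ m) :
    |∫ x in Metric.ball x₀ (1 / 2), p x * cv (bumpScaled (rdy (j + 1))) g x|
      ≤ |∫ x in Metric.ball x₀ (1 / 2), p x * cv (bumpScaled (1 / 4)) g x|
        + 9 * C * rdy (n + 1) * m * (rdy (j + 1))⁻¹ * ∫ x, |g x| := by
  have hr := rdy_pos (n + 1)
  induction j, hj using Nat.le_induction with
  | base =>
    rw [rdy_two, le_add_iff_nonneg_right]
    positivity
  | succ j hj ih =>
    have h1 := ih (by lia)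
    have hr1 := rdy_pos (j + 1)
    have h2 := h.far hC0 (hC _ hr1) hr1 hg hg0 hr.le
      (by rw [← rdy_succ]; exact rdy_anti (by lia))
      ((rdy_anti (by lia : 2 ≤ j + 1)).trans_lt (by rw [rdy_two]; norm_num))
      (hm (j + 1) (by lia) hjn)
    rw [← rdy_succ] at h2
    have h3 : (rdy (j + 1 + 1))⁻¹ = 2 * (rdy (j + 1))⁻¹ := by
      rw [rdy_succ (j + 1), inv_div]; ring
    rw [h3]
    have h4 := abs_sub_abs_le_abs_sub
      (∫ x in Metric.ball x₀ (1 / 2), p x * cv (bumpScaled (rdy (j + 1 + 1))) g x)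
      (∫ x in Metric.ball x₀ (1 / 2), p x * cv (bumpScaled (rdy (j + 1))) g x)
    linarith

end StaticPressure

/-- The pressure tested with bounded functions of mean zero in a small ball. -/
lemma exists_pressure_duality : ∃ C : ℝ, 0 ≤ C ∧ ∀ (x₀ : E3) (p Φ g : E3 → ℝ)
    (F : Fin 3 → Fin 3 → E3 → ℝ) (n : ℕ) (m : ℝ), 2 ≤ n → 0 ≤ m → StaticPressure x₀ p F Φ →
    BddSupp x₀ (rdy (n + 1)) g → ∫ x, g x = 0 →
    (∀ k, 2 ≤ k → k ≤ n → ∫ x in Metric.ball x₀ (rdy k), Φ x ≤ m * rdy k ^ 3) →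
    IntegrableOn (fun x => Φ x ^ 2) (Metric.ball x₀ (3 / 2 * rdy (n + 1))) →
    |∫ x in Metric.ball x₀ (1 / 2), p x * g x| ≤
      C * (√(∫ x in Metric.ball x₀ (3 / 2 * rdy (n + 1)), Φ x ^ 2) * √(∫ x, g x ^ 2)
        + (m + rdy (n + 1) * ∫ x in Metric.ball x₀ (1 / 2), |p x|) * ∫ x, |g x|) := by
  obtain ⟨C₁, hC₁, hfar⟩ := exists_lipschitz_hessian_newtDiff
  obtain ⟨C₂, hC₂, htop⟩ := exists_abs_cv_bump_quarter_le
  set κ := ∫ x, kerBump x with hκdef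
  have hκ : 0 < κ := integral_kerBump_pos
  refine ⟨κ⁻¹ * (6 * κ + 9 * C₁ + C₂), by positivity, ?_⟩
  intro x₀ p Φ g F n m hn hm0 h hg hg0 hm hΦ
  set r := rdy (n + 1) with hr
  have hr0 : 0 < r := rdy_pos _
  have hr8 : r ≤ 1 / 8 := by
    have := rdy_anti (by lia : 3 ≤ n + 1)
    norm_num [rdy] at this hr ⊢; linarith
  set Φ2 := √(∫ x in Metric.ball x₀ (3 / 2 * r), Φ x ^ 2)
  set g2 := √(∫ x, g x ^ 2)
  set P := ∫ x in Metric.ball x₀ (1 / 2), |p x|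
  set g1 := ∫ x, |g x|
  have hg10 : 0 ≤ g1 := integral_nonneg fun x => abs_nonneg _
  have hP0 : 0 ≤ P := integral_nonneg fun x => abs_nonneg _
  set A := fun a => ∫ x in Metric.ball x₀ (1 / 2), p x * cv (bumpScaled a) g x
  have h1 : |A r| ≤ |A (1 / 4)| + 9 * C₁ * m * g1 := by
    have := h.chain hC₁ hfar hg hg0 hm (by lia : 1 ≤ n) le_rfl hm0
    refine this.trans_eq ?_
    rw [← hr]
    field_simp
    rfl
  have h2 : |A (1 / 4)| ≤ C₂ * r * g1 * P := by
    calc |A (1 / 4)| ≤ ∫ x in Metric.ball x₀ (1 / 2), |p x| * (C₂ * r * g1) := by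
          refine abs_integral_le_integral_abs.trans (integral_mono_of_nonneg
            (ae_of_all _ fun y => abs_nonneg _) (h.int_p.abs.mul_const _) (ae_of_all _ fun x => ?_))
          simp only [abs_mul]
          exact mul_le_mul_of_nonneg_left (htop x₀ r g hg hg0 x) (abs_nonneg _)
      _ = _ := by rw [integral_mul_const]; ring
  have h3 : Tendsto A (𝓝[>] 0) (𝓝 (∫ x in Metric.ball x₀ (1 / 2), p x * (κ * g x))) := by
    obtain ⟨M, hM⟩ := hg.bdd
    refine tendsto_integral_filter_of_dominated_convergence (fun x => |p x| * (κ * M)) ?_ ?_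
      (h.int_p.abs.mul_const _) ?_
    · filter_upwards [self_mem_nhdsWithin] with a ha
      exact (integrableOn_mul_cv_bump ha h.int_p hg).aestronglyMeasurable
    · filter_upwards [self_mem_nhdsWithin] with a ha
      refine ae_of_all _ fun x => ?_
      rw [norm_mul]
      exact mul_le_mul_of_nonneg_left (abs_cv_bump_le ha hM x) (abs_nonneg _)
    · filter_upwards [ae_restrict_of_ae (ae_tendsto_cv_bump hg.integrable.locallyIntegrable)]
        with x hx
      exact hx.const_mul _
  have h4 : |∫ x in Metric.ball x₀ (1 / 2), p x * (κ * g x)|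
      ≤ 6 * κ * Φ2 * g2 + 9 * C₁ * m * g1 + C₂ * r * g1 * P := by
    refine le_of_tendsto h3.abs ?_
    filter_upwards [Ioc_mem_nhdsGT hr0] with a ha
    have h5 := h.near ha.1 ha.2 hg (by linarith) hΦ
    have h6 := abs_sub_abs_le_abs_sub (A a) (A r)
    linarith
  have h7 : ∫ x in Metric.ball x₀ (1 / 2), p x * (κ * g x)
      = κ * ∫ x in Metric.ball x₀ (1 / 2), p x * g x := by
    rw [← integral_const_mul]
    congr 1
    ext x
    ring
  rw [h7, abs_mul, abs_of_pos hκ] at h4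
  have hΦ20 : 0 ≤ Φ2 := Real.sqrt_nonneg _
  have hg20 : 0 ≤ g2 := Real.sqrt_nonneg _
  rw [mul_assoc, le_inv_mul_iff₀ hκ]
  refine h4.trans ?_
  have e1 : 0 ≤ κ * (m * g1) := by positivity
  have e2 : 0 ≤ κ * (r * P * g1) := by positivity
  have e3 : 0 ≤ C₁ * (Φ2 * g2) := by positivity
  have e4 : 0 ≤ C₁ * (r * P * g1) := by positivity
  have e5 : 0 ≤ C₂ * (Φ2 * g2) := by positivity
  have e6 : 0 ≤ C₂ * (m * g1) := by positivity
  nlinarith [e1, e2, e3, e4, e5, e6]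

/-- The volume of the unit ball of `ℝ³`. -/
def vol1 : ℝ := volume.real (Metric.ball (0 : E3) 1)

lemma vol1_pos : 0 < vol1 :=
  ENNReal.toReal_pos (Metric.measure_ball_pos volume _ one_pos).ne' measure_ball_lt_top.ne

lemma volume_real_ball (x₀ : E3) {r : ℝ} (hr : 0 ≤ r) :
    volume.real (Metric.ball x₀ r) = vol1 * r ^ 3 := by
  rw [Measure.real, Measure.addHaar_ball volume x₀ hr, ENNReal.toReal_mul,
    ENNReal.toReal_ofReal (by positivity), vol1, Measure.real]
  simp [mul_comm]

lemma exists_pressure_bdd : ∃ C : ℝ, 0 ≤ C ∧ ∀ (x₀ : E3) (p Φ w : E3 → ℝ)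
    (F : Fin 3 → Fin 3 → E3 → ℝ) (n : ℕ) (m M : ℝ), 2 ≤ n → 0 ≤ m → StaticPressure x₀ p F Φ →
    Measurable w → (∀ x, |w x| ≤ M) →
    (∀ k, 2 ≤ k → k ≤ n → ∫ x in Metric.ball x₀ (rdy k), Φ x ≤ m * rdy k ^ 3) →
    IntegrableOn (fun x => Φ x ^ 2) (Metric.ball x₀ (3 / 2 * rdy (n + 1))) →
    |∫ x in Metric.ball x₀ (rdy (n + 1)), w x * (p x - ⨍ y in Metric.ball x₀ (rdy (n + 1)), p y)| ≤
      C * √(∫ x in Metric.ball x₀ (rdy (n + 1)), w x ^ 2)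
        * (√(∫ x in Metric.ball x₀ (3 / 2 * rdy (n + 1)), Φ x ^ 2)
        + √(rdy (n + 1) ^ 3) * (m + rdy (n + 1) * ∫ x in Metric.ball x₀ (1 / 2), |p x|)) := by
  obtain ⟨C, hC, h⟩ := exists_pressure_duality
  refine ⟨C * (1 + 2 * √vol1), by positivity, ?_⟩
  intro x₀ p Φ w F n m M hn hm0 hs hw hM hm hΦ
  specialize h x₀ p Φ
  set r := rdy (n + 1) with hr
  have hr0 : 0 < r := rdy_pos _
  have hrh : r ≤ 1 / 2 := by
    have := rdy_anti (by lia : 1 ≤ n + 1)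
    norm_num [rdy] at this hr ⊢; linarith
  set B := Metric.ball x₀ r with hB
  have hBfin : IsFiniteMeasure (volume.restrict B) :=
    isFiniteMeasure_restrict.2 measure_ball_lt_top.ne
  have hv : volume.real B = vol1 * r ^ 3 := volume_real_ball x₀ hr0.le
  have hv0 : 0 < volume.real B := hv ▸ mul_pos vol1_pos (by positivity)
  set a := ⨍ y in B, w y with ha
  have hwmem : ∀ q, MemLp w q (volume.restrict B) := fun q =>
    MemLp.of_bound hw.aestronglyMeasurable M (ae_of_all _ hM)
  have hwi : IntegrableOn w B := memLp_one_iff_integrable.1 (hwmem 1)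
  have hw2 : IntegrableOn (fun x => w x ^ 2) B := (hwmem 2).integrable_sq
  have hint : ∫ x in B, w x = volume.real B * a := by
    rw [ha, setAverage_eq, smul_eq_mul, mul_inv_cancel_left₀ hv0.ne']
  have hpi : IntegrableOn p B := hs.int_p.mono_set (Metric.ball_subset_ball hrh)
  set g := B.indicator fun x => w x - a with hg
  have hgb : BddSupp x₀ r g := by
    refine ⟨(hw.sub_const a).indicator measurableSet_ball, ⟨M + |a|, fun x => ?_⟩, fun x hx => ?_⟩
    · exact (norm_indicator_le_norm_self (fun x => w x - a) x).trans ((norm_sub_le _ _).trans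
        (add_le_add (hM x) le_rfl))
    · exact indicator_of_notMem (by simpa [hB] using hx) _
  have hg0 : ∫ x, g x = 0 := by
    rw [hg, integral_indicator measurableSet_ball, integral_sub hwi (integrable_const _), hint]
    simp
  have e1 : ∫ x in Metric.ball x₀ (1 / 2), p x * g x = ∫ x in B, w x * (p x - ⨍ y in B, p y) := by
    have h1 : (fun x => p x * g x) = B.indicator fun x => p x * (w x - a) := by
      ext x
      by_cases hx : x ∈ B <;> simp [hg, hx]
    have hwp : IntegrableOn (fun x => p x * w x) B :=
      hpi.mul_bdd (c := M) hw.aestronglyMeasurable (ae_of_all _ hM)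
    have hwp' : IntegrableOn (fun x => w x * p x) B := by simpa only [mul_comm] using hwp
    rw [h1, setIntegral_indicator measurableSet_ball,
      inter_eq_right.2 (Metric.ball_subset_ball hrh)]
    simp only [mul_sub]
    rw [integral_sub hwp (hpi.mul_const _), integral_sub hwp' (hwi.mul_const _),
      integral_mul_const, integral_mul_const, hint, setAverage_eq, smul_eq_mul]
    simp only [mul_comm (p _)]
    field_simp
  have e2 : ∫ x, g x ^ 2 ≤ ∫ x in B, w x ^ 2 := by
    have h1 : (fun x => g x ^ 2) = B.indicator fun x => (w x ^ 2 - (2 * a) * w x) + a ^ 2 := by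
      ext x
      by_cases hx : x ∈ B
      · simp [hg, hx]; ring
      · simp [hg, hx]
    have h2 : IntegrableOn (fun x => w x ^ 2 - (2 * a) * w x) B := hw2.sub (hwi.const_mul _)
    rw [h1, integral_indicator measurableSet_ball, integral_add h2 (integrable_const _),
      integral_sub hw2 (hwi.const_mul _), integral_const_mul, hint]
    simp
    nlinarith [mul_nonneg hv0.le (sq_nonneg a)]
  have e3 : ∫ x, |g x| ≤ 2 * √vol1 * √(r ^ 3) * √(∫ x in B, w x ^ 2) := by
    have h1 : (fun x => |g x|) = B.indicator fun x => |w x - a| := by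
      ext x
      by_cases hx : x ∈ B <;> simp [hg, hx]
    have h2 : ∫ x in B, |w x| ≤ √(volume.real B) * √(∫ x in B, w x ^ 2) := by
      have := integral_abs_mul_le_sqrt (μ := volume.restrict B) (f := fun _ => (1 : ℝ)) (h := w)
        aestronglyMeasurable_const hw.aestronglyMeasurable (integrable_const _) hw2
      simpa using this
    have h3 : volume.real B * |a| ≤ ∫ x in B, |w x| := by
      rw [← abs_of_pos hv0, ← abs_mul, ← hint]
      exact abs_integral_le_integral_abs
    calc ∫ x, |g x| = ∫ x in B, |w x - a| := by rw [h1, integral_indicator measurableSet_ball]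
      _ ≤ ∫ x in B, (|w x| + |a|) := by
          refine integral_mono_of_nonneg (ae_of_all _ fun y => abs_nonneg _)
            (hwi.abs.add (integrable_const _)) (ae_of_all _ fun x => abs_sub _ _)
      _ = (∫ x in B, |w x|) + volume.real B * |a| := by
          rw [integral_add hwi.abs (integrable_const _)]
          simp
      _ ≤ 2 * (√(volume.real B) * √(∫ x in B, w x ^ 2)) := by linarith
      _ = _ := by rw [hv, Real.sqrt_mul vol1_pos.le]; ring
  have := h g F n m hn hm0 hs hgb hg0 hm hΦ
  rw [e1] at this
  refine this.trans ?_
  set W := √(∫ x in B, w x ^ 2)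
  set Φ2 := √(∫ x in Metric.ball x₀ (3 / 2 * r), Φ x ^ 2)
  have hP : 0 ≤ ∫ x in Metric.ball x₀ (1 / 2), |p x| := integral_nonneg fun x => abs_nonneg _
  set D := m + r * ∫ x in Metric.ball x₀ (1 / 2), |p x|
  have hD : 0 ≤ D := by positivity
  have hW : 0 ≤ W := Real.sqrt_nonneg _
  have hΦ2 : 0 ≤ Φ2 := Real.sqrt_nonneg _
  have e4 : √(∫ x, g x ^ 2) ≤ W := Real.sqrt_le_sqrt e2
  calc C * (Φ2 * √(∫ x, g x ^ 2) + D * ∫ x, |g x|)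
      ≤ C * (Φ2 * W + D * (2 * √vol1 * √(r ^ 3) * W)) := by gcongr
    _ ≤ C * (1 + 2 * √vol1) * W * (Φ2 + √(r ^ 3) * D) := by
        have q1 : 0 ≤ C * √vol1 * (Φ2 * W) := by positivity
        have q2 : 0 ≤ C * (D * √(r ^ 3) * W) := by positivity
        nlinarith

/-- The oscillation of the pressure against a nonnegative square integrable weight. -/
lemma exists_pressure_osc : ∃ C : ℝ, 0 ≤ C ∧ ∀ (x₀ : E3) (p Φ U : E3 → ℝ)
    (F : Fin 3 → Fin 3 → E3 → ℝ) (n : ℕ) (m : ℝ), 2 ≤ n → 0 ≤ m → StaticPressure x₀ p F Φ →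
    Measurable p → Measurable U → (∀ x, 0 ≤ U x) →
    IntegrableOn (fun x => U x ^ 2) (Metric.ball x₀ (rdy (n + 1))) →
    (∀ k, 2 ≤ k → k ≤ n → ∫ x in Metric.ball x₀ (rdy k), Φ x ≤ m * rdy k ^ 3) →
    IntegrableOn (fun x => Φ x ^ 2) (Metric.ball x₀ (3 / 2 * rdy (n + 1))) →
    ∫⁻ x in Metric.ball x₀ (rdy (n + 1)),
        ENNReal.ofReal (U x * |p x - ⨍ y in Metric.ball x₀ (rdy (n + 1)), p y|) ≤
      ENNReal.ofReal (C * √(∫ x in Metric.ball x₀ (rdy (n + 1)), U x ^ 2)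
        * (√(∫ x in Metric.ball x₀ (3 / 2 * rdy (n + 1)), Φ x ^ 2)
        + √(rdy (n + 1) ^ 3) * (m + rdy (n + 1) * ∫ x in Metric.ball x₀ (1 / 2), |p x|))) := by
  obtain ⟨C, hC, h⟩ := exists_pressure_bdd
  refine ⟨C, hC, ?_⟩
  intro x₀ p Φ U F n m hn hm0 hs hp hU hU0 hU2 hm hΦ
  specialize h x₀ p Φ
  set r := rdy (n + 1) with hr
  have hr0 : 0 < r := rdy_pos _
  have hrh : r ≤ 1 / 2 := by
    have := rdy_anti (by lia : 1 ≤ n + 1)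
    norm_num [rdy] at this hr ⊢; linarith
  set B := Metric.ball x₀ r with hB
  have hBfin : IsFiniteMeasure (volume.restrict B) :=
    isFiniteMeasure_restrict.2 measure_ball_lt_top.ne
  have hpi : IntegrableOn p B := hs.int_p.mono_set (Metric.ball_subset_ball hrh)
  set q := fun x => p x - ⨍ y in B, p y with hq
  have hqm : Measurable q := hp.sub_const _
  have hqi : IntegrableOn q B := hpi.sub (integrable_const _)
  have hP : 0 ≤ ∫ x in Metric.ball x₀ (1 / 2), |p x| := integral_nonneg fun x => abs_nonneg _
  have hlim : Tendsto (fun T : ℕ => ∫⁻ x in B, ENNReal.ofReal (min (U x) T * |q x|)) atTop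
      (𝓝 (∫⁻ x in B, ENNReal.ofReal (U x * |q x|))) := by
    refine lintegral_tendsto_of_tendsto_of_monotone (fun T => ?_) (ae_of_all _ fun x => ?_)
      (ae_of_all _ fun x => ?_)
    · exact ((hU.min measurable_const).mul hqm.abs).ennreal_ofReal.aemeasurable
    · intro S T hST
      have : (S : ℝ) ≤ T := by exact_mod_cast hST
      dsimp only
      gcongr
    · refine tendsto_const_nhds.congr' ?_
      obtain ⟨N, hN⟩ := exists_nat_ge (U x)
      filter_upwards [eventually_ge_atTop N] with T hT
      have : (N : ℝ) ≤ T := by exact_mod_cast hT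
      rw [min_eq_left (hN.trans this)]
  refine le_of_tendsto hlim (Eventually.of_forall fun T => ?_)
  set w := fun x => min (U x) T * SignType.sign (q x) with hw
  have hT0 : (0 : ℝ) ≤ T := T.cast_nonneg
  have hmin : ∀ x, 0 ≤ min (U x) T := fun x => le_min (hU0 x) hT0
  have hsg : ∀ y : ℝ, |(SignType.sign y : ℝ)| ≤ 1 := fun y => by
    rcases lt_trichotomy y 0 with hy | hy | hy <;> simp [hy]
  have hwabs : ∀ x, |w x| ≤ min (U x) T := fun x => by
    rw [hw, abs_mul, abs_of_nonneg (hmin x)]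
    exact mul_le_of_le_one_right (hmin x) (hsg _)
  have hsm : Measurable fun x => (SignType.sign (q x) : ℝ) := by
    have : (fun x => (SignType.sign (q x) : ℝ))
        = fun x => if 0 < q x then 1 else if q x < 0 then -1 else 0 := by
      ext x
      rcases lt_trichotomy (q x) 0 with hy | hy | hy
      · simp [hy, hy.not_gt]
      · simp [hy]
      · simp [hy]
    rw [this]
    exact Measurable.ite (measurableSet_lt measurable_const hqm) measurable_const
      (Measurable.ite (measurableSet_lt hqm measurable_const) measurable_const measurable_const)
  have hwm : Measurable w := (hU.min measurable_const).mul hsm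
  have hb := h w F n m T hn hm0 hs hwm (fun x => (hwabs x).trans (min_le_right _ _)) hm hΦ
  have hwq : ∀ x, w x * q x = min (U x) T * |q x| := fun x => by
    rw [hw, mul_assoc]
    congr 1
    rw [mul_comm]
    exact self_mul_sign _
  have hwqi : IntegrableOn (fun x => min (U x) T * |q x|) B := by
    refine hqi.abs.bdd_mul (c := T) (hU.min measurable_const).aestronglyMeasurable
      (ae_of_all _ fun x => ?_)
    rw [Real.norm_of_nonneg (hmin x)]
    exact min_le_right _ _
  rw [← ofReal_integral_eq_lintegral_ofReal hwqi
    (ae_of_all _ fun x => mul_nonneg (hmin x) (abs_nonneg _))]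
  refine ENNReal.ofReal_le_ofReal ?_
  have hb2 := (le_abs_self _).trans hb
  have e : ∫ x in B, min (U x) T * |q x| = ∫ x in B, w x * (p x - ⨍ y in B, p y) := by
    simp only [← hwq]
    rfl
  rw [e]
  refine hb2.trans ?_
  have hsq : √(∫ x in B, w x ^ 2) ≤ √(∫ x in B, U x ^ 2) := by
    refine Real.sqrt_le_sqrt (integral_mono_of_nonneg (ae_of_all _ fun x => sq_nonneg _) hU2
      (ae_of_all _ fun x => ?_))
    simp only [← sq_abs (w x)]
    exact pow_le_pow_left₀ (abs_nonneg _) ((hwabs x).trans (min_le_left _ _)) 2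
  gcongr

lemma eLpNorm_two_sq {α : Type*} [MeasurableSpace α] {μ : Measure α} (f : α → ℝ) :
    eLpNorm f 2 μ ^ 2 = ∫⁻ x, ‖f x‖ₑ ^ 2 ∂μ := by
  have := eLpNorm_nnreal_pow_eq_lintegral (f := f) (μ := μ) (p := 2) two_ne_zero
  simpa using this

lemma eLpNorm_cv_bump_le {a : ℝ} (ha : 0 < a) {g : E3 → ℝ} (hg : Measurable g) :
    eLpNorm (cv (bumpScaled a) g) 2 volume
      ≤ ENNReal.ofReal (∫ x, kerBump x) * eLpNorm g 2 volume := by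
  rw [← ENNReal.pow_le_pow_left_iff two_ne_zero, mul_pow, eLpNorm_two_sq, eLpNorm_two_sq,
    ← lintegral_bumpScaled ha]
  exact lintegral_cv_sq_le (contDiff_bumpScaled a).continuous.measurable hg

lemma norm_fderiv_le_sum_pd (ψ : E3 → ℝ) (x : E3) : ‖fderiv ℝ ψ x‖ ≤ ∑ j, |pd j ψ x| := by
  refine ContinuousLinearMap.opNorm_le_bound _ (by positivity) fun y => ?_
  have hy : y = ∑ j, y j • EuclideanSpace.single j (1 : ℝ) := by
    simpa using ((EuclideanSpace.basisFun (Fin 3) ℝ).sum_repr y).symm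
  conv_lhs => rw [hy]
  rw [map_sum, Finset.sum_mul]
  refine (norm_sum_le _ _).trans (Finset.sum_le_sum fun j _ => ?_)
  rw [map_smul, norm_smul, mul_comm]
  exact mul_le_mul_of_nonneg_left (PiLp.norm_apply_le y j) (abs_nonneg _)

/-- Sobolev's inequality for compactly supported functions with square integrable weak gradient. -/
lemma exists_sobolev_six : ∃ C : ℝ≥0, ∀ (x₀ : E3) (s : ℝ) (V : E3 → ℝ) (H : Fin 3 → E3 → ℝ),
    Integrable V → (∀ x, s ≤ dist x x₀ → V x = 0) → (∀ j, Measurable (H j)) →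
    (∀ a, 0 < a → ∀ j, pd j (cv (bumpScaled a) V) = cv (bumpScaled a) (H j)) →
    eLpNorm V 6 volume ≤ C * ∑ j, eLpNorm (H j) 2 volume := by
  refine ⟨SNormLESNormFDerivOfEqConst ℝ (volume : Measure E3) 2, fun x₀ s V H hV hs hH hVH => ?_⟩
  set S := SNormLESNormFDerivOfEqConst ℝ (volume : Measure E3) 2
  set κ := ∫ x, kerBump x
  have hκ : 0 < κ := integral_kerBump_pos
  have hsm : ∀ a, 0 < a → ContDiff ℝ (⊤ : ℕ∞) (cv (bumpScaled a) V) := fun a ha =>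
    contDiff_cv (n := ⊤) (contDiff_bumpScaled a) (hasCompactSupport_bumpScaled ha)
      hV.locallyIntegrable
  have hbd : ∀ a, 0 < a → eLpNorm (cv (bumpScaled a) V) 6 volume
      ≤ S * (ENNReal.ofReal κ * ∑ j, eLpNorm (H j) 2 volume) := by
    intro a ha
    have hc : HasCompactSupport (cv (bumpScaled a) V) :=
      (isCompact_closedBall x₀ (a / 2 + s)).of_isClosed_subset (isClosed_tsupport _)
        (tsupport_subset_closedBall fun x hx => cv_eq_zero (bumpScaled_zero ha) hs hx)
    have h1 := eLpNorm_le_eLpNorm_fderiv_of_eq (volume : Measure E3)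
      ((hsm a ha).of_le (by exact_mod_cast le_top)) hc (p := 2) (p' := 6) (by norm_num)
      (by simp) (by simp; norm_num)
    simp only [ENNReal.coe_ofNat, NNReal.coe_ofNat] at h1
    refine h1.trans (mul_le_mul_right ?_ _)
    have hcont : ∀ j, Continuous (pd j (cv (bumpScaled a) V)) := fun j =>
      (contDiff_pd (hsm a ha) j).continuous
    calc eLpNorm (fderiv ℝ (cv (bumpScaled a) V)) 2 volume
        ≤ eLpNorm (∑ j, fun x => |pd j (cv (bumpScaled a) V) x|) 2 volume := by
          refine eLpNorm_mono fun x => (norm_fderiv_le_sum_pd _ x).trans ?_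
          simp only [Finset.sum_apply]
          exact le_abs_self _
      _ ≤ ∑ j, eLpNorm (fun x => |pd j (cv (bumpScaled a) V) x|) 2 volume :=
          eLpNorm_sum_le (fun j _ => (hcont j).abs.aestronglyMeasurable) (by norm_num)
      _ = ∑ j, eLpNorm (cv (bumpScaled a) (H j)) 2 volume := by
          refine Finset.sum_congr rfl fun j _ => ?_
          rw [← hVH a ha j, ← eLpNorm_norm (pd j (cv (bumpScaled a) V))]
          simp only [Real.norm_eq_abs]
      _ ≤ ∑ j, ENNReal.ofReal κ * eLpNorm (H j) 2 volume :=
          Finset.sum_le_sum fun j _ => eLpNorm_cv_bump_le ha (hH j)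
      _ = _ := by rw [Finset.mul_sum]
  have hpos : ∀ n : ℕ, (0 : ℝ) < 1 / ((n : ℝ) + 1) := fun n => by positivity
  have h2 := Lp.eLpNorm_lim_le_liminf_eLpNorm (p := 6) (μ := (volume : Measure E3))
    (f := fun n : ℕ => cv (bumpScaled (1 / ((n : ℝ) + 1))) V)
    (fun n => (hsm _ (hpos n)).continuous.aestronglyMeasurable) (fun x => κ * V x) (by
      filter_upwards [ae_tendsto_cv_bump hV.locallyIntegrable] with x hx
      exact hx.comp (tendsto_nhdsWithin_iff.2
        ⟨tendsto_one_div_add_atTop_nhds_zero_nat, Eventually.of_forall hpos⟩))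
  have h3 : liminf (fun n : ℕ => eLpNorm (cv (bumpScaled (1 / ((n : ℝ) + 1))) V) 6 volume) atTop
      ≤ S * (ENNReal.ofReal κ * ∑ j, eLpNorm (H j) 2 volume) :=
    liminf_le_of_le (by isBoundedDefault) fun b hb => by
      obtain ⟨n, hn⟩ := hb.exists
      exact hn.trans (hbd _ (hpos n))
  have h4 : eLpNorm (fun x => κ * V x) 6 volume = ENNReal.ofReal κ * eLpNorm V 6 volume := by
    have := eLpNorm_const_smul κ V 6 (volume : Measure E3)
    rw [Real.enorm_eq_ofReal hκ.le] at this
    exact this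
  have h5 := h2.trans h3
  rw [h4, mul_left_comm] at h5
  exact (ENNReal.mul_le_mul_iff_right (by simpa using hκ) ENNReal.ofReal_ne_top).1 h5

/-- `G` is the weak gradient of `v` on `B ⊆ ℝ³`. -/
def WeakGrad (B : Set E3) (v : E3 → ℝ) (G : Fin 3 → E3 → ℝ) : Prop :=
  ∀ j φ, IsSpaceTest B φ → ∫ x in B, v x * pd j φ x = - ∫ x in B, G j x * φ x

/-- Product rule for a weak gradient and a cutoff function, in mollified form. -/
lemma WeakGrad.pd_cv_mul {B : Set E3} {v χ : E3 → ℝ} {G : Fin 3 → E3 → ℝ} (h : WeakGrad B v G)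
    (hB : MeasurableSet B) (hv : IntegrableOn v B) (hG : ∀ j, IntegrableOn (G j) B)
    (hχ : IsSpaceTest B χ) {K : E3 → ℝ} (hK : ContDiff ℝ (⊤ : ℕ∞) K) (hKc : HasCompactSupport K)
    (j : Fin 3) :
    pd j (cv K (B.indicator fun x => χ x * v x))
      = cv K (B.indicator fun x => χ x * G j x + pd j χ x * v x) := by
  have hbd : ∀ {f : E3 → ℝ}, Continuous f → HasCompactSupport f → ∀ {w : E3 → ℝ},
      IntegrableOn w B → IntegrableOn (fun x => f x * w x) B := fun {f} hf hfc {w} hw => by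
    obtain ⟨M, hM⟩ := hfc.exists_bound_of_continuous hf
    exact hw.bdd_mul (c := M) hf.aestronglyMeasurable (ae_of_all _ hM)
  have hχv : IntegrableOn (fun x => χ x * v x) B := hbd hχ.1.continuous hχ.2.1 hv
  rw [pd_cv (hK.of_le (by exact_mod_cast le_top)) hKc
    (hχv.integrable_indicator hB).locallyIntegrable]
  ext x
  have hcv : ∀ L f : E3 → ℝ, cv L (B.indicator f) x = ∫ y in B, L (x - y) * f y := fun L f => by
    rw [cv_apply, ← integral_indicator hB]
    congr 1
    ext y
    by_cases hy : y ∈ B <;> simp [hy]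
  rw [hcv, hcv]
  have hKx : ContDiff ℝ (⊤ : ℕ∞) fun y => K (x - y) := hK.comp (contDiff_const.sub contDiff_id)
  have hφ : IsSpaceTest B fun y => K (x - y) * χ y :=
    ⟨hKx.mul hχ.1, hχ.2.1.mul_left, (tsupport_mul_subset_right).trans hχ.2.2⟩
  have hpd : ∀ y, pd j (fun y => K (x - y) * χ y) y
      = -(pd j K (x - y) * χ y) + K (x - y) * pd j χ y := fun y => by
    have h1 : HasFDerivAt (fun y => K (x - y))
        ((fderiv ℝ K (x - y)).comp (-(ContinuousLinearMap.id ℝ E3))) y :=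
      HasFDerivAt.comp y (hK.differentiable (by simp) _).hasFDerivAt
        ((hasFDerivAt_id y).const_sub x)
    have h2 := h1.mul (hχ.1.differentiable (by simp) y).hasFDerivAt
    have h3 : fderiv ℝ (fun y => K (x - y) * χ y) y = _ := h2.fderiv
    rw [pd, h3]
    simp [pd]
    ring
  have ht := h j _ hφ
  simp only [hpd] at ht
  have c1 : Continuous fun y => pd j K (x - y) * χ y :=
    ((contDiff_pd hK j).continuous.comp (continuous_const.sub continuous_id)).mul
      hχ.1.continuous
  have i1 : IntegrableOn (fun y => pd j K (x - y) * χ y * v y) B := hbd c1 hχ.2.1.mul_left hv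
  have i2 : IntegrableOn (fun y => K (x - y) * pd j χ y * v y) B := hbd ((hKx.continuous).mul (contDiff_pd hχ.1 j).continuous)
    (hasCompactSupport_pd hχ.2.1 j).mul_left hv
  have i3 : IntegrableOn (fun y => K (x - y) * χ y * G j y) B := hbd ((hKx.continuous).mul hχ.1.continuous) hχ.2.1.mul_left (hG j)
  have e1 : ∫ y in B, v y * (-(pd j K (x - y) * χ y) + K (x - y) * pd j χ y)
      = -(∫ y in B, pd j K (x - y) * χ y * v y) + ∫ y in B, K (x - y) * pd j χ y * v y := by
    have i1' : IntegrableOn (fun y => -(pd j K (x - y) * χ y * v y)) B := i1.neg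
    rw [← integral_neg, ← integral_add i1' i2]
    congr 1
    ext y
    ring
  have e2 : ∫ y in B, K (x - y) * (χ y * G j y + pd j χ y * v y)
      = (∫ y in B, K (x - y) * χ y * G j y) + ∫ y in B, K (x - y) * pd j χ y * v y := by
    rw [← integral_add i3 i2]
    congr 1
    ext y
    ring
  have e3 : ∫ y in B, G j y * (K (x - y) * χ y) = ∫ y in B, K (x - y) * χ y * G j y := by
    congr 1
    ext y
    ring
  rw [e1, e3] at ht
  rw [e2]
  simp only [← mul_assoc]
  linarith

/-- Cutoff functions between `B_{3r/2}` and `B_{2r}` with the natural gradient bound. -/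
lemma exists_cutoff : ∃ K : ℝ, 0 ≤ K ∧ ∀ (x₀ : E3) (r : ℝ), 0 < r → ∃ χ : E3 → ℝ,
    IsSpaceTest (Metric.ball x₀ (2 * r)) χ ∧ (∀ x ∈ Metric.ball x₀ (3 / 2 * r), χ x = 1) ∧
    (∀ x, |χ x| ≤ 1) ∧ (∀ j x, |pd j χ x| ≤ K * r⁻¹) ∧
    (∀ x, 7 / 4 * r ≤ dist x x₀ → χ x = 0) := by
  let f : ContDiffBump (0 : E3) := ⟨3 / 2, 7 / 4, by norm_num, by norm_num⟩
  have hf : ContDiff ℝ (⊤ : ℕ∞) f := f.contDiff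
  choose k hk using fun j : Fin 3 =>
    (hasCompactSupport_pd f.hasCompactSupport j).exists_bound_of_continuous
      (contDiff_pd hf j).continuous
  have hk0 : ∀ j, 0 ≤ k j := fun j => (norm_nonneg _).trans (hk j 0)
  refine ⟨∑ j, k j, Finset.sum_nonneg fun j _ => hk0 j, fun x₀ r hr => ?_⟩
  have hr' : 0 < r⁻¹ := inv_pos.2 hr
  have hn : ∀ x : E3, ‖r⁻¹ • (x - x₀)‖ = r⁻¹ * dist x x₀ := fun x => by
    rw [norm_smul, Real.norm_of_nonneg hr'.le, dist_eq_norm]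
  have hz : ∀ x, 7 / 4 * r ≤ dist x x₀ → f (r⁻¹ • (x - x₀)) = 0 := fun x hx => by
    refine f.zero_of_le_dist ?_
    rw [dist_zero_right, hn, le_inv_mul_iff₀ hr, mul_comm]
    exact hx
  have ht : tsupport (fun x => f (r⁻¹ • (x - x₀))) ⊆ Metric.closedBall x₀ (7 / 4 * r) :=
    tsupport_subset_closedBall hz
  refine ⟨fun x => f (r⁻¹ • (x - x₀)), ⟨hf.comp (by fun_prop),
    (isCompact_closedBall _ _).of_isClosed_subset (isClosed_tsupport _) ht,
    ht.trans (Metric.closedBall_subset_ball (by linarith))⟩, fun x hx => ?_, fun x => ?_,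
    fun j x => ?_, hz⟩
  · refine f.one_of_mem_closedBall ?_
    rw [mem_closedBall_zero_iff, hn, inv_mul_le_iff₀ hr, mul_comm]
    exact (Metric.mem_ball.1 hx).le
  · rw [abs_of_nonneg f.nonneg]
    exact f.le_one
  · have h1 : pd j (fun x => f (r⁻¹ • (x - x₀))) x = r⁻¹ * pd j f (r⁻¹ • (x - x₀)) := by
      have h2 := congrFun (pd_comp_smul (hf.differentiable (by simp)) r⁻¹ 1 j) (x - x₀)
      simp only [one_mul] at h2
      rw [← h2, pd, pd, fderiv_comp_sub (f := fun y => f (r⁻¹ • y)) x₀]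
    rw [h1, abs_mul, abs_of_pos hr', mul_comm]
    refine mul_le_mul_of_nonneg_right ((hk j _).trans ?_) hr'.le
    exact Finset.single_le_sum (fun i _ => hk0 i) (Finset.mem_univ j)

/-- A local Ladyzhenskaya inequality. -/
lemma exists_ladyzhenskaya : ∃ C : ℝ, 0 ≤ C ∧ ∀ (x₀ : E3) (r : ℝ) (v : E3 → ℝ)
    (G : Fin 3 → E3 → ℝ), 0 < r → Measurable v → (∀ j, Measurable (G j)) →
    IntegrableOn (fun x => v x ^ 2) (Metric.ball x₀ (2 * r)) →
    (∀ j, IntegrableOn (fun x => G j x ^ 2) (Metric.ball x₀ (2 * r))) →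
    WeakGrad (Metric.ball x₀ (2 * r)) v G →
    IntegrableOn (fun x => v x ^ 4) (Metric.ball x₀ (3 / 2 * r)) ∧
    √(∫ x in Metric.ball x₀ (3 / 2 * r), v x ^ 4) ≤
      C * ((√(r ^ 3))⁻¹ * (∫ x in Metric.ball x₀ (2 * r), v x ^ 2)
        + √r * ∑ j, ∫ x in Metric.ball x₀ (2 * r), G j x ^ 2) := by
  obtain ⟨S, hS⟩ := exists_sobolev_six
  obtain ⟨K, hK0, hK⟩ := exists_cutoff
  set c₀ : ℝ := (3 * S) ^ 4 * (vol1 ^ ((1 : ℝ) / 3) * (3 / 2)) with hc₀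
  have hc₀0 : 0 ≤ c₀ := by have := vol1_pos; positivity
  refine ⟨√c₀ * (2 + 2 * K ^ 2), by positivity, ?_⟩
  intro x₀ r v G hr hv hG hv2 hG2 hw
  obtain ⟨χ, hχ, hχ1, hχb, hχd, hχz⟩ := hK x₀ r hr
  set B := Metric.ball x₀ (2 * r) with hB
  set D := Metric.ball x₀ (3 / 2 * r) with hD
  have hDB : D ⊆ B := Metric.ball_subset_ball (by linarith)
  have hBfin : IsFiniteMeasure (volume.restrict B) :=
    isFiniteMeasure_restrict.2 measure_ball_lt_top.ne
  have hL1 : ∀ {f : E3 → ℝ}, Measurable f → IntegrableOn (fun x => f x ^ 2) B →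
      IntegrableOn f B := fun hf hf2 =>
    ((memLp_two_iff_integrable_sq hf.aestronglyMeasurable).2 hf2).integrable (by norm_num)
  have hvi := hL1 hv hv2
  have hGi := fun j => hL1 (hG j) (hG2 j)
  set V := B.indicator fun x => χ x * v x with hV
  set H := fun j => B.indicator fun x => χ x * G j x + pd j χ x * v x with hH
  have hVi : Integrable V := IntegrableOn.integrable_indicator
    (hvi.bdd_mul (c := 1) hχ.1.continuous.aestronglyMeasurable (ae_of_all _ hχb))
    measurableSet_ball
  have hVz : ∀ x, 7 / 4 * r ≤ dist x x₀ → V x = 0 := fun x hx => by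
    by_cases hxB : x ∈ B <;> simp [hV, hxB, hχz x hx]
  have hHm : ∀ j, Measurable (H j) := fun j =>
    ((hχ.1.continuous.measurable.mul (hG j)).add
      ((contDiff_pd hχ.1 j).continuous.measurable.mul hv)).indicator measurableSet_ball
  have h6 := hS x₀ (7 / 4 * r) V H hVi hVz hHm fun a ha j =>
    hw.pd_cv_mul measurableSet_ball hvi hGi hχ (contDiff_bumpScaled a)
      (hasCompactSupport_bumpScaled ha) j
  set Iv := ∫ x in B, v x ^ 2 with hIv
  set IG := fun j => ∫ x in B, G j x ^ 2 with hIG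
  have hIv0 : 0 ≤ Iv := integral_nonneg fun x => sq_nonneg _
  have hIG0 : ∀ j, 0 ≤ IG j := fun j => integral_nonneg fun x => sq_nonneg _
  set N := 2 * (∑ j, IG j) + 2 * (K * r⁻¹) ^ 2 * Iv with hN
  have hIGs : 0 ≤ ∑ j, IG j := Finset.sum_nonneg fun j _ => hIG0 j
  have hN0 : 0 ≤ N := by positivity
  have hHN : ∀ j, eLpNorm (H j) 2 volume ≤ ENNReal.ofReal (√N) := by
    intro j
    rw [← ENNReal.pow_le_pow_left_iff two_ne_zero, eLpNorm_two_sq,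
      ← ENNReal.ofReal_pow (Real.sqrt_nonneg _), Real.sq_sqrt hN0]
    have hpt : ∀ x, H j x ^ 2
        ≤ B.indicator (fun x => 2 * G j x ^ 2 + 2 * (K * r⁻¹) ^ 2 * v x ^ 2) x := by
      intro x
      by_cases hx : x ∈ B
      · simp only [hH, indicator_of_mem hx]
        have q1 : (χ x * G j x) ^ 2 ≤ G j x ^ 2 := by
          rw [mul_pow]
          exact mul_le_of_le_one_left (sq_nonneg _) ((sq_le_one_iff_abs_le_one _).2 (hχb x))
        have q2 : (pd j χ x * v x) ^ 2 ≤ (K * r⁻¹) ^ 2 * v x ^ 2 := by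
          rw [mul_pow, ← sq_abs (pd j χ x)]
          have := hχd j x
          gcongr
        nlinarith [sq_nonneg (χ x * G j x - pd j χ x * v x)]
      · simp [hH, hx]
    have hi : IntegrableOn (fun x => 2 * G j x ^ 2 + 2 * (K * r⁻¹) ^ 2 * v x ^ 2) B :=
      ((hG2 j).const_mul 2).add (hv2.const_mul _)
    have hi2 := hi.integrable_indicator measurableSet_ball
    have hH2 : Integrable fun x => H j x ^ 2 :=
      hi2.mono' ((hHm j).pow_const 2).aestronglyMeasurable (ae_of_all _ fun x => by
        rw [Real.norm_of_nonneg (sq_nonneg _)]; exact hpt x)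
    rw [lintegral_enorm_sq_eq hH2]
    refine ENNReal.ofReal_le_ofReal ((integral_mono hH2 hi2 hpt).trans ?_)
    rw [integral_indicator measurableSet_ball, integral_add ((hG2 j).const_mul 2)
      (hv2.const_mul _), integral_const_mul, integral_const_mul]
    have := Finset.single_le_sum (f := IG) (fun i _ => hIG0 i) (Finset.mem_univ j)
    change 2 * IG j + 2 * (K * r⁻¹) ^ 2 * Iv ≤ N
    rw [hN]
    linarith
  have h6' : eLpNorm v 6 (volume.restrict D) ≤ ENNReal.ofReal (3 * S * √N) := by
    have e1 : eLpNorm v 6 (volume.restrict D) = eLpNorm V 6 (volume.restrict D) := by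
      refine eLpNorm_congr_ae ?_
      filter_upwards [ae_restrict_mem measurableSet_ball] with x hx
      rw [hV, indicator_of_mem (hDB hx), hχ1 x hx, one_mul]
    rw [e1]
    refine (eLpNorm_mono_measure _ Measure.restrict_le_self).trans (h6.trans ?_)
    calc (S : ℝ≥0∞) * ∑ j, eLpNorm (H j) 2 volume
        ≤ S * ∑ _j : Fin 3, ENNReal.ofReal (√N) :=
          mul_le_mul_right (Finset.sum_le_sum fun j _ => hHN j) _
      _ = _ := by
          rw [ENNReal.ofReal_mul (by positivity), ENNReal.ofReal_mul (by positivity)]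
          simp
          ring
  have h4 : ∫⁻ x in D, ‖v x‖ₑ ^ 4 ≤ ENNReal.ofReal (c₀ * r * N ^ 2) := by
    have q1 := eLpNorm_nnreal_pow_eq_lintegral (f := v) (μ := volume.restrict D) (p := 4)
      four_ne_zero
    simp only [ENNReal.coe_ofNat, NNReal.coe_ofNat, ENNReal.rpow_ofNat] at q1
    rw [← q1]
    have q2 := eLpNorm_le_eLpNorm_mul_rpow_measure_univ (f := v) (μ := volume.restrict D)
      (p := 4) (q := 6) (by norm_num) hv.aestronglyMeasurable
    have hvD : (volume.restrict D) univ = ENNReal.ofReal (vol1 * (3 / 2 * r) ^ 3) := by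
      rw [Measure.restrict_apply_univ, ← volume_real_ball x₀ (by positivity)]
      exact (ENNReal.ofReal_toReal measure_ball_lt_top.ne).symm
    rw [hvD] at q2
    calc eLpNorm v 4 (volume.restrict D) ^ 4
        ≤ (ENNReal.ofReal (3 * S * √N) * ENNReal.ofReal (vol1 * (3 / 2 * r) ^ 3)
          ^ ((1 : ℝ) / 4 - 1 / 6)) ^ 4 := by
          refine pow_le_pow_left₀ (by positivity) (q2.trans ?_) 4
          simp only [ENNReal.toReal_ofNat]
          gcongr
      _ = ENNReal.ofReal ((3 * S * √N) ^ 4 * (vol1 * (3 / 2 * r) ^ 3) ^ ((1 : ℝ) / 3)) := by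
          have := vol1_pos
          rw [ENNReal.ofReal_rpow_of_pos (by positivity), ← ENNReal.ofReal_mul (by positivity),
            ← ENNReal.ofReal_pow (by positivity), mul_pow, ← Real.rpow_natCast (_ ^ _) 4,
            ← Real.rpow_mul (by positivity)]
          norm_num
      _ = _ := by
          have := vol1_pos
          congr 1
          rw [Real.mul_rpow (by positivity) (by positivity), ← Real.rpow_natCast (3 / 2 * r) 3,
            ← Real.rpow_mul (by positivity), mul_pow,
            show √N ^ 4 = (√N ^ 2) ^ 2 by ring, Real.sq_sqrt hN0, hc₀]
          norm_num
          ring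
  have hv4e : ∀ x, ‖v x‖ₑ ^ 4 = ENNReal.ofReal (v x ^ 4) := fun x => by
    rw [Real.enorm_eq_ofReal_abs, ← ENNReal.ofReal_pow (abs_nonneg _), Even.pow_abs (by decide)]
  have hint : IntegrableOn (fun x => v x ^ 4) D := by
    refine ⟨(hv.pow_const 4).aestronglyMeasurable, ?_⟩
    rw [hasFiniteIntegral_iff_ofReal (ae_of_all _ fun x => by positivity)]
    simp only [← hv4e]
    exact h4.trans_lt ENNReal.ofReal_lt_top
  refine ⟨hint, ?_⟩
  simp only [hv4e] at h4
  rw [← ofReal_integral_eq_lintegral_ofReal hint (ae_of_all _ fun x => by positivity),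
    ENNReal.ofReal_le_ofReal_iff (by positivity)] at h4
  have hrr : √(r ^ 3) = r * √r := by
    rw [show r ^ 3 = r ^ 2 * r by ring, Real.sqrt_mul (sq_nonneg r), Real.sqrt_sq hr.le]
  have hsr : 0 < √r := Real.sqrt_pos.2 hr
  have hss : √r * √r = r := Real.mul_self_sqrt hr.le
  have hinv : √r * r⁻¹ ^ 2 = (r * √r)⁻¹ := by
    field_simp
    nlinarith
  calc √(∫ x in D, v x ^ 4) ≤ √(c₀ * r * N ^ 2) := Real.sqrt_le_sqrt h4
    _ = √c₀ * (√r * N) := by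
        rw [Real.sqrt_mul (by positivity), Real.sqrt_mul hc₀0, Real.sqrt_sq hN0, mul_assoc]
    _ = √c₀ * (2 * K ^ 2 * ((√(r ^ 3))⁻¹ * Iv) + 2 * (√r * ∑ j, IG j)) := by
        rw [hrr, ← hinv, hN]
        ring
    _ ≤ √c₀ * ((2 + 2 * K ^ 2) * ((√(r ^ 3))⁻¹ * Iv + √r * ∑ j, IG j)) := by
        have q1 : 0 ≤ (√(r ^ 3))⁻¹ * Iv := by positivity
        have q2 : 0 ≤ K ^ 2 * (√r * ∑ j, IG j) := by positivity
        gcongr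
        nlinarith
    _ = _ := by ring

lemma restrict_prod_eq {B : Set E3} {I : Set ℝ} :
    (volume : Measure SpT).restrict (B ×ˢ I) = (volume.restrict B).prod (volume.restrict I) := by
  rw [Measure.prod_restrict]; rfl

/-- Restricting a space-time identity, tested with products `φ(x)η(t)`, to almost every time
slice. -/
lemma ae_slice_integral_eq_zero {κ : Type*} [Fintype κ] {x₀ : E3} {ρ : ℝ} {I : Set ℝ}
    (hI : IsOpen I) {T : κ → (E3 → ℝ) → E3 → ℝ} {f : κ → SpT → ℝ}
    (hT : ∀ α φ, IsSpaceTest (Metric.ball x₀ ρ) φ → Continuous (T α φ))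
    (hf : ∀ α, IntegrableOn (f α) (Metric.ball x₀ ρ ×ˢ I))
    (h : ∀ φ η, IsSpaceTest (Metric.ball x₀ ρ) φ → ContDiff ℝ (⊤ : ℕ∞) η →
      HasCompactSupport η → tsupport η ⊆ I →
      ∫ z in Metric.ball x₀ ρ ×ˢ I, (∑ α, f α z * T α φ z.1) * η z.2 = 0) :
    ∀ᵐ t ∂volume.restrict I, ∀ φ, IsSpaceTest (Metric.ball x₀ ρ) φ →
      ∫ x in Metric.ball x₀ ρ, ∑ α, f α (x, t) * T α φ x = 0 := by
  set B := Metric.ball x₀ ρ with hB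
  set K := Metric.closedBall x₀ ρ with hK
  have hBK : B ⊆ K := Metric.ball_subset_closedBall
  have hKc : IsCompact K := isCompact_closedBall _ _
  have : CompactSpace K := isCompact_iff_compactSpace.1 hKc
  have hbd : ∀ α φ, IsSpaceTest B φ → ∃ M, ∀ x ∈ B, ‖T α φ x‖ ≤ M := fun α φ hφ => by
    obtain ⟨M, hM⟩ := hKc.exists_bound_of_continuousOn (hT α φ hφ).continuousOn
    exact ⟨M, fun x hx => hM x (hBK hx)⟩
  have single : ∀ φ, IsSpaceTest B φ → ∀ᵐ t ∂volume.restrict I,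
      ∫ x in B, ∑ α, f α (x, t) * T α φ x = 0 := by
    intro φ hφ
    have hF : Integrable (fun z : SpT => ∑ α, f α z * T α φ z.1)
        ((volume.restrict B).prod (volume.restrict I)) := by
      rw [← restrict_prod_eq]
      refine integrable_finsetSum _ fun α _ => ?_
      obtain ⟨M, hM⟩ := hbd α φ hφ
      refine (hf α).mul_bdd (c := M)
        ((hT α φ hφ).comp continuous_fst).aestronglyMeasurable ?_
      have hms : ∀ᵐ z : SpT ∂volume.restrict (B ×ˢ I), z.1 ∈ B := by
        rw [restrict_prod_eq]
        exact Measure.quasiMeasurePreserving_fst.ae (ae_restrict_mem measurableSet_ball)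
      filter_upwards [hms] with z hz using hM _ hz
    have hg := hF.integral_prod_right
    rw [ae_restrict_iff' hI.measurableSet]
    refine hI.ae_eq_zero_of_integral_contDiff_smul_eq_zero
      (IntegrableOn.locallyIntegrableOn hg) fun η hη hηc hηI => ?_
    have q := h φ η hφ hη hηc hηI
    obtain ⟨M, hM⟩ := hηc.exists_bound_of_continuous hη.continuous
    have hFη : Integrable (fun z : SpT => (∑ α, f α z * T α φ z.1) * η z.2)
        ((volume.restrict B).prod (volume.restrict I)) :=
      hF.mul_bdd (c := M) (hη.continuous.comp continuous_snd).aestronglyMeasurable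
        (ae_of_all _ fun z => hM z.2)
    rw [restrict_prod_eq, integral_prod_symm _ hFη] at q
    rw [← q, ← setIntegral_eq_integral_of_forall_compl_eq_zero (s := I)]
    · refine integral_congr_ae (ae_of_all _ fun t => ?_)
      simp only [smul_eq_mul]
      rw [integral_mul_const, mul_comm]
    · intro t ht
      rw [image_eq_zero_of_notMem_tsupport fun h' => ht (hηI h'), zero_smul]
  let e : {φ // IsSpaceTest B φ} → κ → C(K, ℝ) := fun φ α =>
    ⟨fun x => T α φ.1 x, (hT α φ.1 φ.2).comp continuous_subtype_val⟩
  obtain ⟨c, hcS, hc, hcd⟩ :=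
    (TopologicalSpace.IsSeparable.of_separableSpace (range e)).exists_countable_dense_subset
  choose ψ hψ using fun s (hs : s ∈ c) => hcS hs
  have hall : ∀ᵐ t ∂volume.restrict I, ∀ s, ∀ hs : s ∈ c,
      ∫ x in B, ∑ α, f α (x, t) * T α (ψ s hs).1 x = 0 :=
    (ae_ball_iff hc).2 fun s hs => single (ψ s hs).1 (ψ s hs).2
  have hint : ∀ᵐ t ∂volume.restrict I, ∀ α, IntegrableOn (fun x => f α (x, t)) B := by
    refine ae_all_iff.2 fun α => ?_
    have := hf α
    rw [IntegrableOn, restrict_prod_eq] at this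
    exact this.prod_left_ae
  filter_upwards [hall, hint] with t ht hit φ hφ
  have hIT : ∀ χ, IsSpaceTest B χ → ∀ α, IntegrableOn (fun x => f α (x, t) * T α χ x) B := by
    intro χ hχ α
    obtain ⟨M, hM⟩ := hbd α χ hχ
    exact (hit α).mul_bdd (c := M) (hT α χ hχ).aestronglyMeasurable
      ((ae_restrict_mem measurableSet_ball).mono fun x hx => hM x hx)
  have hN : 0 ≤ ∑ α, ∫ x in B, ‖f α (x, t)‖ :=
    Finset.sum_nonneg fun α _ => integral_nonneg fun x => norm_nonneg _
  rw [← norm_le_zero_iff]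
  refine le_of_forall_pos_le_add fun ε hε => ?_
  set N := ∑ α, ∫ x in B, ‖f α (x, t)‖ with hNdef
  obtain ⟨s, hs, hsd⟩ := Metric.mem_closure_iff.1 (hcd (mem_range_self ⟨φ, hφ⟩)) (ε / (N + 1))
    (by positivity)
  have hcl : ∀ α, ∀ x ∈ B, ‖T α φ x - T α (ψ s hs).1 x‖ ≤ ε / (N + 1) := by
    intro α x hx
    have q1 : dist (e ⟨φ, hφ⟩ α ⟨x, hBK hx⟩) (s α ⟨x, hBK hx⟩) ≤ ε / (N + 1) :=
      (ContinuousMap.dist_apply_le_dist _).trans ((dist_le_pi_dist _ _ α).trans hsd.le)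
    rw [← hψ s hs, dist_eq_norm] at q1
    exact q1
  calc ‖∫ x in B, ∑ α, f α (x, t) * T α φ x‖
      = ‖∑ α, ∫ x in B, f α (x, t) * (T α φ x - T α (ψ s hs).1 x)‖ := by
        have := ht s hs
        rw [integral_finsetSum _ fun α _ => hIT _ (ψ s hs).2 α] at this
        rw [integral_finsetSum _ fun α _ => hIT _ hφ α,
          ← sub_zero (∑ α, ∫ x in B, f α (x, t) * T α φ x), ← this, ← Finset.sum_sub_distrib]
        congr 1
        refine Finset.sum_congr rfl fun α _ => ?_
        rw [← integral_sub (hIT _ hφ α) (hIT _ (ψ s hs).2 α)]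
        simp only [mul_sub]
    _ ≤ ∑ α, (∫ x in B, ‖f α (x, t)‖) * (ε / (N + 1)) := by
        refine norm_sum_le_of_le _ fun α _ => ?_
        rw [← integral_mul_const]
        refine norm_integral_le_of_norm_le ((hit α).norm.mul_const _) ?_
        filter_upwards [ae_restrict_mem measurableSet_ball] with x hx
        rw [norm_mul]
        exact mul_le_mul_of_nonneg_left (hcl α x hx) (norm_nonneg _)
    _ = N * (ε / (N + 1)) := by rw [hNdef, Finset.sum_mul]
    _ ≤ 0 + ε := by
        rw [zero_add, mul_div_assoc', div_le_iff₀ (by positivity)]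
        nlinarith

lemma sderiv_prod_mul {φ : E3 → ℝ} {η : ℝ → ℝ} (hφ : Differentiable ℝ φ)
    (hη : Differentiable ℝ η) (j : Fin 3) :
    sderiv j (fun z => φ z.1 * η z.2) = fun z => pd j φ z.1 * η z.2 := by
  ext z
  have h1 : HasFDerivAt (fun z : SpT => φ z.1) ((fderiv ℝ φ z.1).comp
      (ContinuousLinearMap.fst ℝ E3 ℝ)) z := (hφ z.1).hasFDerivAt.comp z hasFDerivAt_fst
  have h2 : HasFDerivAt (fun z : SpT => η z.2) ((fderiv ℝ η z.2).comp
      (ContinuousLinearMap.snd ℝ E3 ℝ)) z := (hη z.2).hasFDerivAt.comp z hasFDerivAt_snd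
  rw [sderiv, HasFDerivAt.fderiv (f := fun z : SpT => φ z.1 * η z.2) (h1.mul h2), pd]
  simp [mul_comm]

lemma isTestOn_prod_mul {B : Set E3} {I : Set ℝ} {U : Set SpT} (hU : B ×ˢ I ⊆ U) {φ : E3 → ℝ}
    {η : ℝ → ℝ} (hφ : IsSpaceTest B φ) (hη : ContDiff ℝ (⊤ : ℕ∞) η) (hηc : HasCompactSupport η)
    (hηI : tsupport η ⊆ I) : IsTestOn U (fun z => φ z.1 * η z.2) := by
  have hs : tsupport (fun z : SpT => φ z.1 * η z.2) ⊆ tsupport φ ×ˢ tsupport η := by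
    refine closure_minimal (fun z hz => ?_)
      ((isClosed_tsupport _).prod (isClosed_tsupport _))
    exact ⟨subset_tsupport _ (left_ne_zero_of_mul hz), subset_tsupport _ (right_ne_zero_of_mul hz)⟩
  exact ⟨(hφ.1.comp contDiff_fst).mul (hη.comp contDiff_snd),
    (hφ.2.1.isCompact.prod hηc.isCompact).of_isClosed_subset (isClosed_tsupport _) hs,
    hs.trans ((prod_mono hφ.2.2 hηI).trans hU)⟩

lemma setIntegral_mul_prod_test {B : Set E3} {I : Set ℝ} {U : Set SpT} (hU : B ×ˢ I ⊆ U)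
    (hUm : MeasurableSet U) {φ : E3 → ℝ} {η : ℝ → ℝ} (f : SpT → ℝ) (hφ : tsupport φ ⊆ B)
    (hη : tsupport η ⊆ I) :
    ∫ z in U, f z * (φ z.1 * η z.2) = ∫ z in B ×ˢ I, f z * (φ z.1 * η z.2) := by
  refine setIntegral_eq_of_subset_of_forall_sdiff_eq_zero hUm hU fun z hz => ?_
  by_cases h1 : z.1 ∈ B
  · rw [image_eq_zero_of_notMem_tsupport (f := η) fun h => hz.2 ⟨h1, hη h⟩, mul_zero, mul_zero]
  · rw [image_eq_zero_of_notMem_tsupport (f := φ) fun h => h1 (hφ h), zero_mul, mul_zero]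

lemma IntegrableOn.mul_prod_test {S : Set SpT} {f : SpT → ℝ} (hf : IntegrableOn f S)
    {φ : E3 → ℝ} {η : ℝ → ℝ} (hφ : Continuous φ) (hφc : HasCompactSupport φ)
    (hη : Continuous η) (hηc : HasCompactSupport η) :
    IntegrableOn (fun z => f z * (φ z.1 * η z.2)) S := by
  obtain ⟨M, hM⟩ := hφc.exists_bound_of_continuous hφ
  obtain ⟨N, hN⟩ := hηc.exists_bound_of_continuous hη
  refine Integrable.mul_bdd (c := M * N) hf
    ((hφ.comp continuous_fst).mul (hη.comp continuous_snd)).aestronglyMeasurable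
    (ae_of_all _ fun z => ?_)
  rw [norm_mul]
  exact mul_le_mul (hM _) (hN _) (norm_nonneg _) ((norm_nonneg _).trans (hM z.1))

lemma IntegrableOn.mul_spaceTest {S : Set E3} {f : E3 → ℝ} (hf : IntegrableOn f S)
    {φ : E3 → ℝ} (hφ : Continuous φ) (hφc : HasCompactSupport φ) :
    IntegrableOn (fun x => f x * φ x) S := by
  obtain ⟨M, hM⟩ := hφc.exists_bound_of_continuous hφ
  exact Integrable.mul_bdd (c := M) hf hφ.aestronglyMeasurable (ae_of_all _ hM)

lemma ae_slice_integrableOn {B : Set E3} {I : Set ℝ} {f : SpT → ℝ}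
    (hf : IntegrableOn f (B ×ˢ I)) :
    ∀ᵐ t ∂volume.restrict I, IntegrableOn (fun x => f (x, t)) B := by
  rw [IntegrableOn, restrict_prod_eq] at hf
  exact hf.prod_left_ae

/-- Weak spatial gradients restrict to almost every time slice. -/
lemma WeakSGrad.ae_slice {x₀ : E3} {ρ : ℝ} {I : Set ℝ} {U : Set SpT} (hI : IsOpen I)
    (hU : Metric.ball x₀ ρ ×ˢ I ⊆ U) (hUm : MeasurableSet U) {f : SpT → ℝ}
    {g : Fin 3 → SpT → ℝ} (h : WeakSGrad U f g) (hf : IntegrableOn f (Metric.ball x₀ ρ ×ˢ I))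
    (hg : ∀ j, IntegrableOn (g j) (Metric.ball x₀ ρ ×ˢ I)) :
    ∀ᵐ t ∂volume.restrict I,
      WeakGrad (Metric.ball x₀ ρ) (fun x => f (x, t)) (fun j x => g j (x, t)) := by
  refine ae_all_iff.2 fun j => ?_
  have key := ae_slice_integral_eq_zero (κ := Bool) (x₀ := x₀) (ρ := ρ) hI
    (T := fun b φ => bif b then pd j φ else φ) (f := fun b => bif b then f else g j)
    (by
      rintro (_ | _) φ hφ
      · exact hφ.1.continuous
      · exact (contDiff_pd hφ.1 j).continuous)
    (by
      rintro (_ | _)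
      · exact hg j
      · exact hf)
    (by
      intro φ η hφ hη hηc hηI
      have hψ := h j _ (isTestOn_prod_mul hU hφ hη hηc hηI)
      rw [sderiv_prod_mul (hφ.1.differentiable (by simp)) (hη.differentiable (by simp)),
        setIntegral_mul_prod_test hU hUm _ (hφ.pd j).2.2 hηI,
        setIntegral_mul_prod_test hU hUm _ hφ.2.2 hηI] at hψ
      simp only [Fintype.sum_bool, cond_true, cond_false, add_mul, mul_assoc]
      rw [integral_add (IntegrableOn.mul_prod_test hf (hφ.pd j).1.continuous (hφ.pd j).2.1
        hη.continuous hηc) (IntegrableOn.mul_prod_test (hg j) hφ.1.continuous hφ.2.1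
        hη.continuous hηc), hψ, neg_add_cancel])
  filter_upwards [key, ae_slice_integrableOn hf, ae_slice_integrableOn (hg j)]
    with t ht hft hgt φ hφ
  have := ht φ hφ
  simp only [Fintype.sum_bool, cond_true, cond_false] at this
  rw [integral_add (IntegrableOn.mul_spaceTest hft (hφ.pd j).1.continuous (hφ.pd j).2.1)
    (IntegrableOn.mul_spaceTest hgt hφ.1.continuous hφ.2.1)] at this
  exact eq_neg_of_add_eq_zero_left this

/-- The weak pressure equation restricts to almost every time slice. -/
lemma PressureEqOn.ae_slice {x₀ : E3} {ρ : ℝ} {I : Set ℝ} {U : Set SpT} (hI : IsOpen I)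
    (hU : Metric.ball x₀ ρ ×ˢ I ⊆ U) (hUm : MeasurableSet U) {u : SpT → E3} {p : SpT → ℝ}
    {Dd : SpT → Fin 3 → Fin 3 → ℝ} (h : PressureEqOn U u p Dd)
    (hp : IntegrableOn p (Metric.ball x₀ ρ ×ˢ I))
    (hF : ∀ i j, IntegrableOn (fun z => u z i * u z j + ∑ k, Dd z k i * Dd z k j)
      (Metric.ball x₀ ρ ×ˢ I)) :
    ∀ᵐ t ∂volume.restrict I, ∀ φ, IsSpaceTest (Metric.ball x₀ ρ) φ →
      -∫ x in Metric.ball x₀ ρ, p (x, t) * ∑ j, pd j (pd j φ) x =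
        ∫ x in Metric.ball x₀ ρ, ∑ i, ∑ j,
          (u (x, t) i * u (x, t) j + ∑ k, Dd (x, t) k i * Dd (x, t) k j) * pd i (pd j φ) x := by
  set F : Fin 3 → Fin 3 → SpT → ℝ := fun i j z => u z i * u z j + ∑ k, Dd z k i * Dd z k j
    with hFdef
  have hlap : ∀ {φ}, IsSpaceTest (Metric.ball x₀ ρ) φ →
      IsSpaceTest (Metric.ball x₀ ρ) fun x => ∑ j, pd j (pd j φ) x := by
    intro φ hφ
    have hs : tsupport (fun x => ∑ j, pd j (pd j φ) x) ⊆ tsupport φ := by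
      refine closure_minimal (fun x hx => ?_) (isClosed_tsupport _)
      obtain ⟨j, -, hj⟩ := Finset.exists_ne_zero_of_sum_ne_zero hx
      exact (tsupport_pd_subset _ j).trans (tsupport_pd_subset _ j) (subset_tsupport _ hj)
    exact ⟨ContDiff.sum fun j _ => ((hφ.pd j).pd j).1,
      hφ.2.1.isCompact.of_isClosed_subset (isClosed_tsupport _) hs, hs.trans hφ.2.2⟩
  have key := ae_slice_integral_eq_zero (κ := Option (Fin 3 × Fin 3)) (x₀ := x₀) (ρ := ρ) hI
    (T := fun a φ => a.elim (fun x => ∑ j, pd j (pd j φ) x) fun ij => pd ij.1 (pd ij.2 φ))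
    (f := fun a => a.elim p fun ij => F ij.1 ij.2)
    (by
      rintro (_ | ⟨i, j⟩) φ hφ
      · exact (hlap hφ).1.continuous
      · exact ((hφ.pd j).pd i).1.continuous)
    (by
      rintro (_ | ⟨i, j⟩)
      · exact hp
      · exact hF i j)
    (by
      intro φ η hφ hη hηc hηI
      have hψ := h _ (isTestOn_prod_mul hU hφ hη hηc hηI)
      have hηd : Differentiable ℝ η := hη.differentiable (by simp)
      have hs : ∀ i j, sderiv i (sderiv j fun z => φ z.1 * η z.2)
          = fun z => pd i (pd j φ) z.1 * η z.2 := fun i j => by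
        rw [sderiv_prod_mul (hφ.1.differentiable (by simp)) hηd,
          sderiv_prod_mul ((hφ.pd j).1.differentiable (by simp)) hηd]
      simp only [sLap, hs, ← Finset.sum_mul] at hψ
      rw [setIntegral_mul_prod_test (φ := fun x => ∑ j, pd j (pd j φ) x) hU hUm _
        (hlap hφ).2.2 hηI] at hψ
      have hr : ∫ z in U, ∑ i, ∑ j, F i j z * (pd i (pd j φ) z.1 * η z.2)
          = ∫ z in Metric.ball x₀ ρ ×ˢ I, ∑ i, ∑ j, F i j z * (pd i (pd j φ) z.1 * η z.2) := by
        refine setIntegral_eq_of_subset_of_forall_sdiff_eq_zero hUm hU fun z hz => ?_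
        refine Finset.sum_eq_zero fun i _ => Finset.sum_eq_zero fun j _ => ?_
        by_cases h1 : z.1 ∈ Metric.ball x₀ ρ
        · rw [image_eq_zero_of_notMem_tsupport (f := η) fun h => hz.2 ⟨h1, hηI h⟩, mul_zero,
            mul_zero]
        · rw [image_eq_zero_of_notMem_tsupport (f := pd i (pd j φ))
            fun h => h1 (((hφ.pd j).pd i).2.2 h), zero_mul, mul_zero]
      change _ = ∫ z in U, ∑ i, ∑ j, F i j z * (pd i (pd j φ) z.1 * η z.2) at hψ
      rw [hr] at hψ
      have hsum : ∀ z : SpT, (∑ a : Option (Fin 3 × Fin 3), a.elim p (fun ij => F ij.1 ij.2) z *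
          a.elim (fun x => ∑ j, pd j (pd j φ) x) (fun ij => pd ij.1 (pd ij.2 φ)) z.1) * η z.2
          = p z * ((∑ j, pd j (pd j φ) z.1) * η z.2)
            + ∑ i, ∑ j, F i j z * (pd i (pd j φ) z.1 * η z.2) := fun z => by
        simp only [Fintype.sum_option, Option.elim_none, Option.elim_some,
          Fintype.sum_prod_type, add_mul, Finset.sum_mul, mul_assoc]
      simp only [hsum]
      rw [integral_add (IntegrableOn.mul_prod_test hp (hlap hφ).1.continuous (hlap hφ).2.1
        hη.continuous hηc) (integrable_finsetSum _ fun i _ => integrable_finsetSum _ fun j _ =>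
          IntegrableOn.mul_prod_test (hF i j) ((hφ.pd j).pd i).1.continuous
            ((hφ.pd j).pd i).2.1 hη.continuous hηc), ← hψ, add_neg_cancel])
  filter_upwards [key, ae_slice_integrableOn hp, ae_all_iff.2 fun i => ae_all_iff.2 fun j =>
    ae_slice_integrableOn (hF i j)] with t ht hpt hFt φ hφ
  have := ht φ hφ
  simp only [Fintype.sum_option, Option.elim_none, Option.elim_some,
    Fintype.sum_prod_type] at this
  rw [integral_add (IntegrableOn.mul_spaceTest hpt (hlap hφ).1.continuous (hlap hφ).2.1)
    (integrable_finsetSum _ fun i _ => integrable_finsetSum _ fun j _ =>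
      IntegrableOn.mul_spaceTest (hFt i j) ((hφ.pd j).pd i).1.continuous
        ((hφ.pd j).pd i).2.1)] at this
  exact neg_eq_of_add_eq_zero_right this

lemma sqrt_sum_le_sum_sqrt {κ : Type*} (s : Finset κ) {a : κ → ℝ} (ha : ∀ i, 0 ≤ a i) :
    √(∑ i ∈ s, a i) ≤ ∑ i ∈ s, √(a i) := by
  refine Real.sqrt_le_iff.2 ⟨Finset.sum_nonneg fun i _ => Real.sqrt_nonneg _, ?_⟩
  calc ∑ i ∈ s, a i = ∑ i ∈ s, √(a i) ^ 2 :=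
        Finset.sum_congr rfl fun i _ => (Real.sq_sqrt (ha i)).symm
    _ ≤ _ := Finset.sum_sq_le_sq_sum_of_nonneg fun i _ => Real.sqrt_nonneg _

/-- The local Ladyzhenskaya inequality for finite families of functions. -/
lemma exists_ladyzhenskaya_sum (κ : Type*) [Fintype κ] : ∃ C : ℝ, 0 ≤ C ∧
    ∀ (x₀ : E3) (r : ℝ) (c : κ → E3 → ℝ) (G : κ → Fin 3 → E3 → ℝ), 0 < r →
    (∀ α, Measurable (c α)) → (∀ α j, Measurable (G α j)) →
    IntegrableOn (fun x => ∑ α, c α x ^ 2) (Metric.ball x₀ (2 * r)) →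
    IntegrableOn (fun x => ∑ α, ∑ j, G α j x ^ 2) (Metric.ball x₀ (2 * r)) →
    (∀ α, WeakGrad (Metric.ball x₀ (2 * r)) (c α) (G α)) →
    IntegrableOn (fun x => (∑ α, c α x ^ 2) ^ 2) (Metric.ball x₀ (3 / 2 * r)) ∧
    √(∫ x in Metric.ball x₀ (3 / 2 * r), (∑ α, c α x ^ 2) ^ 2) ≤
      C * ((√(r ^ 3))⁻¹ * (∫ x in Metric.ball x₀ (2 * r), ∑ α, c α x ^ 2)
        + √r * ∫ x in Metric.ball x₀ (2 * r), ∑ α, ∑ j, G α j x ^ 2) := by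
  obtain ⟨C, hC, h⟩ := exists_ladyzhenskaya
  refine ⟨√(Fintype.card κ) * C, by positivity, ?_⟩
  intro x₀ r c G hr hc hG hci hGi hw
  have hc2 : ∀ α, IntegrableOn (fun x => c α x ^ 2) (Metric.ball x₀ (2 * r)) := fun α =>
    Integrable.mono' hci ((hc α).pow_const 2).aestronglyMeasurable (ae_of_all _ fun x => by
      rw [Real.norm_of_nonneg (sq_nonneg _)]
      exact Finset.single_le_sum (f := fun α => c α x ^ 2) (fun _ _ => sq_nonneg _)
        (Finset.mem_univ α))
  have hG2 : ∀ α j, IntegrableOn (fun x => G α j x ^ 2) (Metric.ball x₀ (2 * r)) := fun α j =>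
    Integrable.mono' hGi ((hG α j).pow_const 2).aestronglyMeasurable (ae_of_all _ fun x => by
      rw [Real.norm_of_nonneg (sq_nonneg _)]
      exact (Finset.single_le_sum (f := fun j => G α j x ^ 2) (fun _ _ => sq_nonneg _)
        (Finset.mem_univ j)).trans (Finset.single_le_sum (f := fun α => ∑ j, G α j x ^ 2)
          (fun _ _ => Finset.sum_nonneg fun _ _ => sq_nonneg _) (Finset.mem_univ α)))
  have hk := fun α => h x₀ r (c α) (G α) hr (hc α) (hG α) (hc2 α) (hG2 α) (hw α)
  have hpt : ∀ x, (∑ α, c α x ^ 2) ^ 2 ≤ Fintype.card κ * ∑ α, c α x ^ 4 := fun x => by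
    refine sq_sum_le_card_mul_sum_sq.trans_eq ?_
    simp only [Finset.card_univ, ← pow_mul]
  have hi4 : IntegrableOn (fun x => (Fintype.card κ : ℝ) * ∑ α, c α x ^ 4)
      (Metric.ball x₀ (3 / 2 * r)) :=
    (integrable_finsetSum _ fun α _ => (hk α).1).const_mul _
  have hi : IntegrableOn (fun x => (∑ α, c α x ^ 2) ^ 2) (Metric.ball x₀ (3 / 2 * r)) :=
    Integrable.mono' hi4
      ((Finset.measurable_fun_sum _ fun α _ => (hc α).pow_const 2).pow_const
        2).aestronglyMeasurable
      (ae_of_all _ fun x => by rw [Real.norm_of_nonneg (sq_nonneg _)]; exact hpt x)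
  refine ⟨hi, ?_⟩
  calc √(∫ x in Metric.ball x₀ (3 / 2 * r), (∑ α, c α x ^ 2) ^ 2)
      ≤ √(Fintype.card κ * ∑ α, ∫ x in Metric.ball x₀ (3 / 2 * r), c α x ^ 4) := by
        refine Real.sqrt_le_sqrt ((integral_mono hi hi4 hpt).trans_eq ?_)
        rw [integral_const_mul, integral_finsetSum _ fun α _ => (hk α).1]
    _ ≤ √(Fintype.card κ) * ∑ α, √(∫ x in Metric.ball x₀ (3 / 2 * r), c α x ^ 4) := by
        rw [Real.sqrt_mul (by positivity)]
        exact mul_le_mul_of_nonneg_left (sqrt_sum_le_sum_sqrt _ fun α =>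
          integral_nonneg fun x => by positivity) (Real.sqrt_nonneg _)
    _ ≤ √(Fintype.card κ) * ∑ α, C * ((√(r ^ 3))⁻¹ * (∫ x in Metric.ball x₀ (2 * r), c α x ^ 2)
        + √r * ∑ j, ∫ x in Metric.ball x₀ (2 * r), G α j x ^ 2) :=
        mul_le_mul_of_nonneg_left (Finset.sum_le_sum fun α _ => (hk α).2) (Real.sqrt_nonneg _)
    _ = _ := by
        rw [integral_finsetSum _ fun α _ => hc2 α,
          integral_finsetSum _ fun α _ => integrable_finsetSum _ fun j _ => hG2 α j]
        simp only [integral_finsetSum _ fun j _ => hG2 _ j]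
        rw [← Finset.mul_sum, Finset.sum_add_distrib, ← Finset.mul_sum, ← Finset.mul_sum,
          mul_assoc]

/-- `|u|² + |∇d|²`. -/
def energyDens {α : Type*} (u : α → E3) (A : α → Fin 3 → Fin 3 → ℝ) (x : α) : ℝ :=
  ‖u x‖ ^ 2 + nsq2 (A x)

/-- `|∇u|² + |∇²d|²`. -/
def dissDens {α : Type*} (Du : α → Fin 3 → Fin 3 → ℝ) (D2 : α → Fin 3 → Fin 3 → Fin 3 → ℝ)
    (x : α) : ℝ := nsq2 (Du x) + nsq3 (D2 x)

lemma nsq2_nonneg (M : Fin 3 → Fin 3 → ℝ) : 0 ≤ nsq2 M :=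
  Finset.sum_nonneg fun _ _ => Finset.sum_nonneg fun _ _ => sq_nonneg _

lemma nsq3_nonneg (A : Fin 3 → Fin 3 → Fin 3 → ℝ) : 0 ≤ nsq3 A :=
  Finset.sum_nonneg fun _ _ => nsq2_nonneg _

lemma energyDens_nonneg {α : Type*} (u : α → E3) (A : α → Fin 3 → Fin 3 → ℝ) (x : α) :
    0 ≤ energyDens u A x := add_nonneg (sq_nonneg _) (nsq2_nonneg _)

lemma dissDens_nonneg {α : Type*} (Du : α → Fin 3 → Fin 3 → ℝ)
    (D2 : α → Fin 3 → Fin 3 → Fin 3 → ℝ) (x : α) : 0 ≤ dissDens Du D2 x :=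
  add_nonneg (nsq2_nonneg _) (nsq3_nonneg _)

lemma sq_le_nsq2 (M : Fin 3 → Fin 3 → ℝ) (i j : Fin 3) : M i j ^ 2 ≤ nsq2 M :=
  (Finset.single_le_sum (f := fun j => M i j ^ 2) (fun _ _ => sq_nonneg _)
    (Finset.mem_univ j)).trans (Finset.single_le_sum (f := fun i => ∑ j, M i j ^ 2)
      (fun _ _ => Finset.sum_nonneg fun _ _ => sq_nonneg _) (Finset.mem_univ i))

lemma sq_le_nsq3 (A : Fin 3 → Fin 3 → Fin 3 → ℝ) (i j k : Fin 3) : A i j k ^ 2 ≤ nsq3 A :=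
  (sq_le_nsq2 (A i) j k).trans (Finset.single_le_sum (f := fun i => nsq2 (A i))
    (fun _ _ => nsq2_nonneg _) (Finset.mem_univ i))

lemma measurable_energyDens {α : Type*} [MeasurableSpace α] {u : α → E3}
    {A : α → Fin 3 → Fin 3 → ℝ} (hu : Measurable u) (hA : Measurable A) :
    Measurable (energyDens u A) := by
  unfold energyDens nsq2
  fun_prop

lemma measurable_dissDens {α : Type*} [MeasurableSpace α] {Du : α → Fin 3 → Fin 3 → ℝ}
    {D2 : α → Fin 3 → Fin 3 → Fin 3 → ℝ} (hDu : Measurable Du) (hD2 : Measurable D2) :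
    Measurable (dissDens Du D2) := by
  unfold dissDens nsq2 nsq3
  fun_prop

lemma abs_stress_le_energyDens {α : Type*} (u : α → E3) (A : α → Fin 3 → Fin 3 → ℝ)
    (i j : Fin 3) (x : α) :
    |u x i * u x j + ∑ k, A x k i * A x k j| ≤ energyDens u A x := by
  have hu : ∀ i, |u x i| ≤ ‖u x‖ := fun i => PiLp.norm_apply_le (u x) i
  refine (abs_add_le _ _).trans (add_le_add ?_ ?_)
  · rw [abs_mul, sq]
    exact mul_le_mul (hu i) (hu j) (abs_nonneg _) (norm_nonneg _)
  · refine (Finset.abs_sum_le_sum_abs _ _).trans (Finset.sum_le_sum fun k _ => ?_)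
    have q : ∀ l, |A x k l| ≤ √(∑ j, A x k j ^ 2) := fun l => Real.abs_le_sqrt
      (Finset.single_le_sum (f := fun j => A x k j ^ 2) (fun _ _ => sq_nonneg _)
        (Finset.mem_univ l))
    rw [abs_mul]
    refine (mul_le_mul (q i) (q j) (abs_nonneg _) (Real.sqrt_nonneg _)).trans_eq ?_
    exact Real.mul_self_sqrt (Finset.sum_nonneg fun _ _ => sq_nonneg _)

/-- Estimates on a single time slice. -/
lemma exists_slice_bound : ∃ C : ℝ, 0 ≤ C ∧ ∀ (x₀ : E3) (u : E3 → E3) (p : E3 → ℝ)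
    (Du A : E3 → Fin 3 → Fin 3 → ℝ) (D2 : E3 → Fin 3 → Fin 3 → Fin 3 → ℝ) (n : ℕ) (Λ : ℝ),
    2 ≤ n → 0 ≤ Λ → Measurable u → Measurable p → Measurable Du → Measurable A →
    Measurable D2 → IntegrableOn p (Metric.ball x₀ (1 / 2)) →
    IntegrableOn (energyDens u A) (Metric.ball x₀ (1 / 2)) →
    IntegrableOn (dissDens Du D2) (Metric.ball x₀ (rdy n)) →
    (∀ k, 2 ≤ k → k ≤ n →
      ∫ x in Metric.ball x₀ (rdy k), energyDens u A x ≤ vol1 * Λ * rdy k ^ 3) →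
    (∀ i, WeakGrad (Metric.ball x₀ (1 / 2)) (fun x => u x i) (fun j x => Du x i j)) →
    (∀ i k, WeakGrad (Metric.ball x₀ (1 / 2)) (fun x => A x i k) (fun j x => D2 x i j k)) →
    (∀ φ, IsSpaceTest (Metric.ball x₀ (1 / 2)) φ →
      -∫ x in Metric.ball x₀ (1 / 2), p x * ∑ j, pd j (pd j φ) x =
        ∫ x in Metric.ball x₀ (1 / 2), ∑ i, ∑ j,
          (u x i * u x j + ∑ k, A x k i * A x k j) * pd i (pd j φ) x) →
    ∫⁻ x in Metric.ball x₀ (rdy (n + 1)), ENNReal.ofReal (‖u x‖ ^ 3 + √(nsq2 (A x)) ^ 3) ≤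
      ENNReal.ofReal (C * (√(rdy (n + 1) ^ 3) * √Λ) * (√(rdy (n + 1) ^ 3) * Λ
        + √(rdy (n + 1)) * ∫ x in Metric.ball x₀ (rdy n), dissDens Du D2 x)) ∧
    ∫⁻ x in Metric.ball x₀ (rdy (n + 1)),
        ENNReal.ofReal (‖u x‖ * |p x - ⨍ y in Metric.ball x₀ (rdy (n + 1)), p y|) ≤
      ENNReal.ofReal (C * (√(rdy (n + 1) ^ 3) * √Λ) * (√(rdy (n + 1) ^ 3) * Λ
        + √(rdy (n + 1)) * (∫ x in Metric.ball x₀ (rdy n), dissDens Du D2 x)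
        + √(rdy (n + 1) ^ 3) * rdy (n + 1) * ∫ x in Metric.ball x₀ (1 / 2), |p x|)) := by
  obtain ⟨CL, hCL, hL⟩ := exists_ladyzhenskaya_sum (Fin 3 ⊕ Fin 3 × Fin 3)
  obtain ⟨CP, hCP, hP⟩ := exists_pressure_osc
  have hv1 := vol1_pos
  set s := √(8 * vol1) with hs
  set M := CL * (8 * vol1 + 1) with hM
  have hs0 : 0 ≤ s := Real.sqrt_nonneg _
  have hM0 : 0 ≤ M := by positivity
  refine ⟨2 * s * M + CP * s * (M + vol1 + 1), by positivity, ?_⟩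
  intro x₀ u p Du A D2 n Λ hn hΛ hu hp hDu hA hD2 hpi hei hdi hk hwu hwA heq
  set r := rdy (n + 1) with hr
  have hr0 : 0 < r := rdy_pos _
  have h2r : rdy n = 2 * r := by rw [hr, rdy_succ]; ring
  have h2rh : 2 * r ≤ 1 / 2 := by
    rw [← h2r]
    have := rdy_anti hn
    rw [rdy_two] at this
    linarith
  rw [h2r] at hdi ⊢
  set Φ := energyDens u A with hΦ
  set a := √(r ^ 3) with ha
  have ha0 : 0 < a := Real.sqrt_pos.2 (by positivity)
  have ha2 : a * a = r ^ 3 := Real.mul_self_sqrt (by positivity)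
  set E := ∫ x in Metric.ball x₀ (2 * r), dissDens Du D2 x with hE
  have hE0 : 0 ≤ E := integral_nonneg fun x => dissDens_nonneg _ _ _
  have hΦm : Measurable Φ := measurable_energyDens hu hA
  have hΦ0 : ∀ x, 0 ≤ Φ x := energyDens_nonneg u A
  have hsub2 : Metric.ball x₀ (2 * r) ⊆ Metric.ball x₀ (1 / 2) := Metric.ball_subset_ball h2rh
  have hsubr : Metric.ball x₀ r ⊆ Metric.ball x₀ (3 / 2 * r) :=
    Metric.ball_subset_ball (by linarith)
  have hsubr2 : Metric.ball x₀ r ⊆ Metric.ball x₀ (2 * r) :=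
    Metric.ball_subset_ball (by linarith)
  have hΦ2r : ∫ x in Metric.ball x₀ (2 * r), Φ x ≤ 8 * vol1 * (r ^ 3 * Λ) := by
    have := hk n hn le_rfl
    rw [h2r] at this
    refine this.trans_eq (by ring)
  have hΦr : √(∫ x in Metric.ball x₀ r, Φ x) ≤ s * (a * √Λ) := by
    rw [hs, ha, ← Real.sqrt_mul (by positivity), ← Real.sqrt_mul (by positivity)]
    exact Real.sqrt_le_sqrt ((setIntegral_mono_set (hei.mono_set hsub2) (ae_of_all _ hΦ0)
      hsubr2.eventuallyLE).trans hΦ2r)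
  -- the fourth-power estimate
  have hrestr : ∀ {v : E3 → ℝ} {G : Fin 3 → E3 → ℝ}, WeakGrad (Metric.ball x₀ (1 / 2)) v G →
      WeakGrad (Metric.ball x₀ (2 * r)) v G := by
    intro v G h j φ hφ
    have key : ∀ (f g : E3 → ℝ), tsupport g ⊆ Metric.ball x₀ (2 * r) →
        ∫ x in Metric.ball x₀ (1 / 2), f x * g x = ∫ x in Metric.ball x₀ (2 * r), f x * g x :=
      fun f g hg => setIntegral_eq_of_subset_of_forall_sdiff_eq_zero measurableSet_ball hsub2
        fun x hx => by rw [image_eq_zero_of_notMem_tsupport fun h => hx.2 (hg h), mul_zero]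
    rw [← key _ _ (hφ.pd j).2.2, ← key _ _ hφ.2.2]
    exact h j φ ⟨hφ.1, hφ.2.1, hφ.2.2.trans hsub2⟩
  have hcsum : ∀ x, ∑ α : Fin 3 ⊕ Fin 3 × Fin 3,
      Sum.elim (fun i x => u x i) (fun ik x => A x ik.1 ik.2) α x ^ 2 = Φ x := fun x => by
    simp [hΦ, energyDens, nsq2, Fintype.sum_sum_type, Fintype.sum_prod_type,
      EuclideanSpace.norm_sq_eq]
  have hGsum : ∀ x, ∑ α : Fin 3 ⊕ Fin 3 × Fin 3, ∑ j,
      Sum.elim (fun i j x => Du x i j) (fun ik j x => D2 x ik.1 j ik.2) α j x ^ 2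
        = dissDens Du D2 x := fun x => by
    simp only [dissDens, nsq2, nsq3, Fintype.sum_sum_type, Fintype.sum_prod_type, Sum.elim_inl,
      Sum.elim_inr]
    congr 1
    exact Finset.sum_congr rfl fun i _ => Finset.sum_comm
  obtain ⟨hΦ2, hΦ4⟩ := hL x₀ r (Sum.elim (fun i x => u x i) fun ik x => A x ik.1 ik.2)
    (Sum.elim (fun i j x => Du x i j) fun ik j x => D2 x ik.1 j ik.2) hr0
    (by rintro (i | ⟨i, k⟩) <;> simp only [Sum.elim_inl, Sum.elim_inr] <;> fun_prop)
    (by rintro (i | ⟨i, k⟩) j <;> simp only [Sum.elim_inl, Sum.elim_inr] <;> fun_prop)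
    (by simp only [hcsum]; exact hei.mono_set hsub2) (by simp only [hGsum]; exact hdi)
    (by
      rintro (i | ⟨i, k⟩)
      · exact hrestr (hwu i)
      · exact hrestr (hwA i k))
  simp only [hcsum, hGsum] at hΦ2 hΦ4
  have hΦ4' : √(∫ x in Metric.ball x₀ (3 / 2 * r), Φ x ^ 2) ≤ M * (a * Λ + √r * E) := by
    have q1 : a⁻¹ * (∫ x in Metric.ball x₀ (2 * r), Φ x) ≤ 8 * vol1 * (a * Λ) := by
      rw [inv_mul_le_iff₀ ha0]
      refine hΦ2r.trans_eq ?_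
      rw [← ha2]
      ring
    have q2 : 0 ≤ a * Λ := by positivity
    have q3 : 0 ≤ √r * E := by positivity
    calc _ ≤ CL * (a⁻¹ * (∫ x in Metric.ball x₀ (2 * r), Φ x) + √r * E) := hΦ4
      _ ≤ CL * ((8 * vol1 + 1) * (a * Λ + √r * E)) := by
          gcongr
          nlinarith
      _ = _ := by rw [hM]; ring
  constructor
  · have hpt : ∀ x, ‖u x‖ ^ 3 + √(nsq2 (A x)) ^ 3 ≤ 2 * (|√(Φ x)| * |Φ x|) := fun x => by
      rw [abs_of_nonneg (Real.sqrt_nonneg _), abs_of_nonneg (hΦ0 x)]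
      have q : ∀ y, 0 ≤ y → y ^ 2 ≤ Φ x → y ^ 3 ≤ √(Φ x) * Φ x := fun y hy hyΦ => by
        rw [pow_succ, mul_comm]
        exact mul_le_mul (Real.le_sqrt_of_sq_le hyΦ) hyΦ (sq_nonneg _) (Real.sqrt_nonneg _)
      have q1 := q ‖u x‖ (norm_nonneg _) (le_add_of_nonneg_right (nsq2_nonneg _))
      have q2 := q (√(nsq2 (A x))) (Real.sqrt_nonneg _) (by
        rw [Real.sq_sqrt (nsq2_nonneg _)]
        exact le_add_of_nonneg_left (sq_nonneg _))
      linarith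
    have hΦi : IntegrableOn (fun x => √(Φ x) ^ 2) (Metric.ball x₀ r) := by
      simp only [Real.sq_sqrt (hΦ0 _)]
      exact hei.mono_set (hsubr2.trans hsub2)
    have hmul : IntegrableOn (fun x => 2 * (|√(Φ x)| * |Φ x|)) (Metric.ball x₀ r) := by
      refine Integrable.const_mul (Integrable.mono' (hΦi.add (hΦ2.mono_set hsubr))
        (hΦm.sqrt.abs.mul hΦm.abs).aestronglyMeasurable (ae_of_all _ fun x => ?_)) 2
      change ‖|√(Φ x)| * |Φ x|‖ ≤ √(Φ x) ^ 2 + Φ x ^ 2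
      rw [Real.norm_of_nonneg (by positivity)]
      nlinarith [sq_nonneg (|√(Φ x)| - |Φ x|), sq_abs (√(Φ x)), sq_abs (Φ x)]
    refine (lintegral_mono fun x => ENNReal.ofReal_le_ofReal (hpt x)).trans ?_
    rw [← ofReal_integral_eq_lintegral_ofReal hmul (ae_of_all _ fun x => by positivity),
      integral_const_mul]
    refine ENNReal.ofReal_le_ofReal ?_
    have hcs := integral_abs_mul_le_sqrt (μ := volume.restrict (Metric.ball x₀ r))
      hΦm.sqrt.aestronglyMeasurable hΦm.aestronglyMeasurable hΦi (hΦ2.mono_set hsubr)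
    simp only [Real.sq_sqrt (hΦ0 _)] at hcs
    calc _ ≤ 2 * (√(∫ x in Metric.ball x₀ r, Φ x) * √(∫ x in Metric.ball x₀ r, Φ x ^ 2)) :=
          mul_le_mul_of_nonneg_left hcs zero_le_two
      _ ≤ 2 * (s * (a * √Λ) * (M * (a * Λ + √r * E))) := by
          gcongr
          exact (Real.sqrt_le_sqrt (setIntegral_mono_set hΦ2 (ae_of_all _ fun x => sq_nonneg _)
            hsubr.eventuallyLE)).trans hΦ4'
      _ = 2 * s * M * (a * √Λ) * (a * Λ + √r * E) := by ring
      _ ≤ _ := by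
          gcongr
          exact le_add_of_nonneg_right (by positivity)
  · have hU2 : IntegrableOn (fun x => ‖u x‖ ^ 2) (Metric.ball x₀ r) :=
      Integrable.mono' (hei.mono_set (hsubr2.trans hsub2))
        (hu.norm.pow_const 2).aestronglyMeasurable (ae_of_all _ fun x => by
          rw [Real.norm_of_nonneg (sq_nonneg _)]
          exact le_add_of_nonneg_right (nsq2_nonneg _))
    have key := hP x₀ p Φ (fun x => ‖u x‖) (fun i j x => u x i * u x j + ∑ k, A x k i * A x k j)
      n (vol1 * Λ) hn (by positivity)
      ⟨hpi, fun i j => by fun_prop, fun i j x => abs_stress_le_energyDens u A i j x, hei, heq⟩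
      hp hu.norm (fun x => norm_nonneg _) hU2 hk hΦ2
    refine key.trans (ENNReal.ofReal_le_ofReal ?_)
    rw [← hr, ← ha]
    set P := ∫ x in Metric.ball x₀ (1 / 2), |p x| with hPdef
    have hP0 : 0 ≤ P := integral_nonneg fun x => abs_nonneg _
    have hUΦ : √(∫ x in Metric.ball x₀ r, ‖u x‖ ^ 2) ≤ s * (a * √Λ) :=
      (Real.sqrt_le_sqrt (integral_mono hU2 (hei.mono_set (hsubr2.trans hsub2)) fun x =>
        le_add_of_nonneg_right (nsq2_nonneg _))).trans hΦr
    have q1 : 0 ≤ a * Λ := by positivity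
    have q2 : 0 ≤ √r * E := by positivity
    have q3 : 0 ≤ a * r * P := by positivity
    calc _ ≤ CP * (s * (a * √Λ)) * (M * (a * Λ + √r * E) + a * (vol1 * Λ + r * P)) := by
          gcongr
      _ ≤ CP * (s * (a * √Λ)) * ((M + vol1 + 1) * (a * Λ + √r * E + a * r * P)) := by
          gcongr
          nlinarith [mul_nonneg hM0 q3, mul_nonneg hv1.le q2, mul_nonneg hv1.le q3]
      _ = CP * s * (M + vol1 + 1) * (a * √Λ) * (a * Λ + √r * E + a * r * P) := by ring
      _ ≤ _ := by
          gcongr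
          exact le_add_of_nonneg_left (by positivity)

lemma volume_ball_eq (x₀ : E3) {r : ℝ} (hr : 0 ≤ r) :
    volume (Metric.ball x₀ r) = ENNReal.ofReal (vol1 * r ^ 3) := by
  rw [← volume_real_ball x₀ hr]
  exact (ENNReal.ofReal_toReal measure_ball_lt_top.ne).symm

lemma measurableSet_Qcyl (z : SpT) (r : ℝ) : MeasurableSet (Qcyl z r) :=
  measurableSet_ball.prod measurableSet_Ioo

lemma volume_Qcyl (z : SpT) {r : ℝ} (hr : 0 ≤ r) :
    volume (Qcyl z r) = ENNReal.ofReal (vol1 * r ^ 5) := by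
  have := vol1_pos
  rw [Qcyl, Measure.volume_eq_prod, Measure.prod_prod, ball3, volume_ball_eq _ hr,
    Real.volume_Ioo, ← ENNReal.ofReal_mul (by positivity)]
  congr 1
  ring

lemma setLIntegral_prod_swap {B : Set E3} {I : Set ℝ} {g : SpT → ℝ≥0∞} (hg : Measurable g) :
    ∫⁻ z in B ×ˢ I, g z = ∫⁻ t in I, ∫⁻ x in B, g (x, t) := by
  rw [restrict_prod_eq, lintegral_prod_symm' _ hg]

lemma measurable_setLIntegral_slice {B : Set E3} {g : SpT → ℝ≥0∞} (hg : Measurable g) :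
    Measurable fun t => ∫⁻ x in B, g (x, t) := hg.lintegral_prod_left'

/-- Integrating slice estimates in time. -/
lemma setLIntegral_prod_le_of_ae_slice {B B' B'' : Set E3} {I : Set ℝ} {g : SpT → ℝ≥0∞}
    {D p : SpT → ℝ} {k α β b : ℝ} (hg : Measurable g) (hD : Measurable D) (hp : Measurable p)
    (hD0 : ∀ z, 0 ≤ D z) (hk : 0 ≤ k) (hα : 0 ≤ α) (hβ : 0 ≤ β) (hb : 0 ≤ b)
    (hDi : ∀ᵐ t ∂volume.restrict I, IntegrableOn (fun x => D (x, t)) B')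
    (hpi : ∀ᵐ t ∂volume.restrict I, IntegrableOn (fun x => p (x, t)) B'')
    (h : ∀ᵐ t ∂volume.restrict I, ∫⁻ x in B, g (x, t) ≤ ENNReal.ofReal
      (k * (α + β * (∫ x in B', D (x, t)) + b * ∫ x in B'', |p (x, t)|))) :
    ∫⁻ z in B ×ˢ I, g z ≤ ENNReal.ofReal (k * α) * volume I
      + ENNReal.ofReal (k * β) * (∫⁻ z in B' ×ˢ I, ENNReal.ofReal (D z))
      + ENNReal.ofReal (k * b) * ∫⁻ z in B'' ×ˢ I, ENNReal.ofReal |p z| := by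
  have hDm := hD.ennreal_ofReal
  have hpm := hp.abs.ennreal_ofReal
  rw [setLIntegral_prod_swap hg, setLIntegral_prod_swap hDm, setLIntegral_prod_swap hpm,
    ← lintegral_const_mul _ (measurable_setLIntegral_slice hDm),
    ← lintegral_const_mul _ (measurable_setLIntegral_slice hpm), ← setLIntegral_const,
    ← lintegral_add_left measurable_const, ← lintegral_add_right _
      ((measurable_setLIntegral_slice hpm).const_mul _)]
  refine lintegral_mono_ae ?_
  filter_upwards [h, hDi, hpi] with t ht hDt hpt
  refine ht.trans_eq ?_
  have e1 : 0 ≤ ∫ x in B', D (x, t) := integral_nonneg fun x => hD0 _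
  have e2 : 0 ≤ ∫ x in B'', |p (x, t)| := integral_nonneg fun x => abs_nonneg _
  rw [← ofReal_integral_eq_lintegral_ofReal hDt (ae_of_all _ fun x => hD0 _),
    ← ofReal_integral_eq_lintegral_ofReal hpt.abs (ae_of_all _ fun x => abs_nonneg _),
    ← ENNReal.ofReal_mul (by positivity), ← ENNReal.ofReal_mul (by positivity),
    ← ENNReal.ofReal_add (by positivity) (by positivity),
    ← ENNReal.ofReal_add (by positivity) (by positivity)]
  congr 1
  ring

lemma ae_energy_of_Ldy_le {u : SpT → E3} {Du Dd : SpT → Fin 3 → Fin 3 → ℝ}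
    {D2d : SpT → Fin 3 → Fin 3 → Fin 3 → ℝ} {z₀ : SpT} {k : ℕ} {Λ : ℝ}
    (h : Ldy u Du Dd D2d z₀ k ≤ ENNReal.ofReal Λ) :
    ∀ᵐ t ∂volume.restrict (Ioo (z₀.2 - rdy k ^ 2) z₀.2),
      ∫⁻ x in Metric.ball z₀.1 (rdy k), ENNReal.ofReal (energyDens u Dd (x, t)) ≤
        ENNReal.ofReal (vol1 * Λ * rdy k ^ 3) := by
  have hr := rdy_pos k
  have hv := vol1_pos
  filter_upwards [ENNReal.ae_le_essSup fun t => (volume (ball3 z₀.1 (rdy k)))⁻¹ *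
      ∫⁻ x in ball3 z₀.1 (rdy k), ENNReal.ofReal (‖u (x, t)‖ ^ 2 + nsq2 (Dd (x, t)))] with t ht
  have q := (ht.trans le_self_add).trans h
  rw [ball3, volume_ball_eq _ hr.le, ENNReal.inv_mul_le_iff (by simp; positivity) (by simp),
    ← ENNReal.ofReal_mul (by positivity)] at q
  refine q.trans_eq ?_
  congr 1
  ring

lemma dissipation_of_Ldy_le {u : SpT → E3} {Du Dd : SpT → Fin 3 → Fin 3 → ℝ}
    {D2d : SpT → Fin 3 → Fin 3 → Fin 3 → ℝ} {z₀ : SpT} {k : ℕ} {Λ : ℝ}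
    (h : Ldy u Du Dd D2d z₀ k ≤ ENNReal.ofReal Λ) :
    ∫⁻ z in Qcyl z₀ (rdy k), ENNReal.ofReal (dissDens Du D2d z) ≤
      ENNReal.ofReal (vol1 * Λ * rdy k ^ 3) := by
  have hr := rdy_pos k
  have hv := vol1_pos
  have q := le_add_self.trans h
  rw [ball3, volume_ball_eq _ hr.le, ENNReal.inv_mul_le_iff (by simp; positivity) (by simp),
    ← ENNReal.ofReal_mul (by positivity)] at q
  refine q.trans_eq ?_
  congr 1
  ring

lemma Qcyl_half_subset {z₀ z : SpT} (hz : z₀ ∈ Qcyl z (1 / 2)) : Qcyl z₀ (1 / 2) ⊆ Qcyl z 1 := by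
  rintro ⟨x, t⟩ ⟨hx, ht1, ht2⟩
  obtain ⟨hx₀, h1, h2⟩ := hz
  simp only [ball3, Metric.mem_ball] at *
  refine ⟨?_, ?_, ?_⟩
  · have := dist_triangle x z₀.1 z.1
    simp only [ball3, Metric.mem_ball]
    linarith
  · norm_num at *
    linarith
  · norm_num at *
    linarith

/-- Young's inequality in the form used for the pressure. -/
lemma mul_le_rpow_add {x c : ℝ} (hx : 0 ≤ x) (hc : 0 ≤ c) :
    c * x ≤ x ^ ((3 : ℝ) / 2) + c ^ 3 := by
  have h := Real.young_inequality_of_nonneg hx hc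
    (p := 3 / 2) (q := 3) ⟨by norm_num, by norm_num, by norm_num⟩
  have h1 : 0 ≤ x ^ ((3 : ℝ) / 2) := Real.rpow_nonneg hx _
  have h2 : c ^ (3 : ℝ) = c ^ 3 := by exact_mod_cast Real.rpow_natCast c 3
  rw [h2] at h
  have h3 : 0 ≤ c ^ 3 := by positivity
  linarith

lemma integrableOn_of_abs_le_one_add {S : Set SpT} (hS : volume S ≠ ∞) {f g : SpT → ℝ}
    (hf : Measurable f) (hg : IntegrableOn g S) (h : ∀ z, |f z| ≤ 1 + g z) :
    IntegrableOn f S :=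
  Integrable.mono' ((integrableOn_const hS).add hg) hf.aestronglyMeasurable (ae_of_all _ h)

lemma rdy_one : rdy 1 = 1 / 2 := by norm_num [rdy]

lemma rdy_le_half {k : ℕ} (hk : 1 ≤ k) : rdy k ≤ 1 / 2 := rdy_one ▸ rdy_anti hk

/-- The slice estimates hold at almost every time when the quantities `L_k` are bounded. -/
lemma exists_ae_slice_bound : ∃ C : ℝ, 0 ≤ C ∧ ∀ (xb : E3) (tb : ℝ)
    (u d : SpT → E3) (p : SpT → ℝ) (Du Dd : SpT → Fin 3 → Fin 3 → ℝ)
    (D2d : SpT → Fin 3 → Fin 3 → Fin 3 → ℝ), QReg xb tb u d p Du Dd D2d →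
    PressureEqOn (Qcyl (xb, tb) 1) u p Dd → ∀ z₀ ∈ Qcyl (xb, tb) (1 / 2), ∀ (n : ℕ) (s : ℝ),
    2 ≤ n → 0 ≤ s →
    (∀ k, 1 ≤ k → k ≤ n → Ldy u Du Dd D2d z₀ k ≤ ENNReal.ofReal (s ^ 2)) →
    ∀ᵐ t ∂volume.restrict (Ioo (z₀.2 - rdy (n + 1) ^ 2) z₀.2),
      IntegrableOn (fun x => dissDens Du D2d (x, t)) (Metric.ball z₀.1 (rdy n)) ∧
      IntegrableOn (fun x => p (x, t)) (Metric.ball z₀.1 (1 / 2)) ∧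
      ∫⁻ x in Metric.ball z₀.1 (rdy (n + 1)),
          ENNReal.ofReal (‖u (x, t)‖ ^ 3 + √(nsq2 (Dd (x, t))) ^ 3) ≤
        ENNReal.ofReal (C * (√(rdy (n + 1) ^ 3) * s) * (√(rdy (n + 1) ^ 3) * s ^ 2
          + √(rdy (n + 1)) * ∫ x in Metric.ball z₀.1 (rdy n), dissDens Du D2d (x, t))) ∧
      ∫⁻ x in Metric.ball z₀.1 (rdy (n + 1)), ENNReal.ofReal
          (‖u (x, t)‖ * |p (x, t) - ⨍ y in Metric.ball z₀.1 (rdy (n + 1)), p (y, t)|) ≤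
        ENNReal.ofReal (C * (√(rdy (n + 1) ^ 3) * s) * (√(rdy (n + 1) ^ 3) * s ^ 2
          + √(rdy (n + 1)) * (∫ x in Metric.ball z₀.1 (rdy n), dissDens Du D2d (x, t))
          + √(rdy (n + 1) ^ 3) * rdy (n + 1)
            * ∫ x in Metric.ball z₀.1 (1 / 2), |p (x, t)|)) := by
  obtain ⟨C, hC, hslice⟩ := exists_slice_bound
  refine ⟨C, hC, ?_⟩
  intro xb tb u d p Du Dd D2d hreg hpe z₀ hz₀ n s hn hs hL
  have hv := vol1_pos
  have hu := hreg.meas_u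
  have hp := hreg.meas_p
  have hDu := hreg.meas_Du
  have hDd := hreg.meas_Dd
  have hD2d := hreg.meas_D2d
  set I := Ioo (z₀.2 - (1 / 2) ^ 2) z₀.2 with hI
  set B := Metric.ball z₀.1 (1 / 2) with hB
  have hU : B ×ˢ I ⊆ Qcyl (xb, tb) 1 := Qcyl_half_subset hz₀
  have hUm : MeasurableSet (Qcyl (xb, tb) 1) := measurableSet_Qcyl _ _
  have hfin : volume (B ×ˢ I) ≠ ∞ := by
    change volume (Qcyl z₀ (1 / 2)) ≠ ∞
    rw [volume_Qcyl _ (by norm_num)]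
    exact ENNReal.ofReal_ne_top
  have hsub : ∀ k, 1 ≤ k → Ioo (z₀.2 - rdy k ^ 2) z₀.2 ⊆ I := fun k hk =>
    Ioo_subset_Ioo_left (by
      have := rdy_le_half hk
      have := rdy_pos k
      gcongr)
  have hlow : ∀ k ≤ n, Ioo (z₀.2 - rdy (n + 1) ^ 2) z₀.2 ⊆ Ioo (z₀.2 - rdy k ^ 2) z₀.2 :=
    fun k hk => Ioo_subset_Ioo_left (by
      have := rdy_anti (hk.trans (Nat.le_succ n))
      have := rdy_pos (n + 1)
      gcongr)
  have hen : IntegrableOn (energyDens u Dd) (B ×ˢ I) := by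
    refine ⟨(measurable_energyDens hu hDd).aestronglyMeasurable, ?_⟩
    rw [hasFiniteIntegral_iff_ofReal (ae_of_all _ fun z => energyDens_nonneg _ _ _),
      setLIntegral_prod_swap (measurable_energyDens hu hDd).ennreal_ofReal]
    have q := ae_energy_of_Ldy_le (hL 1 le_rfl (by lia))
    rw [rdy_one] at q
    refine (lintegral_mono_ae q).trans_lt ?_
    rw [setLIntegral_const, Real.volume_Ioo]
    exact ENNReal.mul_lt_top ENNReal.ofReal_lt_top ENNReal.ofReal_lt_top
  have hdi : IntegrableOn (dissDens Du D2d) (B ×ˢ I) :=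
    (hreg.l2_Du.mono_set hU).add (hreg.l2_D2d.mono_set hU)
  have hsq : ∀ y e : ℝ, y ^ 2 ≤ e → |y| ≤ 1 + e := fun y e h => by
    nlinarith [sq_abs y, sq_nonneg (|y| - 1)]
  have hui : ∀ i, IntegrableOn (fun z => u z i) (B ×ˢ I) := fun i =>
    integrableOn_of_abs_le_one_add hfin (by fun_prop) hen fun z => hsq _ _ (by
      have h1 : |u z i| ≤ ‖u z‖ := PiLp.norm_apply_le (u z) i
      rw [← sq_abs]
      exact (pow_le_pow_left₀ (abs_nonneg _) h1 2).trans
        (le_add_of_nonneg_right (nsq2_nonneg _)))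
  have hDdi : ∀ i k, IntegrableOn (fun z => Dd z i k) (B ×ˢ I) := fun i k =>
    integrableOn_of_abs_le_one_add hfin (by fun_prop) hen fun z => hsq _ _
      ((sq_le_nsq2 _ i k).trans (le_add_of_nonneg_left (sq_nonneg _)))
  have hDui : ∀ i j, IntegrableOn (fun z => Du z i j) (B ×ˢ I) := fun i j =>
    integrableOn_of_abs_le_one_add hfin (by fun_prop) hdi fun z => hsq _ _
      ((sq_le_nsq2 _ i j).trans (le_add_of_nonneg_right (nsq3_nonneg _)))
  have hD2i : ∀ i j k, IntegrableOn (fun z => D2d z i j k) (B ×ˢ I) := fun i j k =>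
    integrableOn_of_abs_le_one_add hfin (by fun_prop) hdi fun z => hsq _ _
      ((sq_le_nsq3 _ i j k).trans (le_add_of_nonneg_left (nsq2_nonneg _)))
  have hpi : IntegrableOn p (B ×ˢ I) :=
    integrableOn_of_abs_le_one_add hfin hp (hreg.l32_p.mono_set hU) fun z => by
      have := mul_le_rpow_add (abs_nonneg (p z)) zero_le_one
      linarith
  have hFi : ∀ i j, IntegrableOn (fun z => u z i * u z j + ∑ k, Dd z k i * Dd z k j)
      (B ×ˢ I) := fun i j => integrableOn_of_abs_le_one_add hfin (by fun_prop) hen fun z =>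
    (abs_stress_le_energyDens u Dd i j z).trans (le_add_of_nonneg_left zero_le_one)
  have hIo : IsOpen I := isOpen_Ioo
  have hr1 : 1 ≤ n + 1 := by lia
  have hres : ∀ {P : ℝ → Prop}, (∀ᵐ t ∂volume.restrict I, P t) →
      ∀ᵐ t ∂volume.restrict (Ioo (z₀.2 - rdy (n + 1) ^ 2) z₀.2), P t := fun h =>
    ae_restrict_of_ae_restrict_of_subset (hsub _ hr1) h
  have henk : ∀ᵐ t ∂volume.restrict (Ioo (z₀.2 - rdy (n + 1) ^ 2) z₀.2), ∀ k, 2 ≤ k → k ≤ n →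
      ∫⁻ x in Metric.ball z₀.1 (rdy k), ENNReal.ofReal (energyDens u Dd (x, t)) ≤
        ENNReal.ofReal (vol1 * s ^ 2 * rdy k ^ 3) := by
    refine ae_all_iff.2 fun k => ?_
    by_cases hk : 2 ≤ k ∧ k ≤ n
    · filter_upwards [ae_restrict_of_ae_restrict_of_subset (hlow k hk.2)
        (ae_energy_of_Ldy_le (hL k (by lia) hk.2))] with t ht _ _ using ht
    · exact ae_of_all _ fun t h1 h2 => absurd ⟨h1, h2⟩ hk
  filter_upwards [henk, hres (ae_slice_integrableOn hen), hres (ae_slice_integrableOn hdi),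
    hres (ae_slice_integrableOn hpi),
    hres (ae_all_iff.2 fun i => (hreg.grad_u i).ae_slice hIo hU hUm (hui i) fun j => hDui i j),
    hres (ae_all_iff.2 fun i => ae_all_iff.2 fun k =>
      (hreg.grad_Dd i k).ae_slice hIo hU hUm (hDdi i k) fun j => hD2i i j k),
    hres (hpe.ae_slice hIo hU hUm hpi hFi)] with t h1 h2 h3 h4 h5 h6 h7
  have h3' := h3.mono_set (Metric.ball_subset_ball (rdy_le_half (by lia : 1 ≤ n)) :
    Metric.ball z₀.1 (rdy n) ⊆ B)
  have key := hslice z₀.1 (fun x => u (x, t)) (fun x => p (x, t)) (fun x => Du (x, t))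
    (fun x => Dd (x, t)) (fun x => D2d (x, t)) n (s ^ 2) hn (sq_nonneg s) (by fun_prop)
    (by fun_prop) (by fun_prop) (by fun_prop) (by fun_prop) h4 h2 h3'
    (fun k hk hkn => by
      have hki : IntegrableOn (fun x => energyDens u Dd (x, t)) (Metric.ball z₀.1 (rdy k)) :=
        h2.mono_set (Metric.ball_subset_ball (rdy_le_half (by lia)))
      have := h1 k hk hkn
      rw [← ofReal_integral_eq_lintegral_ofReal hki
        (ae_of_all _ fun x => energyDens_nonneg _ _ _)] at this
      have hrk := rdy_pos k
      exact (ENNReal.ofReal_le_ofReal_iff (by positivity)).1 this)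
    h5 h6 h7
  rw [Real.sqrt_sq hs] at key
  exact ⟨h3', h4, key⟩

/-- Proposition `la`: there is a universal `C_A > 0` with
`R_{n+1}(z₀) ≤ C_A (max_{1≤k≤n} L_k(z₀)^{3/2} + ‖p‖_{L^{3/2}(Q_{1/2}(z₀))}^{3/2})`. -/
theorem stmt3 :
    ∃ CA : ℝ, 0 < CA ∧
      ∀ (xb : E3) (tb : ℝ)
        (u d : SpT → E3) (p : SpT → ℝ) (Du Dd : SpT → Fin 3 → Fin 3 → ℝ)
        (D2d : SpT → Fin 3 → Fin 3 → Fin 3 → ℝ),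
      QReg xb tb u d p Du Dd D2d →
      PressureEqOn (Qcyl (xb, tb) 1) u p Dd →
      ∀ z₀ ∈ Qcyl (xb, tb) (1 / 2), ∀ n : ℕ, 2 ≤ n →
      Rdy u p Dd z₀ (n + 1) ≤ ENNReal.ofReal CA *
        ((⨆ k ∈ Icc 1 n, Ldy u Du Dd D2d z₀ k ^ ((3 : ℝ) / 2)) +
          ∫⁻ z in Qcyl z₀ (1 / 2), ENNReal.ofReal (|p z| ^ ((3 : ℝ) / 2))) := by
  obtain ⟨C, hC, hslice⟩ := exists_ae_slice_bound
  have hv := vol1_pos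
  set A := C * (1 + 8 * vol1) / vol1 with hA
  have hA0 : 0 ≤ A := by positivity
  refine ⟨2 * A + C / vol1 * (1 + vol1 / 8) + 1, by positivity, ?_⟩
  intro xb tb u d p Du Dd D2d hreg hpe z₀ hz₀ n hn
  set S := ⨆ k ∈ Icc 1 n, Ldy u Du Dd D2d z₀ k ^ ((3 : ℝ) / 2) with hS
  set P := ∫⁻ z in Qcyl z₀ (1 / 2), ENNReal.ofReal (|p z| ^ ((3 : ℝ) / 2)) with hP
  by_cases hStop : S = ∞
  · rw [hStop, top_add, ENNReal.mul_top (by simp; positivity)]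
    exact le_top
  set s := S.toReal ^ ((1 : ℝ) / 3) with hs
  have hs0 : 0 ≤ s := Real.rpow_nonneg ENNReal.toReal_nonneg _
  have hs3 : ENNReal.ofReal (s ^ 3) = S := by
    rw [hs, ← Real.rpow_natCast, ← Real.rpow_mul ENNReal.toReal_nonneg]
    norm_num [ENNReal.ofReal_toReal hStop]
  have hL : ∀ k, 1 ≤ k → k ≤ n → Ldy u Du Dd D2d z₀ k ≤ ENNReal.ofReal (s ^ 2) := by
    intro k h1 h2
    have q : Ldy u Du Dd D2d z₀ k ^ ((3 : ℝ) / 2) ≤ S :=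
      le_iSup₂ (f := fun k (_ : k ∈ Icc 1 n) => Ldy u Du Dd D2d z₀ k ^ ((3 : ℝ) / 2)) k ⟨h1, h2⟩
    rw [← ENNReal.rpow_le_rpow_iff (z := (3 : ℝ) / 2) (by norm_num)]
    refine q.trans_eq ?_
    rw [ENNReal.ofReal_rpow_of_nonneg (sq_nonneg s) (by norm_num), ← hs3,
      ← Real.rpow_natCast s 2, ← Real.rpow_mul hs0, ← Real.rpow_natCast s 3]
    norm_num
  have hae := hslice xb tb u d p Du Dd D2d hreg hpe z₀ hz₀ n s hn hs0 hL
  have hdiss := dissipation_of_Ldy_le (hL n (by lia) le_rfl)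
  set r := rdy (n + 1) with hr
  have hr0 : 0 < r := rdy_pos _
  have hrh : r ≤ 1 / 2 := rdy_le_half (by lia)
  have h2r : rdy n = 2 * r := by rw [hr, rdy_succ]; ring
  set I := Ioo (z₀.2 - r ^ 2) z₀.2 with hI
  have hIvol : volume I = ENNReal.ofReal (r ^ 2) := by
    rw [hI, Real.volume_Ioo]
    congr 1
    ring
  set a := √(r ^ 3) with ha
  have ha0 : 0 ≤ a := Real.sqrt_nonneg _
  have ha2 : a * a = r ^ 3 := Real.mul_self_sqrt (by positivity)
  have har : a * √r = r ^ 2 := by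
    rw [ha, ← Real.sqrt_mul (by positivity), ← pow_succ, show r ^ (3 + 1) = (r ^ 2) ^ 2 by ring,
      Real.sqrt_sq (by positivity)]
  have hdm := measurable_dissDens hreg.meas_Du hreg.meas_D2d
  have hDI : ∫⁻ z in Metric.ball z₀.1 (rdy n) ×ˢ I, ENNReal.ofReal (dissDens Du D2d z) ≤
      ENNReal.ofReal (vol1 * s ^ 2 * (2 * r) ^ 3) := by
    rw [← h2r]
    refine (lintegral_mono_set (prod_mono subset_rfl (Ioo_subset_Ioo_left ?_))).trans hdiss
    rw [h2r]
    nlinarith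
  have hmain : ENNReal.ofReal (C * (a * s) * (a * s ^ 2)) * volume I
      + ENNReal.ofReal (C * (a * s) * √r)
        * (∫⁻ z in Metric.ball z₀.1 (rdy n) ×ˢ I, ENNReal.ofReal (dissDens Du D2d z)) ≤
      ENNReal.ofReal (vol1 * r ^ 5) * (ENNReal.ofReal A * S) := by
    refine (add_le_add_right (mul_le_mul_right hDI _) _).trans_eq ?_
    rw [hIvol, ← hs3, ← ENNReal.ofReal_mul (by positivity), ← ENNReal.ofReal_mul (by positivity),
      ← ENNReal.ofReal_mul (by positivity), ← ENNReal.ofReal_mul (by positivity),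
      ← ENNReal.ofReal_add (by positivity) (by positivity)]
    congr 1
    rw [show C * (a * s) * (a * s ^ 2) * r ^ 2 + C * (a * s) * √r * (vol1 * s ^ 2 * (2 * r) ^ 3)
      = C * s ^ 3 * (a * a * r ^ 2 + (a * √r) * (8 * vol1 * r ^ 3)) by ring, ha2, har, hA]
    field_simp
  have hvolQ : volume (Qcyl z₀ r) = ENNReal.ofReal (vol1 * r ^ 5) := volume_Qcyl z₀ hr0.le
  have hQ0 : ENNReal.ofReal (vol1 * r ^ 5) ≠ 0 := by simp; positivity
  have hu := hreg.meas_u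
  have hp := hreg.meas_p
  have hDd := hreg.meas_Dd
  have hcubic : (volume (Qcyl z₀ r))⁻¹ *
      ∫⁻ z in Qcyl z₀ r, ENNReal.ofReal (‖u z‖ ^ 3 + √(nsq2 (Dd z)) ^ 3) ≤
        ENNReal.ofReal A * S := by
    rw [hvolQ, ENNReal.inv_mul_le_iff hQ0 ENNReal.ofReal_ne_top]
    refine le_trans ?_ hmain
    have q := setLIntegral_prod_le_of_ae_slice (B := Metric.ball z₀.1 r) (I := I)
      (B' := Metric.ball z₀.1 (rdy n)) (B'' := Metric.ball z₀.1 (1 / 2))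
      (g := fun z => ENNReal.ofReal (‖u z‖ ^ 3 + √(nsq2 (Dd z)) ^ 3))
      (D := dissDens Du D2d) (p := p) (k := C * (a * s)) (α := a * s ^ 2) (β := √r) (b := 0)
      (by unfold nsq2; fun_prop) hdm hp (dissDens_nonneg _ _) (by positivity) (by positivity)
      (by positivity) le_rfl (hae.mono fun t h => h.1) (hae.mono fun t h => h.2.1)
      (hae.mono fun t h => by simpa only [zero_mul, add_zero] using h.2.2.1)
    simp only [mul_zero, ENNReal.ofReal_zero, zero_mul, add_zero] at q
    exact q
  -- the pressure term
  set ρ := r ^ ((1 : ℝ) / 3) with hρ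
  have hρ0 : 0 < ρ := Real.rpow_pos_of_pos hr0 _
  have hρ3 : ρ ^ 3 = r := by
    rw [hρ, ← Real.rpow_natCast, ← Real.rpow_mul hr0.le]
    norm_num
  have hρ1 : ρ ≤ 1 := Real.rpow_le_one hr0.le (by linarith) (by norm_num)
  set J := ∫⁻ z in Metric.ball z₀.1 (1 / 2) ×ˢ I, ENNReal.ofReal |p z| with hJ
  have hJP : ENNReal.ofReal (s / ρ ^ 2) * J ≤ P + ENNReal.ofReal (vol1 / 8) * S := by
    have hvol : volume (Metric.ball z₀.1 (1 / 2) ×ˢ I)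
        = ENNReal.ofReal (vol1 * (1 / 2) ^ 3) * ENNReal.ofReal (r ^ 2) := by
      rw [Measure.volume_eq_prod, Measure.prod_prod, volume_ball_eq _ (by norm_num), hIvol]
    rw [hJ, ← lintegral_const_mul _ hp.abs.ennreal_ofReal]
    calc ∫⁻ z in Metric.ball z₀.1 (1 / 2) ×ˢ I,
          ENNReal.ofReal (s / ρ ^ 2) * ENNReal.ofReal |p z|
        ≤ ∫⁻ z in Metric.ball z₀.1 (1 / 2) ×ˢ I,
          (ENNReal.ofReal (|p z| ^ ((3 : ℝ) / 2)) + ENNReal.ofReal ((s / ρ ^ 2) ^ 3)) := by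
          refine lintegral_mono fun z => ?_
          rw [← ENNReal.ofReal_mul (by positivity), ← ENNReal.ofReal_add (by positivity)
            (by positivity)]
          exact ENNReal.ofReal_le_ofReal (mul_le_rpow_add (abs_nonneg _) (by positivity))
      _ = (∫⁻ z in Metric.ball z₀.1 (1 / 2) ×ˢ I, ENNReal.ofReal (|p z| ^ ((3 : ℝ) / 2)))
          + ENNReal.ofReal (vol1 / 8) * S := by
          rw [lintegral_add_right _ measurable_const, setLIntegral_const, hvol, ← hs3,
            ← ENNReal.ofReal_mul (by positivity), ← ENNReal.ofReal_mul (by positivity),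
            ← ENNReal.ofReal_mul (by positivity)]
          congr 2
          rw [← hρ3]
          field_simp
          ring
      _ ≤ _ := by
          refine add_le_add_left (lintegral_mono_set (prod_mono subset_rfl
            (Ioo_subset_Ioo_left ?_))) _
          nlinarith
  have hpress : ENNReal.ofReal ρ * ((volume (Qcyl z₀ r))⁻¹ * ∫⁻ z in Qcyl z₀ r,
      ENNReal.ofReal (‖u z‖ * |p z - ⨍ x in ball3 z₀.1 r, p (x, z.2)|)) ≤
        ENNReal.ofReal A * S
          + ENNReal.ofReal (C / vol1) * (P + ENNReal.ofReal (vol1 / 8) * S) := by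
    have hpm : Measurable fun z : SpT => ⨍ x in ball3 z₀.1 r, p (x, z.2) := by
      simp only [setAverage_eq, smul_eq_mul]
      exact Measurable.const_mul ((hp.stronglyMeasurable.integral_prod_left'
        (μ := volume.restrict (ball3 z₀.1 r))).measurable.comp measurable_snd) _
    have q := setLIntegral_prod_le_of_ae_slice (B := Metric.ball z₀.1 r) (I := I)
      (B' := Metric.ball z₀.1 (rdy n)) (B'' := Metric.ball z₀.1 (1 / 2))
      (g := fun z => ENNReal.ofReal (‖u z‖ * |p z - ⨍ x in ball3 z₀.1 r, p (x, z.2)|))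
      (D := dissDens Du D2d) (p := p) (k := C * (a * s)) (α := a * s ^ 2) (β := √r)
      (b := a * r)
      (hu.norm.mul (hp.sub hpm).abs).ennreal_ofReal hdm hp (dissDens_nonneg _ _)
      (by positivity) (by positivity)
      (by positivity) (by positivity) (hae.mono fun t h => h.1) (hae.mono fun t h => h.2.1)
      (hae.mono fun t h => h.2.2.2)
    have q2 : (volume (Qcyl z₀ r))⁻¹ * ∫⁻ z in Qcyl z₀ r,
        ENNReal.ofReal (‖u z‖ * |p z - ⨍ x in ball3 z₀.1 r, p (x, z.2)|) ≤
        ENNReal.ofReal A * S + ENNReal.ofReal (C * s / (vol1 * r)) * J := by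
      rw [hvolQ, ENNReal.inv_mul_le_iff hQ0 ENNReal.ofReal_ne_top, mul_add]
      refine q.trans (add_le_add hmain (le_of_eq ?_))
      rw [← mul_assoc (ENNReal.ofReal (vol1 * r ^ 5)), ← ENNReal.ofReal_mul (by positivity)]
      congr 2
      rw [show C * (a * s) * (a * r) = C * s * (a * a * r) by ring, ha2]
      field_simp
    refine (mul_le_mul_right q2 _).trans ?_
    rw [mul_add]
    refine add_le_add (mul_le_of_le_one_left (by positivity)
      (ENNReal.ofReal_le_one.2 hρ1)) ?_
    refine le_trans (le_of_eq ?_) (mul_le_mul_right hJP _)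
    rw [← mul_assoc, ← mul_assoc, ← ENNReal.ofReal_mul (by positivity),
      ← ENNReal.ofReal_mul (by positivity)]
    congr 2
    rw [← hρ3]
    field_simp
  calc Rdy u p Dd z₀ (n + 1)
      ≤ ENNReal.ofReal A * S + (ENNReal.ofReal A * S
          + ENNReal.ofReal (C / vol1) * (P + ENNReal.ofReal (vol1 / 8) * S)) :=
        by
          rw [Rdy, lintegral_add_right _ measurable_const, setLIntegral_const, mul_add,
            mul_comm (ENNReal.ofReal _ * _) (volume _), ← mul_assoc (volume _)⁻¹,
            ENNReal.inv_mul_cancel (by rwa [hvolQ]) (by rw [hvolQ]; exact ENNReal.ofReal_ne_top),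
            one_mul]
          exact add_le_add hcubic hpress
    _ ≤ (ENNReal.ofReal A + ENNReal.ofReal A
          + ENNReal.ofReal (C / vol1) * (1 + ENNReal.ofReal (vol1 / 8)) + 1) * (S + P) := by
        have e : (ENNReal.ofReal A + ENNReal.ofReal A
            + ENNReal.ofReal (C / vol1) * (1 + ENNReal.ofReal (vol1 / 8)) + 1) * (S + P)
          = (ENNReal.ofReal A * S + (ENNReal.ofReal A * S
            + ENNReal.ofReal (C / vol1) * (P + ENNReal.ofReal (vol1 / 8) * S)))
            + (2 * ENNReal.ofReal A * P + ENNReal.ofReal (C / vol1) * S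
              + ENNReal.ofReal (C / vol1) * ENNReal.ofReal (vol1 / 8) * P + S + P) := by ring
        rw [e]
        exact le_self_add
    _ = _ := by
        rw [← ENNReal.ofReal_one,
          ← ENNReal.ofReal_add zero_le_one (by positivity : 0 ≤ vol1 / 8),
          ← ENNReal.ofReal_mul (by positivity), ← ENNReal.ofReal_add hA0 hA0,
          ← ENNReal.ofReal_add (by positivity) (by positivity),
          ← ENNReal.ofReal_add (by positivity) (by positivity)]
        congr 2
        ring
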